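/- arXiv:2012.06412 — 2 statements merged into one kernel-verified Lean document; each statement's English description precedes it below -/
import Mathlib

section
/- For every positive integer n, every J⊆{0,1,…,n−1}, every K⊆{1,…,n} and all natural numbers a,b: the number of fully commutative signed permutations w∈FC(B_n) with Des_B(w)=J, Neg(w)=K, bl(w^{-1})=a and n−ldes(w^{-1})=b equals the number of w∈FC(B_n) with Des_B(w)=J, Neg(w)=K, n−ldes(w^{-1})=a and bl(w^{-1})=b. (Equivalently, Σ_{w∈FC(B_n)} x^{Des_B(w)} z^{Neg(w)} q^{bl(w^{-1})} t^{n−ldes(w^{-1})} = Σ_{w∈FC(B_n)} x^{Des_B(w)} z^{Neg(w)} q^{n−ldes(w^{-1})} t^{bl(w^{-1})}.) -/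
open scoped Classical

noncomputable section

namespace Paper

/-- Membership in the hyperoctahedral group `B_n`, realized inside `Equiv.Perm ℤ`:
`w(-i) = -w(i)` and `w` fixes every integer of absolute value larger than `n`. -/
def InB (n : ℕ) (w : Equiv.Perm ℤ) : Prop :=
  (∀ i : ℤ, w (-i) = - w i) ∧ ∀ i : ℤ, (n : ℤ) < |i| → w i = i

/-- Window entry `w_i` with the convention `w_0 = 0`. -/
def went (w : Equiv.Perm ℤ) (i : ℕ) : ℤ := if i = 0 then 0 else w (i : ℤ)

/-- Stembridge's pattern criterion: `w ∈ B_n` is fully commutative iff there are no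
indices `i<j` with `0 > w_i > w_j`, no `i<j<k` with `|w_i| > w_j > w_k`, and no
`i<j<k` with `-w_j > |w_i| > w_k`. -/
def IsFC (n : ℕ) (w : Equiv.Perm ℤ) : Prop :=
  InB n w ∧
  (¬ ∃ i j : ℕ, 1 ≤ i ∧ i < j ∧ j ≤ n ∧ w (j : ℤ) < w (i : ℤ) ∧ w (i : ℤ) < 0) ∧
  (¬ ∃ i j k : ℕ, 1 ≤ i ∧ i < j ∧ j < k ∧ k ≤ n ∧
      w (j : ℤ) < |w (i : ℤ)| ∧ w (k : ℤ) < w (j : ℤ)) ∧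
  (¬ ∃ i j k : ℕ, 1 ≤ i ∧ i < j ∧ j < k ∧ k ≤ n ∧
      |w (i : ℤ)| < - w (j : ℤ) ∧ w (k : ℤ) < |w (i : ℤ)|)

/-- Membership in `S_n ⊆ B_n`: all window entries positive. -/
def InS (n : ℕ) (w : Equiv.Perm ℤ) : Prop :=
  InB n w ∧ ∀ i : ℕ, 1 ≤ i → i ≤ n → 0 < w (i : ℤ)

/-- 321-avoidance of the window. -/
def Avoids321 (n : ℕ) (w : Equiv.Perm ℤ) : Prop :=
  ¬ ∃ i j k : ℕ, 1 ≤ i ∧ i < j ∧ j < k ∧ k ≤ n ∧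
    w (k : ℤ) < w (j : ℤ) ∧ w (j : ℤ) < w (i : ℤ)

/-- Type-B descent set `Des_B(w) = {0 ≤ i ≤ n-1 : w_i > w_{i+1}}`, convention `w_0 = 0`. -/
def DesB (n : ℕ) (w : Equiv.Perm ℤ) : Finset ℕ :=
  (Finset.range n).filter fun i => went w (i+1) < went w i

/-- Type-A descent set `Des(w) = {1 ≤ i ≤ n-1 : w_i > w_{i+1}}`. -/
def DesA (n : ℕ) (w : Equiv.Perm ℤ) : Finset ℕ :=
  (Finset.Ico 1 n).filter fun i => went w (i+1) < went w i

/-- Last descent: `ldes(w) = max (Des_B(w) ∪ {0})`. -/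
def ldes (n : ℕ) (w : Equiv.Perm ℤ) : ℕ := (DesB n w).sup id

/-- `Neg(w) = {1 ≤ i ≤ n : w_i < 0}`. -/
def NegSet (n : ℕ) (w : Equiv.Perm ℤ) : Finset ℕ :=
  (Finset.Icc 1 n).filter fun i => w (i : ℤ) < 0

/-- Block number `bl(w) = 1 + #{1 ≤ i ≤ n-1 : max(w_1,…,w_i) < min(w_{i+1},…,w_n)}`. -/
def bl (n : ℕ) (w : Equiv.Perm ℤ) : ℕ :=
  1 + ((Finset.Ioo 0 n).filter fun i : ℕ =>
    ∀ j ∈ Finset.Icc 1 i, ∀ k ∈ Finset.Icc (i + 1) n, w ((j : ℕ) : ℤ) < w ((k : ℕ) : ℤ)).card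

/-- Chow's type-B fundamental quasi-symmetric function `F^B_J` in variables `x_0,x_1,…`:
the sum of `x_{i_1} ⋯ x_{i_n}` over `0 ≤ i_1 ≤ ⋯ ≤ i_n` with `i_j < i_{j+1}` for `j ∈ J`,
with the convention `i_0 = 0`. A sequence is encoded by `f : ℕ → ℕ` with `f a = i_a`
for `1 ≤ a ≤ n`, normalized by `f 0 = 0` and `f a = 0` for `a > n`. -/
def FB (R : Type) [CommRing R] (n : ℕ) (J : Finset ℕ) : MvPowerSeries ℕ R :=
  fun m => (Nat.card {f : ℕ → ℕ //
    f 0 = 0 ∧ (∀ a, n < a → f a = 0) ∧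
    (∀ a b, a ≤ b → b ≤ n → f a ≤ f b) ∧
    (∀ j ∈ J, f j < f (j + 1)) ∧
    ∀ v : ℕ, m v = ((Finset.Icc 1 n).filter fun a => f a = v).card} : R)

/-- Gessel's fundamental quasi-symmetric function `F_J` in variables `x_1,x_2,…`. -/
def FA (R : Type) [CommRing R] (n : ℕ) (J : Finset ℕ) : MvPowerSeries ℕ R :=
  fun m => (Nat.card {f : ℕ → ℕ //
    f 0 = 0 ∧ (∀ a, n < a → f a = 0) ∧
    (∀ a, 1 ≤ a → a ≤ n → 1 ≤ f a) ∧
    (∀ a b, 1 ≤ a → a ≤ b → b ≤ n → f a ≤ f b) ∧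
    (∀ j ∈ J, f j < f (j + 1)) ∧
    ∀ v : ℕ, m v = ((Finset.Icc 1 n).filter fun a => f a = v).card} : R)

/-- Complete homogeneous symmetric function `h_m` in the variables `x_s, x_{s+1}, …`. -/
def hSeries (R : Type) [CommRing R] (s m : ℕ) : MvPowerSeries ℕ R :=
  fun μ => if (μ.sum fun _ v => v) = m ∧ ∀ a < s, μ a = 0 then 1 else 0

/-- Number of semistandard Young tableaux of shape `lam` (row lengths `lam 0 ≥ lam 1 ≥ …`),
with all entries `≥ s`, rows weakly increasing, columns strictly increasing,
and content `μ` (the value `v` occurs `μ v` times). Tableaux are normalized to be `0`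
outside the cells of the diagram. -/
def schurCoeff (s : ℕ) (lam : ℕ → ℕ) (μ : ℕ → ℕ) : ℕ :=
  Nat.card {T : ℕ → ℕ → ℕ //
    (∀ i j, j + 1 < lam i → T i j ≤ T i (j + 1)) ∧
    (∀ i j, j < lam (i + 1) → T i j < T (i + 1) j) ∧
    (∀ i j, j < lam i → s ≤ T i j) ∧
    (∀ i j, ¬ j < lam i → T i j = 0) ∧
    ∀ v : ℕ, μ v = Nat.card {p : ℕ × ℕ // p.2 < lam p.1 ∧ T p.1 p.2 = v}}

/-- The Schur function `s_lam` in the variables `x_s, x_{s+1}, …`. -/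
def schurS (R : Type) [CommRing R] (s : ℕ) (lam : ℕ → ℕ) : MvPowerSeries ℕ R :=
  fun m => (schurCoeff s lam (fun v => m v) : R)

/-- The two-row shape `(a, b)` as a row-length function. -/
def twoRow (a b : ℕ) : ℕ → ℕ := fun i => if i = 0 then a else if i = 1 then b else 0

/-- Row-length function of a partition of `k`. -/
def partFun {k : ℕ} (p : Nat.Partition k) : ℕ → ℕ :=
  fun i => ((p.parts.sort (· ≤ ·)).reverse).getD i 0

/-- Conjugate of a row-length function. -/
def conjFun (lam : ℕ → ℕ) : ℕ → ℕ := fun j => Nat.card {i : ℕ // j < lam i}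

/-- Descent set of the standard Young tableau of skew shape `(n,k)/(k)` (resp. of the
bi-tableau of bi-shape `((k),(n-k))`) encoded by the set `S ⊆ {1,…,n}` of entries of the
length-`k` bottom row: `{1 ≤ i ≤ n-1 : i ∉ S, i+1 ∈ S}`. -/
def DesSet (n : ℕ) (S : Finset ℕ) : Finset ℕ :=
  (Finset.Ico 1 n).filter fun i => i ∉ S ∧ i + 1 ∈ S

/-- Last descent of the tableau encoded by `S`. -/
def ldesSet (n : ℕ) (S : Finset ℕ) : ℕ := (DesSet n S).sup id

/-- Type-B descent set of the bi-tableau encoded by `S`: add `0` when `1 ∈ S`. -/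
def DesBSet (n : ℕ) (S : Finset ℕ) : Finset ℕ :=
  if 1 ∈ S then insert 0 (DesSet n S) else DesSet n S

/-- `b_{n,k,j}`: the number of standard Young tableaux of skew shape `(n,k)/(k)`
(encoded by `k`-subsets `S ⊆ {1,…,n}`) with `ldes = n - j`. -/
def bCoeff (n k j : ℕ) : ℕ :=
  ((Finset.Icc 1 n).powerset.filter fun S => S.card = k ∧ ldesSet n S = n - j).card

/-- `a_{n,k,j}`: the number of standard Young tableaux of shape `(n-k,k)` (encoded by
`k`-subsets `S ⊆ {1,…,n}` of second-row entries satisfying the ballot condition)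
with `ldes = n - j`. -/
def aCoeff (n k j : ℕ) : ℕ :=
  ((Finset.Icc 1 n).powerset.filter fun S => S.card = k ∧
    (∀ i ∈ Finset.Icc 1 n, 2 * (S.filter (· ≤ i)).card ≤ i) ∧ ldesSet n S = n - j).card

/-- `e_{n,m,J}`: number of `m`-subsets `S ⊆ {1,…,n}` with `Des_B(S) = J`. -/
def eCoeff (n m : ℕ) (J : Finset ℕ) : ℕ :=
  ((Finset.Icc 1 n).powerset.filter fun S => S.card = m ∧ DesBSet n S = J).card

/-- `d_{n,m,j}`: number of `m`-subsets `S ⊆ {1,…,n}` with `ldes(S) = n - j`. -/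
def dCoeff (n m j : ℕ) : ℕ :=
  ((Finset.Icc 1 n).powerset.filter fun S => S.card = m ∧ ldesSet n S = n - j).card

/-- The palindromic representation `w^0 = [-w_n, …, -w_1, w_1, …, w_n]`,
as a function of the position `p ∈ {1,…,2n}`. -/
def wzero (n : ℕ) (w : Equiv.Perm ℤ) : ℕ → ℤ :=
  fun p => if p ≤ n then - w ((n : ℤ) + 1 - (p : ℤ)) else w ((p : ℤ) - (n : ℤ))

/-- Greene invariant: the maximal total size of a union of `j` increasing subsequences
of `w^0` (a set of positions is such a union iff it admits a coloring by `j` colors with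
each color class increasing). By Greene's theorem this equals `λ_1 + ⋯ + λ_j` for the
RSK shape `λ(w^0)`. -/
def greene (n : ℕ) (w : Equiv.Perm ℤ) (j : ℕ) : ℕ :=
  ((Finset.Icc 1 (2 * n)).powerset.filter fun P =>
    ∃ c : ℕ → Fin j, ∀ p ∈ P, ∀ q ∈ P, p < q → c p = c q →
      wzero n w p < wzero n w q).sup Finset.card

/-- First valley `v(π)`. -/
def firstValley (n : ℕ) (π : Equiv.Perm ℤ) : ℕ :=
  if h : ((DesA n π⁻¹).erase 1).Nonempty then ((DesA n π⁻¹).erase 1).min' h else n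

/-- Order key for the order `-1 <r -2 <r ⋯ <r -n <r 1 <r ⋯ <r n`. -/
def rkey (n : ℕ) (a : ℤ) : ℤ := if a < 0 then -a else a + n

/-- The r-descent set `rDes(w) = {1 ≤ i ≤ n-1 : w_i >r w_{i+1}}`. -/
def rDes (n : ℕ) (w : Equiv.Perm ℤ) : Finset ℕ :=
  (Finset.Ico 1 n).filter fun i : ℕ =>
    rkey n (w (((i : ℕ) + 1 : ℕ) : ℤ)) < rkey n (w ((i : ℕ) : ℤ))

/-- Poirier's type-B quasi-symmetric function `F^P_w(X,Y)`, a power series in the two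
alphabets `x_1,x_2,…` (indexed by `Sum.inl`) and `y_1,y_2,…` (indexed by `Sum.inr`). -/
def FP (n : ℕ) (w : Equiv.Perm ℤ) : MvPowerSeries (ℕ ⊕ ℕ) ℤ :=
  fun m => (Nat.card {f : ℕ → ℕ //
    f 0 = 0 ∧ (∀ a, n < a → f a = 0) ∧
    (∀ a, 1 ≤ a → a ≤ n → 1 ≤ f a) ∧
    (∀ a b, 1 ≤ a → a ≤ b → b ≤ n → f a ≤ f b) ∧
    (∀ j ∈ rDes n w, f j < f (j + 1)) ∧
    (∀ v : ℕ, m (Sum.inl v) =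
      ((Finset.Icc 1 n).filter fun a => f a = v ∧ 0 < w ((a : ℕ) : ℤ)).card) ∧
    ∀ v : ℕ, m (Sum.inr v) =
      ((Finset.Icc 1 n).filter fun a => f a = v ∧ w ((a : ℕ) : ℤ) < 0).card} : ℤ)

/-- The Schur function `s_lam(X)` in the first alphabet `x_1,x_2,…`. -/
def schurX (lam : ℕ → ℕ) : MvPowerSeries (ℕ ⊕ ℕ) ℤ :=
  fun m => if ∀ v, m (Sum.inr v) = 0 then
    (schurCoeff 1 lam fun v => m (Sum.inl v) : ℤ) else 0

/-- The Schur function `s_lam(Y)` in the second alphabet `y_1,y_2,…`. -/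
def schurY (lam : ℕ → ℕ) : MvPowerSeries (ℕ ⊕ ℕ) ℤ :=
  fun m => if ∀ v, m (Sum.inl v) = 0 then
    (schurCoeff 1 lam fun v => m (Sum.inr v) : ℤ) else 0

/-- Chow type-B Schur-positivity: a nonnegative combination of the products
`s_{λ⁻}(x_1,x_2,…) ⋅ s_{λ⁺}(x_0,x_1,…)` over pairs of partitions of total size `n`. -/
def ChowPos (n : ℕ) (F : MvPowerSeries ℕ ℤ) : Prop :=
  ∃ c : (Σ k : Fin (n + 1), Nat.Partition (k : ℕ) × Nat.Partition (n - (k : ℕ))) → ℕ,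
    F = ∑ p : (Σ k : Fin (n + 1), Nat.Partition (k : ℕ) × Nat.Partition (n - (k : ℕ))),
      (c p : ℤ) • (schurS ℤ 1 (partFun p.2.1) * schurS ℤ 0 (partFun p.2.2))

/-- The bound `v_{j-1}`, with the convention `v_{-1} = 0`. -/
def prevBound {k : ℕ} (v : Fin (k + 1) → ℕ) (j : Fin (k + 1)) : ℕ :=
  Fin.cases (motive := fun _ => ℕ) 0 (fun i => v i.castSucc) j

/-- Strictly increasing sequences lying strictly below `v`. -/
def boundedSeqs {k : ℕ} (v : Fin (k + 1) → ℕ) : Finset (Fin (k + 1) → ℕ) :=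
  (Fintype.piFinset fun j => Finset.range (v j)).filter StrictMono

/-- The total excess of the entries of `p` over the preceding bounds. -/
def gapSum {k : ℕ} (v p : Fin (k + 1) → ℕ) : ℕ := ∑ j, (p j - prevBound v j)

/-- The room left between the last entry of `p` and its bound. -/
def slack {k : ℕ} (v p : Fin (k + 1) → ℕ) : ℕ := v (Fin.last k) - p (Fin.last k)

/-- `c` is the last index at which `p` exceeds `u`. -/
def IsPivot {k : ℕ} (u p : Fin (k + 1) → ℕ) (c : Fin (k + 1)) : Prop :=
  u c < p c ∧ ∀ j, c < j → p j ≤ u j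

lemma mem_boundedSeqs {k : ℕ} {v p : Fin (k + 1) → ℕ} :
    p ∈ boundedSeqs v ↔ (∀ j, p j < v j) ∧ StrictMono p := by
  simp [boundedSeqs]

lemma le_prevBound {k : ℕ} {v : Fin (k + 1) → ℕ} (hv : Monotone v) {i j : Fin (k + 1)}
    (h : i < j) : v i ≤ prevBound v j := by
  induction j using Fin.cases with
  | zero => simp at h
  | succ j => exact hv (Fin.le_castSucc_iff.2 h)

lemma IsPivot.unique {k : ℕ} {u p : Fin (k + 1) → ℕ} {c d : Fin (k + 1)}
    (hc : IsPivot u p c) (hd : IsPivot u p d) : c = d := by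
  rcases lt_trichotomy c d with h | h | h
  · have := hc.2 d h; have := hd.1; omega
  · exact h
  · have := hd.2 c h; have := hc.1; omega

lemma exists_isPivot {k : ℕ} {u p : Fin (k + 1) → ℕ} {j : Fin (k + 1)} (h : u j < p j) :
    ∃ c, IsPivot u p c := by
  obtain ⟨c, hc, hmax⟩ := (Finset.univ.filter fun j => u j < p j).exists_max_image id
    ⟨j, by simp [h]⟩
  refine ⟨c, by simpa using hc, fun i hi => ?_⟩
  by_contra! h'
  exact absurd (hmax i (by simpa using h')) (not_le.2 hi)

lemma gapSum_eq_succ {k : ℕ} {v p q : Fin (k + 1) → ℕ} {c : Fin (k + 1)}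
    (hlt : ∀ j, j < c → p j = q j) (hle : ∀ j, c ≤ j → p j = q j + 1)
    (hc : IsPivot (prevBound v) p c) : gapSum v p = gapSum v q + 1 := by
  have : ∀ j, p j - prevBound v j = (q j - prevBound v j) + if j = c then 1 else 0 := by
    intro j
    rcases lt_trichotomy j c with h | h | h
    · simp [hlt j h, h.ne]
    · subst h
      have := hc.1
      have := hle j le_rfl
      simp only [if_true]
      omega
    · have := hc.2 j h
      have := hle j h.le
      simp only [h.ne', if_false]
      omega
  simp only [gapSum, this, Finset.sum_add_distrib, Finset.sum_ite_eq', Finset.mem_univ, if_true]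

/-- Lowering (or raising) a final segment of the sequence by one trades one unit of `gapSum`
for one unit of `slack`. -/
lemma card_gapSum_slack_step {k : ℕ} {v : Fin (k + 1) → ℕ} (hv : Monotone v) (x y : ℕ) :
    ((boundedSeqs v).filter fun p => gapSum v p = x + 1 ∧ slack v p = y + 1).card =
      ((boundedSeqs v).filter fun p => gapSum v p = x ∧ slack v p = y + 2).card := by
  have hpiv : ∀ p ∈ (boundedSeqs v).filter fun p => gapSum v p = x + 1 ∧ slack v p = y + 1,
      ∃ c, IsPivot (prevBound v) p c := by
    intro p hp
    by_contra! hno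
    have h0 : gapSum v p = 0 := by
      refine Finset.sum_eq_zero fun j _ => Nat.sub_eq_zero_of_le ?_
      by_contra! h
      obtain ⟨c, hc⟩ := exists_isPivot h
      exact hno c hc
    have := (Finset.mem_filter.1 hp).2.1
    omega
  choose! c hc using hpiv
  have hpos : ∀ p ∈ (boundedSeqs v).filter fun p => gapSum v p = x + 1 ∧ slack v p = y + 1,
      ∀ j, c p ≤ j → 0 < p j := by
    intro p hp j hj
    have hm := (mem_boundedSeqs.1 (Finset.mem_filter.1 hp).1).2.monotone hj
    have := (hc p hp).1
    omega
  have hlow : ∀ p ∈ (boundedSeqs v).filter fun p => gapSum v p = x + 1 ∧ slack v p = y + 1,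
      IsPivot (prevBound v) (fun j => (if c p ≤ j then p j - 1 else p j) + 1) (c p) := by
    intro p hp
    refine ⟨?_, fun j hj => ?_⟩
    · have := (hc p hp).1
      simp only [le_refl, if_true]
      omega
    · have := (hc p hp).2 j hj
      have := hpos p hp j hj.le
      simp only [hj.le, if_true]
      omega
  refine Finset.card_bij (fun p _ j => if c p ≤ j then p j - 1 else p j) ?_ ?_ ?_
  · intro p hp
    obtain ⟨hps, hx, hy⟩ := Finset.mem_filter.1 hp
    obtain ⟨hb, hs⟩ := mem_boundedSeqs.1 hps
    have hpc := hc p hp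
    have hp0 := hpos p hp
    refine Finset.mem_filter.2 ⟨mem_boundedSeqs.2 ⟨fun j => ?_, fun i j hij => ?_⟩, ?_, ?_⟩
    · have := hb j
      split_ifs <;> omega
    · have h1 := hs hij
      dsimp only
      split_ifs with h2 h3 h3
      · have := hp0 i h2
        omega
      · exact absurd (h2.trans hij.le) h3
      · rcases h3.eq_or_lt with h | h
        · subst h
          have := le_prevBound hv hij
          have := hb i
          have := hpc.1
          omega
        · have := hs h
          have := hs (not_le.1 h2)
          omega
      · exact h1
    · have := gapSum_eq_succ (v := v) (p := p) (q := fun j => if c p ≤ j then p j - 1 else p j)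
        (c := c p) (fun j hj => by simp [not_le.2 hj])
        (fun j hj => by have := hp0 j hj; simp only [hj, if_true]; omega) hpc
      omega
    · have := hp0 (Fin.last k) (Fin.le_last _)
      have := hb (Fin.last k)
      simp only [slack, Fin.le_last, if_true] at hy ⊢
      omega
  · intro p hp q hq h
    have hcc : c p = c q := by
      have h1 := hlow p hp
      have h2 := hlow q hq
      have h' : ∀ j, (if c p ≤ j then p j - 1 else p j) = if c q ≤ j then q j - 1 else q j :=
        fun j => congrFun h j
      simp only [h'] at h1
      exact h1.unique h2
    funext j
    have hj := congrFun h j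
    simp only [hcc] at hj
    split_ifs at hj with hle
    · have := hpos p hp j (hcc ▸ hle)
      have := hpos q hq j hle
      omega
    · exact hj
  · intro q hq
    obtain ⟨hqs, hx, hy⟩ := Finset.mem_filter.1 hq
    obtain ⟨hb, hs⟩ := mem_boundedSeqs.1 hqs
    obtain ⟨d, hd⟩ := exists_isPivot (u := prevBound v) (p := fun j => q j + 1) (j := 0)
      (by simp [prevBound])
    set p : Fin (k + 1) → ℕ := fun j => if d ≤ j then q j + 1 else q j with hpdef
    have hpd : IsPivot (prevBound v) p d := by
      refine ⟨?_, fun j hj => ?_⟩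
      · simpa [hpdef] using hd.1
      · simpa [hpdef, hj.le] using hd.2 j hj
    have hpv : ∀ j, p j < v j := by
      intro j
      have := hb j
      simp only [hpdef]
      split_ifs with h
      · rcases (Fin.le_last j).eq_or_lt with hj | hj
        · subst hj
          simp only [slack] at hy
          omega
        · obtain ⟨i, rfl⟩ := Fin.exists_castSucc_eq.2 hj.ne
          have h1 := hd.2 i.succ (lt_of_le_of_lt h i.castSucc_lt_succ)
          have h2 : prevBound v i.succ = v i.castSucc := rfl
          have h3 := hs i.castSucc_lt_succ
          dsimp only at h1
          omega
      · exact this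
    have hp : p ∈ (boundedSeqs v).filter fun p => gapSum v p = x + 1 ∧ slack v p = y + 1 := by
      refine Finset.mem_filter.2 ⟨mem_boundedSeqs.2 ⟨hpv, fun i j hij => ?_⟩, ?_, ?_⟩
      · have := hs hij
        simp only [hpdef]
        split_ifs with h1 h2 h2
        · omega
        · exact absurd (h1.trans hij.le) h2
        · omega
        · omega
      · rw [gapSum_eq_succ (q := q) (c := d) _ _ hpd, hx]
        · intro j hj
          simp [hpdef, not_le.2 hj]
        · intro j hj
          simp [hpdef, hj]
      · have := hpv (Fin.last k)
        simp only [slack, hpdef, Fin.le_last, if_true] at hy this ⊢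
        omega
    refine ⟨p, hp, funext fun j => ?_⟩
    rw [(hc p hp).unique hpd]
    simp only [hpdef]
    split_ifs <;> omega

lemma card_gapSum_slack_symm {k : ℕ} {v : Fin (k + 1) → ℕ} (hv : Monotone v) (x y : ℕ) :
    ((boundedSeqs v).filter fun p => gapSum v p = x ∧ slack v p = y + 1).card =
      ((boundedSeqs v).filter fun p => gapSum v p = y ∧ slack v p = x + 1).card := by
  have key : ∀ x y, ((boundedSeqs v).filter fun p => gapSum v p = x ∧ slack v p = y + 1).card =
      ((boundedSeqs v).filter fun p => gapSum v p = 0 ∧ slack v p = x + y + 1).card := by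
    intro x
    induction x with
    | zero => intro y; simp
    | succ x ih =>
      intro y
      rw [card_gapSum_slack_step hv, ih (y + 1)]
      congr! 4
      omega
  rw [key x y, key y x, add_comm x y]

lemma card_contacts {k n : ℕ} {v p : Fin (k + 1) → ℕ} (hv : StrictMono v) (hp : StrictMono p)
    (hpv : ∀ j, p j < v j) (hn : v (Fin.last k) < n) :
    ((Finset.Ioo 0 n).filter fun i => ∀ j, ¬ (p j < i ∧ i ≤ v j)).card =
      gapSum v p + (n - 1 - v (Fin.last k)) := by
  have hset : ((Finset.Ioo 0 n).filter fun i => ∀ j, ¬ (p j < i ∧ i ≤ v j)) =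
      (Finset.univ.biUnion fun j => Finset.Ioc (prevBound v j) (p j)) ∪
        Finset.Ioo (v (Fin.last k)) n := by
    ext i
    simp only [Finset.mem_filter, Finset.mem_Ioo, Finset.mem_union, Finset.mem_biUnion,
      Finset.mem_univ, true_and, Finset.mem_Ioc]
    constructor
    · rintro ⟨⟨h0, h1⟩, h2⟩
      by_cases hi : i ≤ v (Fin.last k)
      · left
        obtain ⟨j, hj, hmin⟩ := (Finset.univ.filter fun j => i ≤ v j).exists_min_image id
          ⟨Fin.last k, by simp [hi]⟩
        have hj' : i ≤ v j := by simpa using hj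
        refine ⟨j, ?_, ?_⟩
        · induction j using Fin.cases with
          | zero => simpa [prevBound] using h0
          | succ j =>
            change v j.castSucc < i
            by_contra! h
            exact absurd (hmin j.castSucc (by simpa using h)) (not_le.2 j.castSucc_lt_succ)
        · by_contra! h
          exact h2 j ⟨h, hj'⟩
      · right
        omega
    · rintro (⟨j, hj1, hj2⟩ | ⟨h1, h2⟩)
      · have := hpv j
        have := hv.monotone (Fin.le_last j)
        refine ⟨by omega, fun j' ⟨h1, h2⟩ => ?_⟩
        rcases lt_or_ge j' j with h | h
        · have := le_prevBound hv.monotone h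
          omega
        · have := hp.monotone h
          omega
      · refine ⟨by omega, fun j' h => ?_⟩
        have := hv.monotone (Fin.le_last j')
        omega
  rw [hset, Finset.card_union_of_disjoint, Finset.card_biUnion]
  · simp only [Nat.card_Ioc, Nat.card_Ioo, gapSum]
    omega
  · have key : ∀ i j, i < j →
        Disjoint (Finset.Ioc (prevBound v i) (p i)) (Finset.Ioc (prevBound v j) (p j)) := by
      intro i j hij
      rw [Finset.disjoint_left]
      intro a ha hb
      have := le_prevBound hv.monotone hij
      have := hpv i
      simp only [Finset.mem_Ioc] at ha hb
      omega
    intro i _ j _ hij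
    rcases lt_or_gt_of_ne hij with h | h
    · exact key i j h
    · exact (key j i h).symm
  · rw [Finset.disjoint_left]
    intro a ha hb
    simp only [Finset.mem_biUnion, Finset.mem_univ, true_and, Finset.mem_Ioc,
      Finset.mem_Ioo] at ha hb
    obtain ⟨j, hj⟩ := ha
    have := hpv j
    have := hv.monotone (Fin.le_last j)
    omega

section Perm

variable {n : ℕ} {τ : Equiv.Perm (Fin n)}

/-- 321-avoidance. -/
def PermAvoids321 (τ : Equiv.Perm (Fin n)) : Prop :=
  ∀ i j k, i < j → j < k → τ k < τ j → ¬ τ j < τ i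

/-- The values of `τ` at its excedances. -/
def excValues (τ : Equiv.Perm (Fin n)) : Finset (Fin n) :=
  Finset.univ.filter fun v => τ.symm v < v

/-- The number of blocks of the one-line notation of `τ`. -/
def permBlocks (τ : Equiv.Perm (Fin n)) : ℕ :=
  1 + ((Finset.Ioo 0 n).filter fun i =>
    ∀ j k : Fin n, (j : ℕ) < i → i ≤ (k : ℕ) → τ j < τ k).card

/-- The last descent of `τ`, or zero if there is none. -/
def permLastDescent (τ : Equiv.Perm (Fin n)) : ℕ :=
  ((Finset.Ioo 0 n).filter fun i =>
    ∃ j k : Fin n, (j : ℕ) + 1 = i ∧ (k : ℕ) = i ∧ τ k < τ j).sup id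

lemma exists_inversion_of_lt {x : Fin n} (h : x < τ x) : ∃ y, x < y ∧ τ y < τ x := by
  by_contra! hno
  have hsub : Finset.Iio (τ x) ⊆ (Finset.Iio x).image τ := by
    intro v hv
    rw [Finset.mem_Iio] at hv
    refine Finset.mem_image.2 ⟨τ.symm v, ?_, by simp⟩
    rw [Finset.mem_Iio]
    by_contra! hle
    rcases hle.eq_or_lt with he | hlt
    · rw [he] at hv
      simp at hv
    · have := hno _ hlt
      rw [Equiv.apply_symm_apply] at this
      exact absurd hv (not_lt.2 this)
  have := (Finset.card_le_card hsub).trans Finset.card_image_le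
  simp only [Fin.card_Iio] at this
  exact absurd h (not_lt.2 this)

lemma PermAvoids321.lt_of_inversion (hτ : PermAvoids321 τ) {x y : Fin n} (hxy : x < y)
    (h : τ y < τ x) : x < τ x := by
  have hsub : (insert y (Finset.Iio x)).image τ ⊆ Finset.Iio (τ x) := by
    intro v hv
    obtain ⟨u, hu, rfl⟩ := Finset.mem_image.1 hv
    rw [Finset.mem_Iio]
    rcases Finset.mem_insert.1 hu with rfl | hu
    · exact h
    · rw [Finset.mem_Iio] at hu
      refine lt_of_le_of_ne (not_lt.1 (hτ u x y hu hxy h)) fun he => ?_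
      exact hu.ne (τ.injective he)
  have := Finset.card_le_card hsub
  rw [Finset.card_image_of_injective _ τ.injective, Finset.card_insert_of_notMem (by
    simp [hxy.le]), Fin.card_Iio, Fin.card_Iio] at this
  exact this

lemma PermAvoids321.strictMonoOn_exc (hτ : PermAvoids321 τ) : StrictMonoOn τ {x | x < τ x} := by
  intro x _ y hy hxy
  by_contra! h
  obtain ⟨z, hyz, hz⟩ := exists_inversion_of_lt hy
  exact hτ x y z hxy hyz hz (lt_of_le_of_ne h fun he => hxy.ne' (τ.injective he))

lemma PermAvoids321.strictMonoOn_nonexc (hτ : PermAvoids321 τ) :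
    StrictMonoOn τ {x | x < τ x}ᶜ := by
  intro x hx y _ hxy
  by_contra! h
  exact hx (hτ.lt_of_inversion hxy (lt_of_le_of_ne h fun he => hxy.ne' (τ.injective he)))

lemma avoids321_of_strictMonoOn {S : Set (Fin n)} (h1 : StrictMonoOn τ S)
    (h2 : StrictMonoOn τ Sᶜ) : PermAvoids321 τ := by
  intro i j k hij hjk hkj hji
  have key : ∀ a b, a < b → τ b < τ a → (a ∈ S ↔ b ∉ S) := by
    intro a b hab hba
    constructor
    · intro ha hb
      exact absurd (h1 ha hb hab) hba.not_gt
    · intro hb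
      by_contra ha
      exact absurd (h2 ha hb hab) hba.not_gt
  have := key i j hij hji
  have := key j k hjk hkj
  have := key i k (hij.trans hjk) (hkj.trans hji)
  tauto

lemma lt_apply_iff_mem {S : Set (Fin n)} (h2 : StrictMonoOn τ Sᶜ) (h3 : ∀ x ∈ S, x < τ x)
    (x : Fin n) : x < τ x ↔ x ∈ S := by
  refine ⟨fun hx => ?_, h3 x⟩
  by_contra hxS
  have hsub : (Finset.Iic (τ x)).image τ.symm ⊆ Finset.Iio (τ x) := by
    intro u hu
    obtain ⟨v, hv, rfl⟩ := Finset.mem_image.1 hu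
    rw [Finset.mem_Iic] at hv
    rw [Finset.mem_Iio]
    by_cases huS : τ.symm v ∈ S
    · have := h3 _ huS
      rw [Equiv.apply_symm_apply] at this
      exact this.trans_le hv
    · refine lt_of_le_of_lt ?_ hx
      by_contra! h
      have := h2 hxS huS h
      rw [Equiv.apply_symm_apply] at this
      exact absurd hv (not_le.2 this)
  have := Finset.card_le_card hsub
  rw [Finset.card_image_of_injective _ τ.symm.injective, Fin.card_Iic, Fin.card_Iio] at this
  omega

lemma eq_of_strictMonoOn_compl {σ : Equiv.Perm (Fin n)} {S : Set (Fin n)}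
    (h : ∀ x ∈ S, τ x = σ x) (h1 : StrictMonoOn τ Sᶜ) (h2 : StrictMonoOn σ Sᶜ) : τ = σ := by
  have key : ∀ α β : Equiv.Perm (Fin n), (∀ x ∈ S, α x = β x) → StrictMonoOn β Sᶜ →
      ∀ x ∉ S, (∀ y < x, α y = β y) → β x ≤ α x := by
    intro α β hS hβ x hx ih
    by_contra! hlt
    obtain ⟨y, hy⟩ := β.surjective (α x)
    have hyx : α y ≠ β y ∨ y = x := by
      by_contra! hc
      exact hc.2 (α.injective (hc.1.trans hy))
    rcases hyx with hyx | rfl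
    · have hyS : y ∉ S := fun hyS => hyx (hS y hyS)
      have : y < x := by
        rw [← hβ.lt_iff_lt hyS hx, hy]
        exact hlt
      exact hyx (ih y this)
    · exact hlt.ne hy.symm
  refine Equiv.ext fun x => ?_
  induction x using WellFoundedLT.induction with
  | ind x ih =>
    by_cases hx : x ∈ S
    · exact h x hx
    · exact le_antisymm (key σ τ (fun y hy => (h y hy).symm) h1 x hx fun y hy => (ih y hy).symm)
        (key τ σ h h2 x hx ih)

lemma exists_perm_strictMonoOn {S V : Finset (Fin n)} (h : S.card = V.card) :
    ∃ τ : Equiv.Perm (Fin n), StrictMonoOn τ S ∧ StrictMonoOn τ (S : Set (Fin n))ᶜ ∧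
      ∀ x ∈ S, τ x ∈ V := by
  have hc : Sᶜ.card = Vᶜ.card := by rw [Finset.card_compl, Finset.card_compl, h]
  let a : S ≃o V := (S.orderIsoOfFin h).symm.trans (V.orderIsoOfFin rfl)
  let b : ↥Sᶜ ≃o ↥Vᶜ := (Sᶜ.orderIsoOfFin hc).symm.trans (Vᶜ.orderIsoOfFin rfl)
  let g : Fin n → Fin n := fun x =>
    if hx : x ∈ S then a ⟨x, hx⟩ else b ⟨x, Finset.mem_compl.2 hx⟩
  have gS : ∀ x (hx : x ∈ S), g x = a ⟨x, hx⟩ := fun x hx => dif_pos hx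
  have gSc : ∀ x (hx : x ∉ S), g x = b ⟨x, Finset.mem_compl.2 hx⟩ := fun x hx => dif_neg hx
  have gV : ∀ x, g x ∈ V ↔ x ∈ S := by
    intro x
    by_cases hx : x ∈ S
    · simp [gS x hx, hx]
    · have := (b ⟨x, Finset.mem_compl.2 hx⟩).2
      rw [Finset.mem_compl] at this
      simp [gSc x hx, hx, this]
  have ginj : Function.Injective g := by
    intro x y hxy
    have hiff : x ∈ S ↔ y ∈ S := by rw [← gV, ← gV, hxy]
    by_cases hx : x ∈ S
    · rw [gS x hx, gS y (hiff.1 hx)] at hxy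
      simpa using a.injective (Subtype.ext hxy)
    · rw [gSc x hx, gSc y (fun hy => hx (hiff.2 hy))] at hxy
      simpa using b.injective (Subtype.ext hxy)
  refine ⟨Equiv.ofBijective g (Finite.injective_iff_bijective.1 ginj), ?_, ?_, ?_⟩
  · intro x hx y hy hxy
    simp only [Equiv.ofBijective_apply]
    rw [gS x hx, gS y hy]
    exact a.strictMono (Subtype.mk_lt_mk.2 hxy)
  · intro x hx y hy hxy
    simp only [Equiv.ofBijective_apply]
    rw [gSc x hx, gSc y hy]
    exact b.strictMono (Subtype.mk_lt_mk.2 hxy)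
  · intro x hx
    exact (gV x).2 hx

lemma contact_iff (τ : Equiv.Perm (Fin n)) (i : ℕ) :
    (∀ j k : Fin n, (j : ℕ) < i → i ≤ (k : ℕ) → τ j < τ k) ↔
      ∀ x : Fin n, ¬ ((x : ℕ) < i ∧ i ≤ (τ x : ℕ)) := by
  set A : Finset (Fin n) := Finset.univ.filter fun x => (x : ℕ) < i with hA
  have memA : ∀ x, x ∈ A ↔ (x : ℕ) < i := by simp [hA]
  constructor
  · rintro h x ⟨hx, hx'⟩
    have hsub : (insert x Aᶜ).image τ ⊆ Aᶜ := by
      intro v hv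
      obtain ⟨u, hu, rfl⟩ := Finset.mem_image.1 hv
      rw [Finset.mem_compl, memA]
      rcases Finset.mem_insert.1 hu with rfl | hu
      · omega
      · rw [Finset.mem_compl, memA] at hu
        have := h x u hx (by omega)
        rw [Fin.lt_def] at this
        omega
    have := Finset.card_le_card hsub
    rw [Finset.card_image_of_injective _ τ.injective, Finset.card_insert_of_notMem (by
      simp [memA, hx])] at this
    omega
  · intro h j k hj hk
    by_contra! hle
    have hsub : (insert k A).image τ ⊆ A := by
      intro v hv
      obtain ⟨u, hu, rfl⟩ := Finset.mem_image.1 hv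
      rw [memA]
      have h1 := h j
      rw [Fin.le_def] at hle
      rcases Finset.mem_insert.1 hu with rfl | hu
      · omega
      · rw [memA] at hu
        have := h u
        omega
    have := Finset.card_le_card hsub
    rw [Finset.card_image_of_injective _ τ.injective, Finset.card_insert_of_notMem (by
      rw [memA]; omega)] at this
    omega


lemma PermAvoids321.permLastDescent_eq (hτ : PermAvoids321 τ) {x : Fin n} (hx : x < τ x)
    (hmax : ∀ y, y < τ y → y ≤ x) : permLastDescent τ = x + 1 := by
  refine le_antisymm (Finset.sup_le fun i hi => ?_) ?_
  · obtain ⟨-, j, k, hj, hk, hkj⟩ := Finset.mem_filter.1 hi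
    have h1 : j < k := by rw [Fin.lt_def]; omega
    have h2 := hmax j (hτ.lt_of_inversion h1 hkj)
    rw [Fin.le_def] at h2
    simp only [id]
    omega
  · obtain ⟨y, hxy, hy⟩ := exists_inversion_of_lt hx
    have hxy' : (x : ℕ) < y := hxy
    have hxn : (x : ℕ) + 1 < n := by omega
    refine Finset.le_sup (f := id) (b := (x : ℕ) + 1) ?_
    rw [Finset.mem_filter, Finset.mem_Ioo]
    refine ⟨⟨by omega, hxn⟩, x, ⟨x + 1, hxn⟩, rfl, rfl, ?_⟩
    rcases (show (⟨x + 1, hxn⟩ : Fin n) ≤ y by rw [Fin.le_def]; exact hxy').eq_or_lt with h | h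
    · rwa [h]
    · refine (hτ.strictMonoOn_nonexc ?_ ?_ h).trans hy
      · intro hc
        have := hmax _ hc
        rw [Fin.le_def] at this
        dsimp only at this
        omega
      · intro hc
        exact absurd (hmax _ hc) (not_le.2 hxy)

lemma PermAvoids321.stats_of_excValues_eq_empty (hτ : PermAvoids321 τ) (hn : 0 < n)
    (h : excValues τ = ∅) : permBlocks τ = n ∧ permLastDescent τ = 0 := by
  have hno : ∀ x, ¬ x < τ x := by
    intro x hx
    have : τ x ∈ excValues τ := by simpa [excValues] using hx
    simp [h] at this
  constructor
  · rw [permBlocks, Finset.filter_true_of_mem, Nat.card_Ioo]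
    · omega
    · intro i _
      rw [contact_iff]
      intro x hx
      have := hno x
      rw [Fin.lt_def] at this
      omega
  · rw [permLastDescent, Finset.filter_false_of_mem, Finset.sup_empty, bot_eq_zero]
    rintro i - ⟨j, k, hj, hk, hkj⟩
    exact hno j (hτ.lt_of_inversion (by rw [Fin.lt_def]; omega) hkj)

section Encoding

variable {k : ℕ} {V : Finset (Fin n)} (hV : V.card = k + 1)

/-- The values of the excedances. -/
def excValueSeq (j : Fin (k + 1)) : ℕ := V.orderEmbOfFin hV j

/-- The positions of the excedances. -/
def excPosSeq (τ : Equiv.Perm (Fin n)) (j : Fin (k + 1)) : ℕ := τ.symm (V.orderEmbOfFin hV j)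

lemma excValueSeq_strictMono : StrictMono (excValueSeq hV) :=
  fun _ _ h => (V.orderEmbOfFin hV).strictMono h

lemma mem_iff_exists_orderEmb {v : Fin n} : v ∈ V ↔ ∃ j, V.orderEmbOfFin hV j = v := by
  rw [← Finset.mem_coe, ← Finset.range_orderEmbOfFin V hV, Set.mem_range]

lemma lt_apply_iff (hτV : excValues τ = V) (x : Fin n) : x < τ x ↔ τ x ∈ V := by
  simp [← hτV, excValues]

lemma excPosSeq_mem (hτ : PermAvoids321 τ) (hτV : excValues τ = V) :
    excPosSeq hV τ ∈ boundedSeqs (excValueSeq hV) := by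
  have hlt : ∀ j, τ.symm (V.orderEmbOfFin hV j) < V.orderEmbOfFin hV j := by
    intro j
    have hV' : ∀ v ∈ V, τ.symm v < v := by
      intro v hv
      rw [← hτV, excValues, Finset.mem_filter] at hv
      exact hv.2
    exact hV' _ (V.orderEmbOfFin_mem hV j)
  refine mem_boundedSeqs.2 ⟨fun j => hlt j, fun i j hij => ?_⟩
  have h := hτ.strictMonoOn_exc.lt_iff_lt (a := τ.symm (V.orderEmbOfFin hV i))
    (b := τ.symm (V.orderEmbOfFin hV j)) (by simpa using hlt i) (by simpa using hlt j)
  simp only [Equiv.apply_symm_apply, OrderEmbedding.lt_iff_lt] at h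
  exact h.1 hij

lemma excPosSeq_injective {σ : Equiv.Perm (Fin n)} (hτ : PermAvoids321 τ) (hσ : PermAvoids321 σ)
    (hτV : excValues τ = V) (hσV : excValues σ = V) (h : excPosSeq hV τ = excPosSeq hV σ) :
    τ = σ := by
  have hsymm : ∀ v ∈ V, τ.symm v = σ.symm v := by
    intro v hv
    obtain ⟨j, rfl⟩ := (mem_iff_exists_orderEmb hV).1 hv
    exact Fin.ext (congrFun h j)
  have hagree : ∀ x ∈ {x | x < τ x}, τ x = σ x := by
    intro x hx
    have h1 := hsymm _ ((lt_apply_iff hτV x).1 hx)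
    rw [Equiv.symm_apply_apply, Equiv.eq_symm_apply] at h1
    exact h1.symm
  have hset : {x | x < τ x} = {x | x < σ x} := by
    ext x
    refine ⟨fun hx => ?_, fun hx => ?_⟩
    · have := hagree x hx
      simp only [Set.mem_ofPred_eq] at hx ⊢
      rwa [← this]
    · have h1 := hsymm _ ((lt_apply_iff hσV x).1 hx)
      rw [Equiv.symm_apply_apply, Equiv.symm_apply_eq] at h1
      simp only [Set.mem_ofPred_eq] at hx ⊢
      rwa [← h1]
  refine eq_of_strictMonoOn_compl hagree hτ.strictMonoOn_nonexc ?_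
  rw [hset]
  exact hσ.strictMonoOn_nonexc

lemma exists_excPosSeq_eq {p : Fin (k + 1) → ℕ} (hp : p ∈ boundedSeqs (excValueSeq hV)) :
    ∃ τ : Equiv.Perm (Fin n), PermAvoids321 τ ∧ excValues τ = V ∧ excPosSeq hV τ = p := by
  obtain ⟨hlt, hmono⟩ := mem_boundedSeqs.1 hp
  let q : Fin (k + 1) → Fin n := fun j => ⟨p j, (hlt j).trans (Fin.is_lt _)⟩
  have hq : StrictMono q := fun i j hij => hmono hij
  set S : Finset (Fin n) := Finset.univ.image q with hS
  have hqS : ∀ j, q j ∈ S := fun j => Finset.mem_image_of_mem q (Finset.mem_univ j)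
  have hcard : S.card = V.card := by
    rw [hS, Finset.card_image_of_injective _ hq.injective, hV, Finset.card_univ, Fintype.card_fin]
  obtain ⟨τ, h1, h2, h3⟩ := exists_perm_strictMonoOn hcard
  have hval : ∀ j, τ (q j) = V.orderEmbOfFin hV j := by
    have : (fun j => τ (q j)) = V.orderEmbOfFin hV :=
      Finset.orderEmbOfFin_unique hV (fun j => h3 _ (hqS j))
        fun i j hij => h1 (hqS i) (hqS j) (hq hij)
    exact fun j => congrFun this j
  have hexc : ∀ x, x < τ x ↔ x ∈ (S : Set (Fin n)) := by
    refine lt_apply_iff_mem h2 fun x hx => ?_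
    obtain ⟨j, -, rfl⟩ := Finset.mem_image.1 (Finset.mem_coe.1 hx)
    rw [hval]
    exact hlt j
  refine ⟨τ, avoids321_of_strictMonoOn h1 h2, ?_, funext fun j => ?_⟩
  · ext v
    obtain ⟨x, rfl⟩ := τ.surjective v
    simp only [excValues, Finset.mem_filter, Finset.mem_univ, true_and, Equiv.symm_apply_apply]
    rw [hexc]
    constructor
    · exact h3 x
    · intro hx
      obtain ⟨j, hj⟩ := (mem_iff_exists_orderEmb hV).1 hx
      rw [← hval] at hj
      rw [← τ.injective hj]
      exact hqS j
  · simp only [excPosSeq, ← hval, Equiv.symm_apply_apply, q]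

lemma permBlocks_eq (hτ : PermAvoids321 τ) (hτV : excValues τ = V) :
    permBlocks τ = 1 + (gapSum (excValueSeq hV) (excPosSeq hV τ) +
      (n - 1 - excValueSeq hV (Fin.last k))) := by
  obtain ⟨hlt, hmono⟩ := mem_boundedSeqs.1 (excPosSeq_mem hV hτ hτV)
  rw [permBlocks, ← card_contacts (excValueSeq_strictMono hV) hmono hlt (Fin.is_lt _)]
  congr 2
  refine Finset.filter_congr fun i _ => ?_
  rw [contact_iff]
  constructor
  · intro h j hj
    refine h (τ.symm (V.orderEmbOfFin hV j)) ?_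
    rw [Equiv.apply_symm_apply]
    exact hj
  · intro h x hx
    have hx' : x < τ x := by rw [Fin.lt_def]; omega
    obtain ⟨j, hj⟩ := (mem_iff_exists_orderEmb hV).1 ((lt_apply_iff hτV x).1 hx')
    refine h j ?_
    rw [excPosSeq, excValueSeq, hj, Equiv.symm_apply_apply]
    exact hx

lemma sub_permLastDescent_eq (hτ : PermAvoids321 τ) (hτV : excValues τ = V) :
    n - permLastDescent τ = (n - 1 - excValueSeq hV (Fin.last k)) +
      slack (excValueSeq hV) (excPosSeq hV τ) := by
  obtain ⟨hlt, hmono⟩ := mem_boundedSeqs.1 (excPosSeq_mem hV hτ hτV)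
  have hx : τ.symm (V.orderEmbOfFin hV (Fin.last k)) <
      τ (τ.symm (V.orderEmbOfFin hV (Fin.last k))) := by
    rw [Equiv.apply_symm_apply]
    exact hlt _
  rw [hτ.permLastDescent_eq hx]
  · have h1 : excValueSeq hV (Fin.last k) < n := Fin.is_lt _
    have h2 := hlt (Fin.last k)
    change n - (excPosSeq hV τ (Fin.last k) + 1) = _
    rw [slack]
    omega
  · intro y hy
    obtain ⟨j, hj⟩ := (mem_iff_exists_orderEmb hV).1 ((lt_apply_iff hτV y).1 hy)
    have := hmono.monotone (Fin.le_last j)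
    simp only [excPosSeq, hj, Equiv.symm_apply_apply] at this
    exact this

end Encoding

lemma card_avoids321_symm (hn : 0 < n) (V : Finset (Fin n)) (a b : ℕ) :
    (Finset.univ.filter fun τ : Equiv.Perm (Fin n) => PermAvoids321 τ ∧ excValues τ = V ∧
        permBlocks τ = a ∧ n - permLastDescent τ = b).card =
      (Finset.univ.filter fun τ : Equiv.Perm (Fin n) => PermAvoids321 τ ∧ excValues τ = V ∧
        permBlocks τ = b ∧ n - permLastDescent τ = a).card := by
  rcases Nat.eq_zero_or_eq_succ_pred V.card with h0 | hV
  · rw [Finset.card_eq_zero] at h0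
    subst h0
    congr 1
    refine Finset.filter_congr fun τ _ => ?_
    refine and_congr_right fun hτ => and_congr_right fun hτV => ?_
    obtain ⟨h1, h2⟩ := hτ.stats_of_excValues_eq_empty hn hτV
    rw [h1, h2]
    simp [and_comm]
  · generalize V.card.pred = k at hV
    set v := excValueSeq hV
    have key : ∀ a b, (Finset.univ.filter fun τ : Equiv.Perm (Fin n) =>
        PermAvoids321 τ ∧ excValues τ = V ∧ permBlocks τ = a ∧ n - permLastDescent τ = b).card =
        ((boundedSeqs v).filter fun p => 1 + (gapSum v p + (n - 1 - v (Fin.last k))) = a ∧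
          (n - 1 - v (Fin.last k)) + slack v p = b).card := by
      intro a b
      refine Finset.card_bij (fun τ _ => excPosSeq hV τ) ?_ ?_ ?_
      · intro τ hτ
        obtain ⟨-, h1, h2, h3, h4⟩ := Finset.mem_filter.1 hτ
        rw [permBlocks_eq hV h1 h2] at h3
        rw [sub_permLastDescent_eq hV h1 h2] at h4
        exact Finset.mem_filter.2 ⟨excPosSeq_mem hV h1 h2, h3, h4⟩
      · intro τ hτ σ hσ h
        obtain ⟨-, h1, h2, -⟩ := Finset.mem_filter.1 hτ
        obtain ⟨-, h3, h4, -⟩ := Finset.mem_filter.1 hσ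
        exact excPosSeq_injective hV h1 h3 h2 h4 h
      · intro p hp
        obtain ⟨hp, h3, h4⟩ := Finset.mem_filter.1 hp
        obtain ⟨τ, h1, h2, rfl⟩ := exists_excPosSeq_eq hV hp
        rw [← permBlocks_eq hV h1 h2] at h3
        rw [← sub_permLastDescent_eq hV h1 h2] at h4
        exact ⟨τ, by simp [h1, h2, h3, h4], rfl⟩
    have hzero : ∀ a b, a ≤ n - 1 - v (Fin.last k) ∨ b ≤ n - 1 - v (Fin.last k) →
        ((boundedSeqs v).filter fun p => 1 + (gapSum v p + (n - 1 - v (Fin.last k))) = a ∧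
          (n - 1 - v (Fin.last k)) + slack v p = b).card = 0 := by
      intro a b hab
      rw [Finset.card_eq_zero, Finset.filter_eq_empty_iff]
      intro p hp
      have := (mem_boundedSeqs.1 hp).1 (Fin.last k)
      simp only [slack]
      omega
    rw [key, key]
    by_cases hab : a ≤ n - 1 - v (Fin.last k) ∨ b ≤ n - 1 - v (Fin.last k)
    · rw [hzero a b hab, hzero b a hab.symm]
    · have hshift : ∀ a b, n - 1 - v (Fin.last k) < a → n - 1 - v (Fin.last k) < b →
          ((boundedSeqs v).filter fun p => 1 + (gapSum v p + (n - 1 - v (Fin.last k))) = a ∧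
            (n - 1 - v (Fin.last k)) + slack v p = b) =
          (boundedSeqs v).filter fun p => gapSum v p = a - (n - 1 - v (Fin.last k)) - 1 ∧
            slack v p = b - (n - 1 - v (Fin.last k)) - 1 + 1 := by
        intro a b ha hb
        refine Finset.filter_congr fun p _ => ?_
        omega
      push Not at hab
      rw [hshift a b hab.1 hab.2, hshift b a hab.2 hab.1,
        card_gapSum_slack_symm (excValueSeq_strictMono hV).monotone]

/-- Adjacent values form an inverse descent exactly when the larger one alone is an excedance
value. -/
lemma PermAvoids321.symm_lt_symm_iff (hτ : PermAvoids321 τ) {r s : Fin n}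
    (hrs : (r : ℕ) + 1 = s) :
    τ.symm s < τ.symm r ↔ s ∈ excValues τ ∧ r ∉ excValues τ := by
  have hlt : r < s := by rw [Fin.lt_def]; omega
  have hmem : ∀ v, v ∈ excValues τ ↔ τ.symm v < τ (τ.symm v) := by simp [excValues]
  constructor
  · intro h
    have h1 : τ.symm s < τ (τ.symm s) := hτ.lt_of_inversion h (by simpa using hlt)
    refine ⟨(hmem s).2 h1, fun h2 => ?_⟩
    have := hτ.strictMonoOn_exc h1 ((hmem r).1 h2) h
    simp only [Equiv.apply_symm_apply] at this
    exact absurd hlt this.not_gt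
  · rintro ⟨hs, hr⟩
    by_contra! hle
    have hne : τ.symm r ≠ τ.symm s := fun he => hlt.ne (τ.symm.injective he)
    have hlt' := lt_of_le_of_ne hle hne
    obtain ⟨y, hy, hys⟩ := exists_inversion_of_lt ((hmem s).1 hs)
    rw [Equiv.apply_symm_apply] at hys
    have hyr : τ y ≠ r := by
      rintro rfl
      rw [Equiv.symm_apply_apply] at hlt'
      exact hlt'.not_gt hy
    have hyr' : τ y < τ (τ.symm r) := by
      rw [Equiv.apply_symm_apply]
      rw [Fin.lt_def] at hys ⊢
      have : (τ y : ℕ) ≠ r := fun h => hyr (Fin.ext h)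
      omega
    exact hr ((hmem r).2 (hτ.lt_of_inversion (hlt'.trans hy) hyr'))

/-- A permutation `e` of the symmetric group preserving 321-avoidance and inverse descents of
321-avoiding permutations, while exchanging the two statistics. -/
def IsStatSwap (e : Equiv.Perm (Equiv.Perm (Fin n))) : Prop :=
  ∀ τ, (PermAvoids321 (e τ) ↔ PermAvoids321 τ) ∧
    (PermAvoids321 τ → excValues (e τ) = excValues τ ∧
      permBlocks (e τ) = n - permLastDescent τ ∧ n - permLastDescent (e τ) = permBlocks τ)

lemma IsStatSwap.symm {e : Equiv.Perm (Equiv.Perm (Fin n))} (he : IsStatSwap e) :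
    IsStatSwap e.symm := by
  intro τ
  obtain ⟨h1, h2⟩ := he (e.symm τ)
  rw [Equiv.apply_symm_apply] at h1 h2
  refine ⟨h1.symm, fun hτ => ?_⟩
  obtain ⟨h3, h4, h5⟩ := h2 (h1.1 hτ)
  exact ⟨h3.symm, h5.symm, h4.symm⟩

lemma exists_isStatSwap (hn : 0 < n) : ∃ e : Equiv.Perm (Equiv.Perm (Fin n)), IsStatSwap e := by
  let α := {τ : Equiv.Perm (Fin n) // PermAvoids321 τ}
  let f : α → Finset (Fin n) × ℕ × ℕ := fun τ =>
    (excValues τ.1, permBlocks τ.1, n - permLastDescent τ.1)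
  let g : α → Finset (Fin n) × ℕ × ℕ := fun τ =>
    (excValues τ.1, n - permLastDescent τ.1, permBlocks τ.1)
  have hcard : ∀ c, Nonempty ({τ // f τ = c} ≃ {τ // g τ = c}) := by
    rintro ⟨V, a, b⟩
    refine ⟨Fintype.equivOfCardEq ?_⟩
    have h := card_avoids321_symm hn V a b
    rw [← Fintype.card_subtype, ← Fintype.card_subtype] at h
    have e1 : {τ // f τ = (V, a, b)} ≃ {τ : Equiv.Perm (Fin n) // PermAvoids321 τ ∧
        excValues τ = V ∧ permBlocks τ = a ∧ n - permLastDescent τ = b} :=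
      (Equiv.subtypeSubtypeEquivSubtypeInter (fun τ => PermAvoids321 τ) (fun τ =>
        (excValues τ, permBlocks τ, n - permLastDescent τ) = (V, a, b))).trans
        (Equiv.subtypeEquivRight fun τ => by simp [Prod.ext_iff])
    have e2 : {τ // g τ = (V, a, b)} ≃ {τ : Equiv.Perm (Fin n) // PermAvoids321 τ ∧
        excValues τ = V ∧ permBlocks τ = b ∧ n - permLastDescent τ = a} :=
      (Equiv.subtypeSubtypeEquivSubtypeInter (fun τ => PermAvoids321 τ) (fun τ =>
        (excValues τ, n - permLastDescent τ, permBlocks τ) = (V, a, b))).trans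
        (Equiv.subtypeEquivRight fun τ => by simp [Prod.ext_iff, and_comm])
    rw [Fintype.card_congr e1, Fintype.card_congr e2, h]
  let e : Equiv.Perm α := Equiv.ofFiberEquiv fun c => (hcard c).some
  have he : ∀ τ, g (e τ) = f τ := Equiv.ofFiberEquiv_map _
  refine ⟨Equiv.Perm.ofSubtype e, fun τ => ?_⟩
  by_cases hτ : PermAvoids321 τ
  · rw [Equiv.Perm.ofSubtype_apply_of_mem e hτ]
    have h := he ⟨τ, hτ⟩
    simp only [f, g, Prod.mk.injEq] at h
    exact ⟨iff_of_true (e _).2 hτ, fun _ => ⟨h.1, h.2.2, h.2.1⟩⟩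
  · rw [Equiv.Perm.ofSubtype_apply_of_not_mem e hτ]
    exact ⟨Iff.rfl, fun h => absurd h hτ⟩

end Perm

lemma InB.map_zero {n : ℕ} {w : Equiv.Perm ℤ} (hw : InB n w) : w 0 = 0 := by
  have := hw.1 0
  rw [neg_zero] at this
  omega

lemma InB.apply_ne_zero {n : ℕ} {w : Equiv.Perm ℤ} (hw : InB n w) {x : ℤ} (hx : x ≠ 0) :
    w x ≠ 0 := fun h => hx (w.injective (h.trans hw.map_zero.symm))

lemma InB.abs_apply_le {n : ℕ} {w : Equiv.Perm ℤ} (hw : InB n w) {x : ℤ} (hx : |x| ≤ n) :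
    |w x| ≤ n := by
  by_contra! h
  rw [w.injective (hw.2 _ h)] at h
  omega

lemma InB.inv {n : ℕ} {w : Equiv.Perm ℤ} (hw : InB n w) : InB n w⁻¹ := by
  constructor
  · intro i
    rw [Equiv.Perm.inv_eq_iff_eq, hw.1, ← Equiv.Perm.inv_eq_iff_eq.1 rfl]
  · intro i hi
    rw [Equiv.Perm.inv_eq_iff_eq, hw.2 i hi]

section Window

variable {n : ℕ}

/-- The `i`-th entry of the window of `w⁻¹`, indexed from zero. -/
def invEntry (n : ℕ) (w : Equiv.Perm ℤ) (i : Fin n) : ℤ := w⁻¹ ((i : ℤ) + 1)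

/-- The standardization of the window of `w⁻¹`. -/
def invStd (n : ℕ) (w : Equiv.Perm ℤ) : Equiv.Perm (Fin n) := (Tuple.sort (invEntry n w))⁻¹

lemma invEntry_injective (w : Equiv.Perm ℤ) : Function.Injective (invEntry n w) := by
  intro i j h
  have := w⁻¹.injective h
  exact Fin.ext (by omega)

lemma strictMono_invEntry_invStd_symm (w : Equiv.Perm ℤ) :
    StrictMono fun r => invEntry n w ((invStd n w).symm r) :=
  (Tuple.monotone_sort (invEntry n w)).strictMono_of_injective
    ((invEntry_injective w).comp (Tuple.sort (invEntry n w)).injective)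

lemma invStd_lt_iff (w : Equiv.Perm ℤ) {i j : Fin n} :
    invStd n w i < invStd n w j ↔ invEntry n w i < invEntry n w j := by
  have := (strictMono_invEntry_invStd_symm (n := n) w).lt_iff_lt
    (a := invStd n w i) (b := invStd n w j)
  simpa using this.symm

lemma apply_invEntry (w : Equiv.Perm ℤ) (i : Fin n) : w (invEntry n w i) = (i : ℤ) + 1 :=
  (Equiv.Perm.inv_eq_iff_eq.1 rfl).symm

/-- The positions in `[-n, n]` at which `w` is positive. -/
def posSet (n : ℕ) (w : Equiv.Perm ℤ) : Set ℤ := {x | |x| ≤ n ∧ 0 < w x}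

lemma invEntry_mem_posSet {w : Equiv.Perm ℤ} (hw : InB n w) (i : Fin n) :
    invEntry n w i ∈ posSet n w := by
  refine ⟨hw.inv.abs_apply_le ?_, ?_⟩
  · rw [abs_le]
    omega
  · rw [apply_invEntry]
    omega

lemma exists_invEntry_eq {w : Equiv.Perm ℤ} (hw : InB n w) {x : ℤ} (hx : x ∈ posSet n w) :
    ∃ i, invEntry n w i = x := by
  have h1 := hw.abs_apply_le hx.1
  have h2 := hx.2
  rw [abs_le] at h1
  refine ⟨⟨(w x - 1).toNat, by omega⟩, w.injective ?_⟩
  rw [apply_invEntry]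
  simp only
  omega

lemma bl_inv_eq (w : Equiv.Perm ℤ) : bl n w⁻¹ = permBlocks (invStd n w) := by
  rw [bl, permBlocks]
  congr 2
  ext i
  simp only [Finset.mem_filter, Finset.mem_Ioo]
  refine and_congr_right fun hi => ?_
  constructor
  · intro h j k hj hk
    rw [invStd_lt_iff]
    have := h (j + 1) (by simp; omega) (k + 1) (by simp; omega)
    simpa [invEntry] using this
  · intro h j hj k hk
    rw [Finset.mem_Icc] at hj hk
    have := h ⟨j - 1, by omega⟩ ⟨k - 1, by omega⟩ (by simp only; omega) (by simp only; omega)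
    rw [invStd_lt_iff, invEntry, invEntry] at this
    convert this using 2 <;> simp only <;> omega

lemma ldes_inv_eq (w : Equiv.Perm ℤ) : ldes n w⁻¹ = permLastDescent (invStd n w) := by
  have hmem : ∀ i, i ≠ 0 → (i ∈ DesB n w⁻¹ ↔ i ∈ (Finset.Ioo 0 n).filter fun i =>
      ∃ j k : Fin n, (j : ℕ) + 1 = i ∧ (k : ℕ) = i ∧ invStd n w k < invStd n w j) := by
    intro i hi
    simp only [DesB, went, Finset.mem_filter, Finset.mem_range, Finset.mem_Ioo, if_neg hi,
      Nat.succ_ne_zero, if_false]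
    constructor
    · rintro ⟨h1, h2⟩
      refine ⟨by omega, ⟨i - 1, by omega⟩, ⟨i, h1⟩, by simp only; omega, rfl, ?_⟩
      rw [invStd_lt_iff, invEntry, invEntry]
      convert h2 using 2 <;> simp only <;> omega
    · rintro ⟨⟨-, h1⟩, j, k, hj, hk, h2⟩
      rw [invStd_lt_iff, invEntry, invEntry] at h2
      refine ⟨h1, ?_⟩
      convert h2 using 2 <;> omega
  apply le_antisymm <;> refine Finset.sup_le fun i hi => ?_ <;>
    rcases eq_or_ne i 0 with rfl | h0
  · exact Nat.zero_le _
  · exact Finset.le_sup (f := id) ((hmem i h0).1 hi)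
  · exact Nat.zero_le _
  · exact Finset.le_sup (f := id) ((hmem i h0).2 hi)

lemma permAvoids321_invStd_iff {w : Equiv.Perm ℤ} (hw : InB n w) :
    PermAvoids321 (invStd n w) ↔ ∀ x ∈ posSet n w, ∀ y ∈ posSet n w, ∀ z ∈ posSet n w,
      x < y → y < z → w z < w y → ¬ w y < w x := by
  constructor
  · intro h x hx y hy z hz hxy hyz hzy hyx
    obtain ⟨i, rfl⟩ := exists_invEntry_eq hw hx
    obtain ⟨j, rfl⟩ := exists_invEntry_eq hw hy
    obtain ⟨k, rfl⟩ := exists_invEntry_eq hw hz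
    rw [apply_invEntry, apply_invEntry] at hzy hyx
    exact h k j i (by rw [Fin.lt_def]; omega) (by rw [Fin.lt_def]; omega)
      ((invStd_lt_iff w).2 hxy) ((invStd_lt_iff w).2 hyz)
  · intro h i j k hij hjk hkj hji
    rw [invStd_lt_iff] at hkj hji
    rw [Fin.lt_def] at hij hjk
    refine h _ (invEntry_mem_posSet hw k) _ (invEntry_mem_posSet hw j) _
      (invEntry_mem_posSet hw i) hkj hji ?_ ?_ <;> rw [apply_invEntry, apply_invEntry] <;> omega

/-- The part of the full commutativity criterion that is not 321-avoidance of `invStd n w`. -/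
structure SignCond (n : ℕ) (w : Equiv.Perm ℤ) : Prop where
  neg : ∀ x ∈ posSet n w, ∀ y ∈ posSet n w, x < y → y < 0 → w x < w y
  pos : ∀ x ∈ posSet n w, ∀ y ∈ posSet n w, ∀ z ∈ posSet n w,
    0 < x → x < y → y < -z → w x < w y
  mixed : ∀ x ∈ posSet n w, ∀ y ∈ posSet n w, ∀ z ∈ posSet n w, ∀ z' ∈ posSet n w,
    z < z' → z' < 0 → x < 0 → 0 < y → y < -z → w x < w y

lemma mem_posSet_of_pos {w : Equiv.Perm ℤ} {i : ℕ} (hi : i ≤ n) (h : 0 < w (i : ℤ)) :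
    (i : ℤ) ∈ posSet n w := ⟨by rw [abs_le]; omega, h⟩

lemma InB.neg_mem_posSet {w : Equiv.Perm ℤ} (hw : InB n w) {i : ℕ} (hi : i ≤ n)
    (h : w (i : ℤ) < 0) : -(i : ℤ) ∈ posSet n w :=
  ⟨by rw [abs_le]; omega, by rw [hw.1]; omega⟩

lemma isFC_iff {w : Equiv.Perm ℤ} :
    IsFC n w ↔ InB n w ∧ PermAvoids321 (invStd n w) ∧ SignCond n w := by
  rw [IsFC]
  refine and_congr_right fun hw => ?_
  rw [permAvoids321_invStd_iff hw]
  have hne : ∀ x y, x < y → w y ≤ w x → w y < w x := fun x y h1 h2 =>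
    lt_of_le_of_ne h2 fun h => h1.ne' (w.injective h)
  constructor
  · rintro ⟨h1, h2, h3⟩
    replace h1 : ∀ i j : ℤ, 0 < i → i < j → j ≤ n → w j < w i → ¬ w i < 0 := by
      intro i j hi hij hj h h'
      lift i to ℕ using hi.le
      lift j to ℕ using by omega
      exact h1 ⟨i, j, by omega, by omega, by omega, h, h'⟩
    replace h2 : ∀ i j k : ℤ, 0 < i → i < j → j < k → k ≤ n → w j < |w i| → ¬ w k < w j := by
      intro i j k hi hij hjk hk h h'
      lift i to ℕ using hi.le
      lift j to ℕ using by omega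
      lift k to ℕ using by omega
      exact h2 ⟨i, j, k, by omega, by omega, by omega, by omega, h, h'⟩
    replace h3 : ∀ i j k : ℤ, 0 < i → i < j → j < k → k ≤ n → |w i| < - w j →
        ¬ w k < |w i| := by
      intro i j k hi hij hjk hk h h'
      lift i to ℕ using hi.le
      lift j to ℕ using by omega
      lift k to ℕ using by omega
      exact h3 ⟨i, j, k, by omega, by omega, by omega, by omega, h, h'⟩
    have hb : ∀ x ∈ posSet n w, -(n : ℤ) ≤ x ∧ x ≤ n ∧ 0 < w x ∧ w (-x) = -w x ∧ |w x| = w x ∧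
        |w (-x)| = w x := by
      intro x hx
      refine ⟨(abs_le.1 hx.1).1, (abs_le.1 hx.1).2, hx.2, hw.1 x, abs_of_pos hx.2, ?_⟩
      rw [hw.1, abs_neg, abs_of_pos hx.2]
    have hz0 : ∀ x ∈ posSet n w, x ≠ 0 := by
      rintro x hx rfl
      have := hx.2
      rw [hw.map_zero] at this
      omega
    have hneg : ∀ x ∈ posSet n w, ∀ y ∈ posSet n w, x < y → y < 0 → w x < w y := by
      intro x hx y hy hxy hy0
      have hx' := hb x hx
      have hy' := hb y hy
      by_contra! hle
      have := hne x y hxy hle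
      exact h1 (-y) (-x) (by omega) (by omega) (by omega) (by omega) (by omega)
    refine ⟨?_, hneg, ?_, ?_⟩
    · intro x hx y hy z hz hxy hyz hzy hyx
      have hx' := hb x hx
      have hy' := hb y hy
      have hz' := hb z hz
      have hx0 := hz0 x hx
      have hy0 := hz0 y hy
      rcases lt_or_gt_of_ne hy0 with hy0 | hy0
      · exact (hneg x hx y hy hxy hy0).not_gt hyx
      rcases lt_or_gt_of_ne hx0 with hx0 | hx0
      · rcases lt_trichotomy (-x) y with h | h | h
        · exact h2 (-x) y z (by omega) h hyz (by omega) (by omega) hzy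
        · have := hw.1 x
          rw [h] at this
          omega
        · rcases lt_trichotomy (-x) z with h' | h' | h'
          · exact h3 y (-x) z (by omega) h h' (by omega) (by omega) (by omega)
          · have := hw.1 x
            rw [h'] at this
            omega
          · exact h2 y z (-x) (by omega) hyz h' (by omega) (by omega) (by omega)
      · exact h2 x y z (by omega) hxy hyz (by omega) (by omega) hzy
    · intro x hx y hy z hz hx0 hxy hyz
      have hx' := hb x hx
      have hy' := hb y hy
      have hz' := hb z hz
      by_contra! hle
      have := hne x y hxy hle
      exact h2 x y (-z) hx0 hxy hyz (by omega) (by omega) (by omega)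
    · have key : ∀ x ∈ posSet n w, ∀ y ∈ posSet n w, ∀ z ∈ posSet n w,
          z < x → x < 0 → 0 < y → y < -z → w x < w y := by
        intro x hx y hy z hz hzx hx0 hy0 hyz
        have hx' := hb x hx
        have hy' := hb y hy
        have hz' := hb z hz
        by_contra! hle
        have := hne x y (by omega) hle
        rcases lt_trichotomy (-x) y with h | h | h
        · exact h2 (-x) y (-z) (by omega) h hyz (by omega) (by omega) (by omega)
        · have := hw.1 x
          rw [h] at this
          omega
        · exact h3 y (-x) (-z) hy0 h (by omega) (by omega) (by omega) (by omega)
      intro x hx y hy z hz z' hz' hzz hz0' hx0 hy0 hyz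
      rcases lt_or_ge z x with h | h
      · exact key x hx y hy z hz h hx0 hy0 hyz
      · have h4 := key z' hz' y hy z hz hzz hz0' hy0 hyz
        have h5 := hneg z hz z' hz' hzz hz0'
        rcases h.eq_or_lt with rfl | h
        · exact h5.trans h4
        · exact ((hneg x hx z hz h (by omega)).trans h5).trans h4
  · rintro ⟨hav, hneg, hpos, hmix⟩
    have hb : ∀ i : ℕ, 0 < i → i ≤ n → ((i : ℤ) ∈ posSet n w ∧ 0 < w i ∧ |w i| = w i) ∨
        (-(i : ℤ) ∈ posSet n w ∧ w i < 0 ∧ |w i| = -w i ∧ w (-i) = -w i) := by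
      intro i hi hin
      rcases lt_or_gt_of_ne (hw.apply_ne_zero (x := i) (by omega)) with h | h
      · exact .inr ⟨hw.neg_mem_posSet hin h, h, abs_of_neg h, hw.1 i⟩
      · exact .inl ⟨mem_posSet_of_pos hin h, h, abs_of_pos h⟩
    have hdec : ∀ i j : ℕ, 1 ≤ i → i < j → j ≤ n → w (j : ℤ) < w (i : ℤ) → ¬ w (i : ℤ) < 0 := by
      intro i j hi hij hj h h0
      have := hneg _ (hw.neg_mem_posSet hj (h.trans h0)) _
        (hw.neg_mem_posSet (by omega) h0) (by omega) (by omega)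
      rw [hw.1, hw.1] at this
      omega
    refine ⟨fun ⟨i, j, h1, h2, h3, h4, h5⟩ => hdec i j h1 h2 h3 h4 h5, ?_, ?_⟩
    · rintro ⟨i, j, k, h1, h2, h3, h4, h5, h6⟩
      rcases hb j (by omega) (by omega) with hj | hj
      · rcases hb i (by omega) (by omega) with hi | hi <;>
          rcases hb k (by omega) (by omega) with hk | hk
        · exact hav _ hi.1 _ hj.1 _ hk.1 (by omega) (by omega) h6 (by omega)
        · have := hpos _ hi.1 _ hj.1 _ hk.1 (by omega) (by omega) (by omega)
          omega
        · exact hav _ hi.1 _ hj.1 _ hk.1 (by omega) (by omega) h6 (by omega)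
        · have := hmix _ hi.1 _ hj.1 _ hk.1 _ hi.1 (by omega) (by omega) (by omega) (by omega)
            (by omega)
          omega
      · exact hdec j k (by omega) h3 h4 h6 hj.2.1
    · rintro ⟨i, j, k, h1, h2, h3, h4, h5, h6⟩
      rcases hb j (by omega) (by omega) with hj | hj
      · have := abs_nonneg (w i)
        omega
      · rcases hb i (by omega) (by omega) with hi | hi
        · rcases hb k (by omega) (by omega) with hk | hk
          · exact hav _ hj.1 _ hi.1 _ hk.1 (by omega) (by omega) (by omega) (by omega)
          · have := hmix _ hj.1 _ hi.1 _ hk.1 _ hj.1 (by omega) (by omega) (by omega) (by omega)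
              (by omega)
            omega
        · exact hdec i j h1 h2 (by omega) (by omega) hi.2.1

end Window
section Transfer

variable {n : ℕ}

/-- Every interval of `posSet n w` on which `w` is increasing has its ends in increasing order
under `w'`. -/
def KeepsIncreasing (n : ℕ) (w w' : Equiv.Perm ℤ) : Prop :=
  ∀ x ∈ posSet n w, ∀ y ∈ posSet n w, x < y →
    (∀ x' ∈ posSet n w, ∀ y' ∈ posSet n w, x ≤ x' → x' < y' → y' ≤ y → w x' < w y') →
    w' x < w' y

lemma symm_lt_symm_of_interval {τ τ' : Equiv.Perm (Fin n)} (hτ : PermAvoids321 τ)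
    (hτ' : PermAvoids321 τ') (hV : excValues τ' = excValues τ) {r s : Fin n} (hrs : r < s)
    (h : ∀ t t', r ≤ t → t < t' → t' ≤ s → τ.symm t < τ.symm t') : τ'.symm r < τ'.symm s := by
  obtain ⟨r, hr⟩ := r
  obtain ⟨s, hs⟩ := s
  induction s, (show r + 1 ≤ s from hrs) using Nat.le_induction with
  | base =>
    refine lt_of_le_of_ne (not_lt.1 fun hlt => ?_) fun he => hrs.ne (τ'.symm.injective he)
    rw [hτ'.symm_lt_symm_iff rfl, hV, ← hτ.symm_lt_symm_iff rfl] at hlt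
    exact (h _ _ le_rfl hrs le_rfl).not_gt hlt
  | succ s hrs' ih =>
    have hlt : (⟨s, by omega⟩ : Fin n) < ⟨s + 1, hs⟩ := by simp
    refine (ih (by omega) hrs' fun t t' h1 h2 h3 => h t t' h1 h2 (h3.trans hlt.le)).trans ?_
    refine lt_of_le_of_ne (not_lt.1 fun hlt' => ?_) fun he => hlt.ne (τ'.symm.injective he)
    rw [hτ'.symm_lt_symm_iff rfl, hV, ← hτ.symm_lt_symm_iff rfl] at hlt'
    exact (h _ _ (by simp; omega) hlt le_rfl).not_gt hlt'

lemma keepsIncreasing {w w' : Equiv.Perm ℤ} (hw : InB n w)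
    (h : ∀ r, invEntry n w' ((invStd n w').symm r) = invEntry n w ((invStd n w).symm r))
    (ha : PermAvoids321 (invStd n w)) (ha' : PermAvoids321 (invStd n w'))
    (hV : excValues (invStd n w') = excValues (invStd n w)) : KeepsIncreasing n w w' := by
  intro x hx y hy hxy hinc
  obtain ⟨i, rfl⟩ := exists_invEntry_eq hw hx
  obtain ⟨j, rfl⟩ := exists_invEntry_eq hw hy
  obtain ⟨r, rfl⟩ := (invStd n w).symm.surjective i
  obtain ⟨s, rfl⟩ := (invStd n w).symm.surjective j
  have hu := strictMono_invEntry_invStd_symm (n := n) w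
  have := symm_lt_symm_of_interval ha ha' hV (hu.lt_iff_lt.1 hxy) fun t t' h1 h2 h3 => by
    have := hinc _ (invEntry_mem_posSet hw _) _ (invEntry_mem_posSet hw _) (hu.monotone h1)
      (hu h2) (hu.monotone h3)
    rw [apply_invEntry, apply_invEntry] at this
    rw [Fin.lt_def]
    omega
  rw [← h, ← h, apply_invEntry, apply_invEntry]
  rw [Fin.lt_def] at this
  omega

lemma SignCond.transfer {w w' : Equiv.Perm ℤ} (hw : InB n w) (h : KeepsIncreasing n w w')
    (hP : posSet n w' = posSet n w) (hs : SignCond n w) : SignCond n w' := by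
  obtain ⟨hneg, hpos, hmix⟩ := hs
  constructor <;> rw [hP]
  · intro x hx y hy hxy hy0
    exact h x hx y hy hxy fun x' hx' y' hy' h1 h2 h3 => hneg x' hx' y' hy' h2 (by omega)
  · intro x hx y hy z hz hx0 hxy hyz
    exact h x hx y hy hxy fun x' hx' y' hy' h1 h2 h3 =>
      hpos x' hx' y' hy' z hz (by omega) h2 (by omega)
  · intro x hx y hy z hz z' hz' hzz hz0 hx0 hy0 hyz
    refine h x hx y hy (by omega) fun x' hx' y' hy' h1 h2 h3 => ?_
    have hne : ∀ x ∈ posSet n w, x ≠ 0 := by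
      rintro x hx rfl
      exact hx.2.ne' hw.map_zero
    rcases lt_or_gt_of_ne (hne y' hy') with hy0' | hy0'
    · exact hneg x' hx' y' hy' h2 hy0'
    rcases lt_or_gt_of_ne (hne x' hx') with hx0' | hx0'
    · exact hmix x' hx' y' hy' z hz z' hz' hzz hz0 hx0' hy0' (by omega)
    · exact hpos x' hx' y' hy' z hz hx0' h2 (by omega)

lemma desB_subset {w w' : Equiv.Perm ℤ} (hw : InB n w) (hw' : InB n w')
    (h : KeepsIncreasing n w w') (hpos : ∀ x, 0 < w' x ↔ 0 < w x) (hs : SignCond n w') :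
    DesB n w' ⊆ DesB n w := by
  intro i hi
  simp only [DesB, Finset.mem_filter, Finset.mem_range, went, Nat.succ_ne_zero, if_false] at hi ⊢
  obtain ⟨hin, hi⟩ := hi
  refine ⟨hin, ?_⟩
  have hne := hw.apply_ne_zero (x := ((i + 1 : ℕ) : ℤ)) (by omega)
  have h1 := hpos ((i + 1 : ℕ) : ℤ)
  split_ifs at hi ⊢ with h0
  · omega
  have hne0 := hw.apply_ne_zero (x := (i : ℤ)) (by omega)
  have hne0' := hw'.apply_ne_zero (x := (i : ℤ)) (by omega)
  have h2 := hpos (i : ℤ)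
  rcases lt_or_gt_of_ne hne0 with hi0 | hi0
  · have h3 := hs.neg _ (hw'.neg_mem_posSet (i := i + 1) (by omega) (by omega)) _
      (hw'.neg_mem_posSet (i := i) (by omega) (by omega)) (by omega) (by omega)
    rw [hw'.1, hw'.1] at h3
    omega
  rcases lt_or_gt_of_ne hne with hj0 | hj0
  · omega
  · by_contra! hle
    have hlt : w i < w ((i + 1 : ℕ) : ℤ) :=
      lt_of_le_of_ne hle fun he => by have := w.injective he; omega
    refine hi.not_gt (h _ (mem_posSet_of_pos (by omega) hi0) _
      (mem_posSet_of_pos (by omega) hj0) (by omega) fun x' hx' y' hy' h3 h4 h5 => ?_)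
    rwa [show x' = i by omega, show y' = ((i + 1 : ℕ) : ℤ) by omega]

end Transfer

section Lift

variable {n : ℕ}

/-- The extension of a permutation of `Fin n`, viewed as `{1, …, n}`, to the natural numbers. -/
def natExt (ρ : Equiv.Perm (Fin n)) (m : ℕ) : ℕ :=
  if h : 0 < m ∧ m - 1 < n then ρ ⟨m - 1, h.2⟩ + 1 else m

lemma natExt_pos_iff (ρ : Equiv.Perm (Fin n)) (m : ℕ) : 0 < natExt ρ m ↔ 0 < m := by
  rw [natExt]
  split_ifs <;> omega

lemma natExt_natExt {ρ σ : Equiv.Perm (Fin n)} (h : ∀ i, ρ (σ i) = i) (m : ℕ) :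
    natExt ρ (natExt σ m) = m := by
  by_cases hm : 0 < m ∧ m - 1 < n
  · rw [natExt, natExt, dif_pos hm, dif_pos (by simp)]
    simp only [Nat.add_sub_cancel, Fin.eta, h]
    omega
  · rw [natExt, natExt, dif_neg hm, dif_neg hm]

lemma sign_mul_natExt_natExt {ρ σ : Equiv.Perm (Fin n)} (h : ∀ i, ρ (σ i) = i) (z : ℤ) :
    (z.sign * natExt σ z.natAbs).sign * natExt ρ (z.sign * natExt σ z.natAbs).natAbs = z := by
  rcases eq_or_ne z 0 with rfl | hz
  · simp
  have hpos := (natExt_pos_iff σ z.natAbs).2 (Int.natAbs_pos.2 hz)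
  have h1 : (z.sign * natExt σ z.natAbs).natAbs = natExt σ z.natAbs := by
    rw [Int.natAbs_mul, Int.natAbs_sign_of_ne_zero hz, one_mul, Int.natAbs_natCast]
  rw [h1, natExt_natExt h, Int.sign_mul, Int.sign_sign,
    Int.sign_eq_one_of_pos (Int.natCast_pos.2 hpos), mul_one, Int.sign_mul_natAbs]

/-- The signed permutation extending a permutation of `Fin n`, viewed as `{1, …, n}`. -/
def oddExt (ρ : Equiv.Perm (Fin n)) : Equiv.Perm ℤ where
  toFun z := z.sign * natExt ρ z.natAbs
  invFun z := z.sign * natExt ρ.symm z.natAbs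
  left_inv := sign_mul_natExt_natExt ρ.symm_apply_apply
  right_inv := sign_mul_natExt_natExt ρ.apply_symm_apply

lemma oddExt_apply (ρ : Equiv.Perm (Fin n)) (z : ℤ) :
    oddExt ρ z = z.sign * natExt ρ z.natAbs := rfl

lemma oddExt_inv (ρ : Equiv.Perm (Fin n)) : (oddExt ρ)⁻¹ = oddExt ρ⁻¹ := rfl

lemma oddExt_pos_iff (ρ : Equiv.Perm (Fin n)) (z : ℤ) : 0 < oddExt ρ z ↔ 0 < z := by
  have := natExt_pos_iff ρ z.natAbs
  rw [oddExt_apply]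
  rcases lt_trichotomy z 0 with h | rfl | h
  · rw [Int.sign_eq_neg_one_of_neg h]
    omega
  · simp
  · rw [Int.sign_eq_one_of_pos h]
    omega

lemma inB_oddExt (ρ : Equiv.Perm (Fin n)) : InB n (oddExt ρ) := by
  constructor
  · intro i
    simp [oddExt_apply]
  · intro i hi
    rw [Int.abs_eq_natAbs] at hi
    rw [oddExt_apply, natExt, dif_neg (by omega), Int.sign_mul_natAbs]

lemma oddExt_coe_add_one (ρ : Equiv.Perm (Fin n)) (i : Fin n) :
    oddExt ρ ((i : ℤ) + 1) = (ρ i : ℤ) + 1 := by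
  have h : ((i : ℤ) + 1).natAbs = i + 1 := by omega
  rw [oddExt_apply, Int.sign_eq_one_of_pos (by omega), natExt]
  simp [h]

/-- The action on signed permutations of a permutation of the symmetric group, which replaces
the standardization of the inverse window without changing its values. -/
def liftSwap (e : Equiv.Perm (Equiv.Perm (Fin n))) (w : Equiv.Perm ℤ) : Equiv.Perm ℤ :=
  (oddExt ((invStd n w)⁻¹ * e (invStd n w)))⁻¹ * w

lemma invEntry_oddExt_inv_mul (ρ : Equiv.Perm (Fin n)) (w : Equiv.Perm ℤ) :
    invEntry n ((oddExt ρ)⁻¹ * w) = invEntry n w ∘ ρ := by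
  ext i
  rw [invEntry, mul_inv_rev, inv_inv, Equiv.Perm.mul_apply, oddExt_coe_add_one]
  rfl

lemma invStd_oddExt_inv_mul (ρ : Equiv.Perm (Fin n)) (w : Equiv.Perm ℤ) :
    invStd n ((oddExt ρ)⁻¹ * w) = invStd n w * ρ := by
  rw [← inv_inj]
  ext1 r
  have h := congrFun (Tuple.comp_perm_comp_sort_eq_comp_sort (f := invEntry n w) (σ := ρ)) r
  have h' := invEntry_injective w h
  rw [invStd, invEntry_oddExt_inv_mul, invStd, inv_inv, mul_inv_rev, inv_inv,
    Equiv.Perm.mul_apply, Equiv.Perm.eq_inv_iff_eq]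
  exact h'

lemma invStd_liftSwap (e : Equiv.Perm (Equiv.Perm (Fin n))) (w : Equiv.Perm ℤ) :
    invStd n (liftSwap e w) = e (invStd n w) := by
  rw [liftSwap, invStd_oddExt_inv_mul, mul_inv_cancel_left]

lemma liftSwap_symm_liftSwap (e : Equiv.Perm (Equiv.Perm (Fin n))) (w : Equiv.Perm ℤ) :
    liftSwap e.symm (liftSwap e w) = w := by
  rw [liftSwap, invStd_liftSwap, Equiv.symm_apply_apply, liftSwap, oddExt_inv, oddExt_inv,
    ← mul_assoc, ← oddExt_inv, mul_inv_rev, inv_inv, inv_mul_cancel, one_mul]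

lemma liftSwap_pos_iff (e : Equiv.Perm (Equiv.Perm (Fin n))) (w : Equiv.Perm ℤ) (x : ℤ) :
    0 < liftSwap e w x ↔ 0 < w x := by
  rw [liftSwap, oddExt_inv, Equiv.Perm.mul_apply, oddExt_pos_iff]

lemma InB.liftSwap {w : Equiv.Perm ℤ} (hw : InB n w) (e : Equiv.Perm (Equiv.Perm (Fin n))) :
    InB n (liftSwap e w) := by
  rw [Paper.liftSwap, oddExt_inv]
  refine ⟨fun i => ?_, fun i hi => ?_⟩
  · rw [Equiv.Perm.mul_apply, Equiv.Perm.mul_apply, hw.1, (inB_oddExt _).1]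
  · rw [Equiv.Perm.mul_apply, hw.2 i hi, (inB_oddExt _).2 i hi]

lemma invEntry_liftSwap (e : Equiv.Perm (Equiv.Perm (Fin n))) (w : Equiv.Perm ℤ) (r : Fin n) :
    invEntry n (liftSwap e w) ((invStd n (liftSwap e w)).symm r) =
      invEntry n w ((invStd n w).symm r) := by
  rw [liftSwap, invEntry_oddExt_inv_mul, invStd_oddExt_inv_mul, Function.comp_apply]
  congr 1
  rw [Equiv.eq_symm_apply, ← Equiv.Perm.mul_apply, Equiv.apply_symm_apply]

lemma IsStatSwap.liftSwap {e : Equiv.Perm (Equiv.Perm (Fin n))} (he : IsStatSwap e)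
    {w : Equiv.Perm ℤ} (hw : IsFC n w) :
    IsFC n (liftSwap e w) ∧ DesB n (liftSwap e w) = DesB n w ∧
      NegSet n (liftSwap e w) = NegSet n w ∧
      bl n (liftSwap e w)⁻¹ = n - ldes n w⁻¹ ∧ n - ldes n (liftSwap e w)⁻¹ = bl n w⁻¹ := by
  obtain ⟨hB, ha, hs⟩ := isFC_iff.1 hw
  obtain ⟨he1, he2⟩ := he (invStd n w)
  obtain ⟨hV, hbl, hld⟩ := he2 ha
  have ha' := he1.2 ha
  rw [← invStd_liftSwap] at hV hbl hld ha'
  have hB' := hB.liftSwap e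
  have hpos := liftSwap_pos_iff e w
  have hP : posSet n (Paper.liftSwap e w) = posSet n w := by
    ext x
    exact and_congr_right fun _ => hpos x
  have hk := keepsIncreasing hB (invEntry_liftSwap e w) ha ha' hV
  have hk' := keepsIncreasing hB' (fun r => (invEntry_liftSwap e w r).symm) ha' ha hV.symm
  have hs' := hs.transfer hB hk hP
  refine ⟨isFC_iff.2 ⟨hB', ha', hs'⟩, ?_, ?_, ?_, ?_⟩
  · exact (desB_subset hB hB' hk hpos hs').antisymm
      (desB_subset hB' hB hk' (fun x => (hpos x).symm) hs)
  · refine Finset.filter_congr fun i hi => ?_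
    rw [Finset.mem_Icc] at hi
    have h1 := hB.apply_ne_zero (x := (i : ℤ)) (by omega)
    have h2 := hB'.apply_ne_zero (x := (i : ℤ)) (by omega)
    have h3 := hpos i
    omega
  · rw [bl_inv_eq, ldes_inv_eq, hbl]
  · rw [bl_inv_eq, ldes_inv_eq, hld]

end Lift

theorem equidistribution_FC_Bn (n : ℕ) (hn : 0 < n) (J : Finset ℕ)
    (hJ : J ⊆ Finset.range n) (K : Finset ℕ) (hK : K ⊆ Finset.Icc 1 n) (a b : ℕ) :
    Nat.card {w : Equiv.Perm ℤ // IsFC n w ∧ DesB n w = J ∧ NegSet n w = K ∧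
        bl n w⁻¹ = a ∧ n - ldes n w⁻¹ = b} =
      Nat.card {w : Equiv.Perm ℤ // IsFC n w ∧ DesB n w = J ∧ NegSet n w = K ∧
        n - ldes n w⁻¹ = a ∧ bl n w⁻¹ = b} := by
  obtain ⟨e, he⟩ := exists_isStatSwap hn
  refine Nat.card_congr ⟨fun w => ⟨liftSwap e w.1, ?_⟩, fun w => ⟨liftSwap e.symm w.1, ?_⟩,
    fun w => Subtype.ext (liftSwap_symm_liftSwap e w.1),
    fun w => Subtype.ext (liftSwap_symm_liftSwap e.symm w.1)⟩
  · obtain ⟨w, hw, rfl, rfl, rfl, rfl⟩ := w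
    obtain ⟨h1, h2, h3, h4, h5⟩ := he.liftSwap hw
    exact ⟨h1, h2, h3, h5, h4⟩
  · obtain ⟨w, hw, rfl, rfl, rfl, rfl⟩ := w
    exact he.symm.liftSwap hw

end Paper
end
end

section
/- For every positive integer n, the following identity of formal power series in x_1,x_2,… with polynomial coefficients in q holds: Σ_{π∈FC(S_n)} q^{bl(π)}·F_{Des(π)}(x_1,x_2,…) = Σ_{k=0}^{⌊n/2⌋} (Σ_{j=0}^{n} a_{n,k,j} q^j)·s_{(n−k,k)}(x_1,x_2,…). In particular all coefficients a_{n,k,j} are nonnegative. -/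
open scoped Classical

noncomputable section

namespace Paper

section Operators

open Polynomial

variable {R : Type*} [CommRing R]

theorem mul_divByMonic_sub_C_eval (f : R[X]) :
    (X - C (1 : R)) * ((f - C (f.eval 1)) /ₘ (X - C 1)) = f - C (f.eval 1) := by
  rw [mul_divByMonic_eq_iff_isRoot]
  simp

/-- The operator `f ↦ X (f - f(1)) / (X - 1)`, sending `X ^ s` to `X + X ^ 2 + ⋯ + X ^ s`. -/
def opE [IsDomain R] : R[X] →ₗ[R] R[X] where
  toFun f := X * ((f - C (f.eval 1)) /ₘ (X - C 1))
  map_add' f g := by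
    refine mul_left_cancel₀ (X_sub_C_ne_zero (1 : R)) ?_
    have h := mul_divByMonic_sub_C_eval f
    have h' := mul_divByMonic_sub_C_eval g
    have h'' := mul_divByMonic_sub_C_eval (f + g)
    have e : C (eval 1 (f + g)) = C (eval 1 f) + C (eval 1 g) := by
      rw [eval_add, C_add]
    linear_combination X * h'' - X * h - X * h' - X * e
  map_smul' c f := by
    refine mul_left_cancel₀ (X_sub_C_ne_zero (1 : R)) ?_
    have h := mul_divByMonic_sub_C_eval f
    have h' := mul_divByMonic_sub_C_eval (c • f)
    have e : C (eval 1 (c • f)) = C c * C (eval 1 f) := by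
      rw [smul_eq_C_mul, eval_mul, eval_C, C_mul]
    rw [smul_eq_C_mul] at h' e
    rw [RingHom.id_apply, smul_eq_C_mul, smul_eq_C_mul]
    linear_combination X * h' - C c * X * h - X * e

theorem sub_one_mul_opE [IsDomain R] (f : R[X]) : (X - 1) * opE f = X * (f - C (f.eval 1)) := by
  have h := mul_divByMonic_sub_C_eval f
  change (X - 1) * (X * ((f - C (f.eval 1)) /ₘ (X - C 1))) = _
  rw [C_1] at h ⊢
  rw [mul_left_comm, h]

theorem opE_eq_iff [IsDomain R] {f g : R[X]} :
    opE f = g ↔ (X - 1) * g = X * (f - C (f.eval 1)) := by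
  rw [← sub_one_mul_opE]
  have h : (X - 1 : R[X]) ≠ 0 := by
    rw [← C_1]
    exact X_sub_C_ne_zero 1
  constructor
  · rintro rfl
    rfl
  · intro hg
    exact (mul_left_cancel₀ h hg).symm

theorem opE_X_mul [IsDomain R] (f : R[X]) : opE (X * f) = X * f + opE f := by
  rw [opE_eq_iff, mul_add, sub_one_mul_opE, eval_mul, eval_X, one_mul]
  ring

theorem opE_C [IsDomain R] (c : R) : opE (C c) = 0 := by
  rw [opE_eq_iff]
  simp

theorem opE_one [IsDomain R] : opE (1 : R[X]) = 0 := by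
  rw [← C_1, opE_C]

theorem opE_sub_one_mul [IsDomain R] (f : R[X]) : opE ((X - 1) * f) = X * f := by
  rw [opE_eq_iff]
  simp only [eval_mul, eval_sub, eval_X, eval_one, sub_self, zero_mul, C_0, sub_zero]
  ring

/-- The operator `∑ c ≤ p, X ^ c · opE ^ (p - c)`. -/
def opH [IsDomain R] : ℕ → (R[X] →ₗ[R] R[X])
  | 0 => LinearMap.id
  | p + 1 => LinearMap.mulLeft R X ∘ₗ opH p + opE ^ (p + 1)

theorem opH_zero [IsDomain R] (f : R[X]) : opH 0 f = f := rfl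

theorem opH_succ [IsDomain R] (p : ℕ) (f : R[X]) : opH (p + 1) f = X * opH p f + (opE ^ (p + 1)) f := rfl

theorem opH_one [IsDomain R] (f : R[X]) : opH 1 f = X * f + opE f := by
  rw [opH_succ, opH_zero, zero_add, pow_one]

theorem opH_add_two [IsDomain R] (p : ℕ) (f : R[X]) :
    opH (p + 2) f = opH 1 (opH (p + 1) f - opH p f) := by
  have h : opE (opH (p + 1) f) = opH 1 (opH p f) + (opE ^ (p + 2)) f := by
    rw [opH_succ, map_add, opE_X_mul, opH_one, pow_succ' opE (p + 1)]
    rfl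
  rw [opH_succ (p + 1), map_sub, opH_one (opH (p + 1) f), h]
  ring

/-- The polynomials enumerating two-row standard Young tableaux by last descent, extended to all
`k` by antisymmetry. -/
def ballotPoly : ℕ → ℕ → R[X]
  | 0, 0 => 1
  | 0, k + 1 => -(X - 1) ^ k
  | n + 1, 0 => X ^ (n + 1)
  | n + 1, k + 1 => ballotPoly n k + ballotPoly n (k + 1)

theorem ballotPoly_zero_right (n : ℕ) : ballotPoly n 0 = (X ^ n : R[X]) := by
  cases n <;> simp [ballotPoly]

theorem ballotPoly_succ_succ (n k : ℕ) :
    (ballotPoly (n + 1) (k + 1) : R[X]) = ballotPoly n k + ballotPoly n (k + 1) := by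
  rw [ballotPoly]

theorem opH_one_ballotPoly [IsDomain R] (n k : ℕ) :
    opH 1 (ballotPoly n k : R[X]) = ballotPoly (n + 1) k + ballotPoly (n + 1) (k + 1) := by
  induction n generalizing k with
  | zero =>
    rcases k with _ | _ | k
    · rw [opH_one]
      simp [ballotPoly, opE_one]
    · rw [opH_one]
      simp [ballotPoly, opE_one]
      ring
    · have h : opE (-(X - 1) ^ (k + 1) : R[X]) = - (X * (X - 1) ^ k) := by
        rw [map_neg, pow_succ', opE_sub_one_mul]
      rw [opH_one]
      simp only [ballotPoly]
      rw [h]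
      ring
  | succ n ih =>
    cases k with
    | zero =>
      have h0 := ih 0
      rw [ballotPoly_zero_right, ballotPoly_zero_right, opH_one] at h0
      rw [ballotPoly_succ_succ, ballotPoly_zero_right, ballotPoly_zero_right, opH_one,
        pow_succ' X n, opE_X_mul]
      have h1 : opE (X ^ n : R[X]) = ballotPoly (n + 1) (0 + 1) := by
        rw [← pow_succ'] at h0
        exact add_left_cancel h0
      rw [h1]
      ring
    | succ k =>
      rw [ballotPoly_succ_succ n, map_add, ih, ih, ballotPoly_succ_succ (n + 1),
        ballotPoly_succ_succ (n + 1)]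

theorem opH_ballotPoly [IsDomain R] (p n k : ℕ) :
    opH p (ballotPoly n k : R[X]) =
      ∑ x ∈ Finset.range (p + 1), ballotPoly (n + p) (k + x) := by
  induction p using Nat.twoStepInduction with
  | zero => simp [opH_zero]
  | one =>
    rw [opH_one_ballotPoly]
    simp [Finset.sum_range_succ]
  | more p ih1 ih2 =>
    have e1 : ∀ N K M : ℕ, opH 1 (∑ x ∈ Finset.range M, ballotPoly N (K + x) : R[X]) =
        ∑ x ∈ Finset.range M, ballotPoly (N + 1) (K + x) +
          ∑ x ∈ Finset.range M, ballotPoly (N + 1) (K + x + 1) := by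
      intro N K M
      rw [map_sum, ← Finset.sum_add_distrib]
      exact Finset.sum_congr rfl fun x _ => opH_one_ballotPoly _ _
    have e2 : ∀ N K M : ℕ, (∑ x ∈ Finset.range M, ballotPoly (N + 1) (K + x + 1) : R[X]) =
        ∑ x ∈ Finset.range M, ballotPoly N (K + x) +
          ∑ x ∈ Finset.range M, ballotPoly N (K + x + 1) := by
      intro N K M
      rw [← Finset.sum_add_distrib]
      exact Finset.sum_congr rfl fun x _ => ballotPoly_succ_succ _ _
    have e3 := e2 (n + (p + 1)) k (p + 1)
    rw [opH_add_two, ih1, ih2, map_sub, e1, e1,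
      show n + p + 1 = n + (p + 1) from rfl, ← e3, Finset.sum_range_succ _ (p + 1 + 1),
      Finset.sum_range_succ (fun x => ballotPoly (n + (p + 1) + 1) (k + x + 1)) (p + 1),
      show n + (p + 1) + 1 = n + (p + 2) from rfl, add_assoc k]
    ring

theorem ballotPoly_of_lt (n i : ℕ) :
    (ballotPoly n (n + 1 + i) : R[X]) = -((X - 1) ^ i * X ^ n) := by
  induction n generalizing i with
  | zero =>
    rw [show 0 + 1 + i = i + 1 by omega, ballotPoly]
    simp
  | succ n ih =>
    rw [show n + 1 + 1 + i = (n + 1 + i) + 1 by omega, ballotPoly_succ_succ, ih,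
      show n + 1 + i + 1 = n + 1 + (i + 1) by omega, ih]
    ring

theorem ballotPoly_antisymm (n k l : ℕ) (h : k + l = n + 1) :
    (ballotPoly n k : R[X]) = - ballotPoly n l := by
  induction n generalizing k l with
  | zero =>
    have : k = 0 ∧ l = 1 ∨ k = 1 ∧ l = 0 := by omega
    rcases this with ⟨rfl, rfl⟩ | ⟨rfl, rfl⟩ <;> simp [ballotPoly]
  | succ n ih =>
    rcases k with _ | k
    · have := ballotPoly_of_lt (R := R) (n + 1) 0
      rw [show l = n + 1 + 1 + 0 by omega, this, ballotPoly_zero_right]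
      simp
    · rcases l with _ | l
      · have := ballotPoly_of_lt (R := R) (n + 1) 0
        rw [show k + 1 = n + 1 + 1 + 0 by omega, this, ballotPoly_zero_right]
        simp
      · rw [ballotPoly_succ_succ, ballotPoly_succ_succ, ih k (l + 1) (by omega),
          ih (k + 1) l (by omega)]
        ring

theorem ballotPoly_middle [IsDomain R] [CharZero R] (n k : ℕ) (h : 2 * k = n + 1) :
    (ballotPoly n k : R[X]) = 0 :=
  self_eq_neg.mp (ballotPoly_antisymm n k k (by omega))

theorem sum_ballotPoly_symm [IsDomain R] [CharZero R] (n a b : ℕ) (h : a + b = n + 1) :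
    (∑ i ∈ Finset.Icc a b, ballotPoly n i : R[X]) = 0 := by
  rw [← self_eq_neg, ← Finset.sum_neg_distrib]
  refine Finset.sum_bij' (fun i _ => n + 1 - i) (fun i _ => n + 1 - i) ?_ ?_ ?_ ?_ ?_
  · intro i hi
    rw [Finset.mem_Icc] at hi ⊢
    omega
  · intro i hi
    rw [Finset.mem_Icc] at hi ⊢
    omega
  · intro i hi
    rw [Finset.mem_Icc] at hi
    omega
  · intro i hi
    rw [Finset.mem_Icc] at hi
    omega
  · intro i hi
    rw [Finset.mem_Icc] at hi
    exact ballotPoly_antisymm _ _ _ (by omega)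

/-- Pieri rule for `ballotPoly`: the partitions `(n + p - l, l)` obtained from `(n - k, k)` by
adding a horizontal strip of size `p`. -/
theorem opH_ballotPoly_strip [IsDomain R] [CharZero R] (p n k : ℕ) (hk : 2 * k ≤ n) :
    opH p (ballotPoly n k : R[X]) =
      ∑ l ∈ (Finset.range ((n + p) / 2 + 1)).filter
        (fun l => k ≤ l ∧ l ≤ k + p ∧ k + l ≤ n), ballotPoly (n + p) l := by
  have h1 : (∑ x ∈ Finset.range (p + 1), ballotPoly (n + p) (k + x) : R[X]) =
      ∑ l ∈ Finset.Icc k (k + p), ballotPoly (n + p) l := by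
    rw [← Finset.Ico_add_one_right_eq_Icc, Finset.sum_Ico_eq_sum_range]
    refine Finset.sum_congr (congrArg _ ?_) fun _ _ => rfl
    omega
  rw [opH_ballotPoly, h1, ← Finset.sum_filter_add_sum_filter_not _ (fun l => k + l ≤ n)]
  have h2 : (Finset.Icc k (k + p)).filter (fun l => ¬ k + l ≤ n) =
      Finset.Icc (n + 1 - k) (k + p) := by
    ext l
    simp only [Finset.mem_filter, Finset.mem_Icc]
    omega
  rw [h2, sum_ballotPoly_symm _ _ _ (by omega), add_zero]
  refine Finset.sum_congr ?_ fun _ _ => rfl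
  ext l
  simp only [Finset.mem_filter, Finset.mem_Icc, Finset.mem_range]
  omega

end Operators

section Heights

open Polynomial

variable {R : Type*} [CommRing R]

/-- The weight of an excess `h` of `S` over `P`. -/
def heightPoly (q : R) : ℕ → R[X]
  | 0 => 1
  | h + 1 => (X - C q) * (X - 1) ^ h

theorem X_mul_heightPoly_zero (q : R) :
    X * heightPoly q 0 = q • heightPoly q 0 + heightPoly q 1 := by
  simp only [heightPoly, smul_eq_C_mul]
  ring

theorem X_mul_heightPoly_succ (q : R) (h : ℕ) :
    X * heightPoly q (h + 1) = heightPoly q (h + 1) + heightPoly q (h + 2) := by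
  simp only [heightPoly]
  ring

theorem opE_heightPoly_zero [IsDomain R] (q : R) : opE (heightPoly q 0) = 0 := opE_one

theorem opE_heightPoly_one [IsDomain R] (q : R) :
    opE (heightPoly q 1) = q • heightPoly q 0 + heightPoly q 1 := by
  rw [opE_eq_iff]
  simp only [heightPoly, smul_eq_C_mul, eval_sub, eval_X, eval_C, pow_zero, mul_one,
    C_sub, C_1]
  ring

theorem opE_heightPoly_add_two [IsDomain R] (q : R) (h : ℕ) :
    opE (heightPoly q (h + 2)) = heightPoly q (h + 1) + heightPoly q (h + 2) := by
  have e : heightPoly q (h + 2) = (X - 1) * heightPoly q (h + 1) := by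
    simp only [heightPoly]
    ring
  rw [e, opE_sub_one_mul]
  ring

theorem eval_heightPoly (q : R) (h : ℕ) : (heightPoly q h).eval q = if h = 0 then 1 else 0 := by
  cases h <;> simp [heightPoly]

/-- Every element of `P` up to `n` has its order-isomorphic partner in `S` strictly below it. -/
def Compat (n : ℕ) (P S : Finset ℕ) : Prop :=
  ∀ i ≤ n, Nat.count (· ∈ P) (i + 1) ≤ Nat.count (· ∈ S) i

/-- The number of `i` in `{1, …, n}` for which `P` and `S` have equally many elements up to `i`. -/
def contacts (n : ℕ) (P S : Finset ℕ) : ℕ :=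
  ((Finset.Icc 1 n).filter fun i =>
    Nat.count (· ∈ S) (i + 1) = Nat.count (· ∈ P) (i + 1)).card

/-- The weight of a pair of sets truncated at `n`. -/
def pairWeight (q : R) (n : ℕ) (P S : Finset ℕ) : R[X] :=
  if Compat n P S then
    q ^ contacts n P S •
      heightPoly q (Nat.count (· ∈ S) (n + 1) - Nat.count (· ∈ P) (n + 1))
  else 0

/-- The polynomial obtained by reading `P`: multiply by `X` at letters outside `P`, apply `opE`
at letters in `P`. -/
def pathPoly [IsDomain R] (P : Finset ℕ) : ℕ → R[X]
  | 0 => 1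
  | n + 1 => if n + 1 ∈ P then opE (pathPoly P n) else X * pathPoly P n

theorem count_insert_of_le (S : Finset ℕ) {a k : ℕ} (h : k ≤ a) :
    Nat.count (· ∈ insert a S) k = Nat.count (· ∈ S) k := by
  rw [Nat.count_eq_card_filter_range, Nat.count_eq_card_filter_range]
  congr 1
  refine Finset.filter_congr fun x hx => ?_
  have := Finset.mem_range.mp hx
  rw [Finset.mem_insert]
  exact or_iff_right (by omega)

theorem compat_succ (n : ℕ) (P S : Finset ℕ) :
    Compat (n + 1) P S ↔
      Compat n P S ∧ Nat.count (· ∈ P) (n + 2) ≤ Nat.count (· ∈ S) (n + 1) := by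
  constructor
  · exact fun h => ⟨fun i hi => h i (by omega), h (n + 1) le_rfl⟩
  · rintro ⟨h, h'⟩ i hi
    rcases Nat.lt_or_ge n i with h1 | h1
    · obtain rfl : i = n + 1 := by omega
      exact h'
    · exact h i h1

theorem contacts_succ (n : ℕ) (P S : Finset ℕ) :
    contacts (n + 1) P S = contacts n P S +
      if Nat.count (· ∈ S) (n + 2) = Nat.count (· ∈ P) (n + 2) then 1 else 0 := by
  rw [contacts, ← Finset.insert_Icc_right_eq_Icc_add_one (by omega), Finset.filter_insert]
  split_ifs with h
  · rw [Finset.card_insert_of_notMem (by simp)]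
    rfl
  · rfl

theorem pairWeight_succ [IsDomain R] (q : R) (n : ℕ) (P S : Finset ℕ)
    (hS : S ⊆ Finset.Icc 1 n) :
    pairWeight q (n + 1) P S + pairWeight q (n + 1) P (insert (n + 1) S) =
      if n + 1 ∈ P then opE (pairWeight q n P S) else X * pairWeight q n P S := by
  have hn : n + 1 ∉ S := fun h => by simpa using hS h
  have hc : Compat n P (insert (n + 1) S) ↔ Compat n P S := by
    refine forall₂_congr fun i hi => ?_
    rw [count_insert_of_le _ (by omega)]
  have hk : contacts n P (insert (n + 1) S) = contacts n P S := by
    rw [contacts, contacts]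
    congr 1
    refine Finset.filter_congr fun x hx => ?_
    rw [Finset.mem_Icc] at hx
    rw [count_insert_of_le _ (by omega)]
  have e1 : Nat.count (· ∈ S) (n + 2) = Nat.count (· ∈ S) (n + 1) := by
    rw [Nat.count_succ, if_neg hn, add_zero]
  have e2 : Nat.count (· ∈ insert (n + 1) S) (n + 2) = Nat.count (· ∈ S) (n + 1) + 1 := by
    rw [Nat.count_succ, if_pos (Finset.mem_insert_self _ _), count_insert_of_le _ le_rfl]
  have e3 : Nat.count (· ∈ P) (n + 2) =
      Nat.count (· ∈ P) (n + 1) + if n + 1 ∈ P then 1 else 0 := Nat.count_succ _ _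
  simp only [pairWeight, compat_succ, contacts_succ, hc, hk, e1, e2,
    count_insert_of_le S (le_refl (n + 1))]
  by_cases hcomp : Compat n P S
  swap
  · simp [hcomp]
  have hle : Nat.count (· ∈ P) (n + 1) ≤ Nat.count (· ∈ S) (n + 1) :=
    (hcomp n le_rfl).trans (Nat.count_monotone _ (by omega))
  obtain ⟨h, hh⟩ := Nat.exists_eq_add_of_le hle
  by_cases hP : n + 1 ∈ P
  · rw [if_pos hP] at e3
    simp only [hcomp, true_and, e3, hh, if_pos hP, if_true]
    rcases h with _ | _ | h
    · simp [opE_heightPoly_zero]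
    · simp [opE_heightPoly_one, pow_succ, mul_smul]
    · rw [if_pos (by omega), if_neg (by omega), if_pos (by omega), if_neg (by omega)]
      rw [map_smul, show Nat.count (· ∈ P) (n + 1) + (h + 1 + 1) - Nat.count (· ∈ P) (n + 1) =
        h + 2 by omega, opE_heightPoly_add_two, smul_add, add_zero]
      congr 3 <;> omega
  · rw [if_neg hP, add_zero] at e3
    simp only [hcomp, true_and, e3, hh, if_neg hP, if_true]
    rcases h with _ | h
    · simp [X_mul_heightPoly_zero, pow_succ, mul_smul]
    · rw [if_pos (by omega), if_neg (by omega), if_pos (by omega), if_neg (by omega)]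
      rw [mul_smul_comm, show Nat.count (· ∈ P) (n + 1) + (h + 1) - Nat.count (· ∈ P) (n + 1) =
        h + 1 by omega, X_mul_heightPoly_succ, smul_add, add_zero]
      congr 3; omega

theorem sum_pairWeight [IsDomain R] (q : R) (n : ℕ) (P : Finset ℕ) (hP : 0 ∉ P) :
    ∑ S ∈ (Finset.Icc 1 n).powerset, pairWeight q n P S = pathPoly P n := by
  induction n with
  | zero =>
    have h : Compat 0 P ∅ := by
      intro i hi
      obtain rfl : i = 0 := by omega
      simp [Nat.count_succ, hP]
    simp [pairWeight, h, contacts, pathPoly, heightPoly, Nat.count_succ]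
  | succ n ih =>
    rw [← Finset.insert_Icc_right_eq_Icc_add_one (by omega),
      Finset.sum_powerset_insert (by simp), ← Finset.sum_add_distrib,
      Finset.sum_congr rfl fun S hS => pairWeight_succ q n P S (Finset.mem_powerset.mp hS),
      pathPoly, ← ih]
    split_ifs
    · rw [map_sum]
    · rw [Finset.mul_sum]

/-- `pathPoly` enumerates the sets `S` compatible with `P` of the same size by contacts. -/
theorem sum_contacts [IsDomain R] (q : R) (n : ℕ) (P : Finset ℕ) (hP : 0 ∉ P) :
    ∑ S ∈ (Finset.Icc 1 n).powerset.filter (fun S => Compat n P S ∧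
        Nat.count (· ∈ S) (n + 1) = Nat.count (· ∈ P) (n + 1)), q ^ contacts n P S =
      (pathPoly P n).eval q := by
  rw [← sum_pairWeight q n P hP, eval_finsetSum, Finset.sum_filter]
  refine Finset.sum_congr rfl fun S _ => ?_
  rw [pairWeight]
  by_cases h : Compat n P S
  · have hle : Nat.count (· ∈ P) (n + 1) ≤ Nat.count (· ∈ S) (n + 1) :=
      (h n le_rfl).trans (Nat.count_monotone _ (by omega))
    simp only [h, true_and, if_true, eval_smul, eval_heightPoly, smul_eq_mul, mul_ite, mul_one,
      mul_zero]
    refine if_congr ?_ rfl rfl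
    omega
  · simp [h]

end Heights

section DescentSums

open Polynomial

variable {R : Type*} [CommRing R] [IsDomain R]

/-- The sum of `pathPoly` over the subsets of `{1, …, n}` whose descents all satisfy `D`. -/
def descSum (R : Type*) [CommRing R] [IsDomain R] (D : ℕ → Prop) (n : ℕ) : R[X] :=
  ∑ P ∈ (Finset.Icc 1 n).powerset, if ∀ i ∈ DesSet n P, D i then pathPoly P n else 0

/-- The part of `descSum` coming from the sets containing `n`. -/
def descSumMem (R : Type*) [CommRing R] [IsDomain R] (D : ℕ → Prop) (n : ℕ) : R[X] :=
  ∑ P ∈ (Finset.Icc 1 n).powerset,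
    if (∀ i ∈ DesSet n P, D i) ∧ n ∈ P then pathPoly P n else 0

theorem pathPoly_insert (P : Finset ℕ) {n a : ℕ} (h : n < a) :
    (pathPoly (insert a P) n : R[X]) = pathPoly P n := by
  induction n with
  | zero => rfl
  | succ n ih =>
    rw [pathPoly, pathPoly, ih (by omega)]
    refine if_congr ?_ rfl rfl
    rw [Finset.mem_insert]
    exact or_iff_right (by omega)

theorem forall_mem_DesSet_succ (D : ℕ → Prop) (n : ℕ) (P : Finset ℕ) :
    (∀ i ∈ DesSet (n + 1) P, D i) ↔
      (∀ i ∈ DesSet n P, D i) ∧ (n ≠ 0 → n ∉ P → n + 1 ∈ P → D n) := by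
  simp only [DesSet, Finset.mem_filter, Finset.mem_Ico]
  constructor
  · exact fun h => ⟨fun i hi => h i ⟨by omega, hi.2⟩, fun h1 h2 h3 => h n ⟨by omega, h2, h3⟩⟩
  · rintro ⟨h1, h2⟩ i ⟨hi, hi'⟩
    rcases Nat.lt_or_ge i n with h | h
    · exact h1 i ⟨by omega, hi'⟩
    · obtain rfl : i = n := by omega
      exact h2 (by omega) hi'.1 hi'.2

theorem forall_mem_DesSet_insert (D : ℕ → Prop) {n a : ℕ} (P : Finset ℕ) (h : n < a) :
    (∀ i ∈ DesSet n (insert a P), D i) ↔ ∀ i ∈ DesSet n P, D i := by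
  have : DesSet n (insert a P) = DesSet n P := by
    refine Finset.filter_congr fun i hi => ?_
    rw [Finset.mem_Ico] at hi
    rw [Finset.mem_insert, Finset.mem_insert, or_iff_right (by omega : i ≠ a),
      or_iff_right (by omega : i + 1 ≠ a)]
  rw [this]

theorem descSumMem_succ (D : ℕ → Prop) (n : ℕ) :
    descSumMem R D (n + 1) = if n = 0 ∨ D n then opE (descSum R D n)
      else opE (descSumMem R D n) := by
  have h : descSumMem R D (n + 1) = ∑ P ∈ (Finset.Icc 1 n).powerset,
      if (∀ i ∈ DesSet n P, D i) ∧ (n ≠ 0 → n ∉ P → D n) then opE (pathPoly P n) else 0 := by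
    rw [descSumMem, ← Finset.insert_Icc_right_eq_Icc_add_one (by omega),
      Finset.sum_powerset_insert (by simp), Finset.sum_eq_zero, zero_add]
    · refine Finset.sum_congr rfl fun P hP => ?_
      have hn : n ≠ n + 1 := by omega
      simp only [forall_mem_DesSet_succ, forall_mem_DesSet_insert D P (Nat.lt_add_one n),
        Finset.mem_insert_self, pathPoly, if_true, pathPoly_insert P (Nat.lt_add_one n),
        Finset.mem_insert, hn, false_or, and_true, true_imp_iff]
    · intro P hP
      rw [if_neg]
      rintro ⟨-, h⟩
      simpa using Finset.mem_powerset.mp hP h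
  rw [h, descSum, descSumMem, map_sum, map_sum]
  split_ifs with hD
  · refine Finset.sum_congr rfl fun P _ => ?_
    rw [apply_ite opE, map_zero]
    refine if_congr ?_ rfl rfl
    tauto
  · refine Finset.sum_congr rfl fun P _ => ?_
    rw [apply_ite opE, map_zero]
    refine if_congr ?_ rfl rfl
    tauto

theorem descSum_succ (D : ℕ → Prop) (n : ℕ) :
    descSum R D (n + 1) = X * descSum R D n + descSumMem R D (n + 1) := by
  have h : descSum R D (n + 1) = ∑ P ∈ (Finset.Icc 1 (n + 1)).powerset,
      ((if (∀ i ∈ DesSet (n + 1) P, D i) ∧ n + 1 ∉ P then pathPoly P (n + 1) else 0) +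
        if (∀ i ∈ DesSet (n + 1) P, D i) ∧ n + 1 ∈ P then pathPoly P (n + 1) else 0) := by
    refine Finset.sum_congr rfl fun P _ => ?_
    by_cases hP : n + 1 ∈ P <;> simp [hP]
  rw [h, Finset.sum_add_distrib]
  refine congrArg₂ _ ?_ rfl
  rw [← Finset.insert_Icc_right_eq_Icc_add_one (by omega), Finset.sum_powerset_insert (by simp),
    add_eq_left.mpr, descSum, Finset.mul_sum]
  · refine Finset.sum_congr rfl fun P hP => ?_
    have hn : n + 1 ∉ P := fun h => by simpa using Finset.mem_powerset.mp hP h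
    simp only [forall_mem_DesSet_succ, hn, false_imp_iff, implies_true, and_true,
      not_false_eq_true, pathPoly, if_false, mul_ite, mul_zero]
  · refine Finset.sum_eq_zero fun P _ => ?_
    simp

theorem descSum_add (D : ℕ → Prop) (s p : ℕ) (hs : D s) (hp : ∀ i, 0 < i → i < p → ¬ D (s + i))
    (i : ℕ) (hi : i ≤ p) :
    descSum R D (s + i) = opH i (descSum R D s) ∧
      (0 < i → descSumMem R D (s + i) = (opE ^ i) (descSum R D s)) := by
  induction i with
  | zero => exact ⟨rfl, fun h => absurd h (by omega)⟩
  | succ i ih =>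
    obtain ⟨h1, h2⟩ := ih (by omega)
    have h3 : descSumMem R D (s + (i + 1)) = (opE ^ (i + 1)) (descSum R D s) := by
      rw [← add_assoc, descSumMem_succ]
      rcases Nat.eq_zero_or_pos i with rfl | h0
      · rw [add_zero, if_pos (Or.inr hs)]
        simp
      · have := hp i h0 (by omega)
        rw [if_neg (by rintro (h | h) <;> [omega; exact this h]), h2 h0, pow_succ']
        rfl
    refine ⟨?_, fun _ => h3⟩
    rw [← add_assoc, descSum_succ, h1, add_assoc, h3, opH_succ]

theorem descSum_zero (D : ℕ → Prop) : descSum R D 0 = 1 := by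
  simp [descSum, DesSet, pathPoly]

end DescentSums

section TwoRowSequences

open Polynomial

/-- The sequences `c` with `c u` the number of entries at most `u` in the second row of a
semistandard tableau with two rows, `s u` entries at most `u` in total, maximal entry `v` and
second row of length `k`. -/
def rowSeqs (s : ℕ → ℕ) : ℕ → ℕ → Finset (ℕ → ℕ)
  | 0, k => if k = 0 then {fun _ => 0} else ∅
  | v + 1, l =>
    ((Finset.range (l + 1)).filter fun k => l + s v ≤ k + s (v + 1) ∧ k + l ≤ s v).biUnion
      fun k => (rowSeqs s v k).image fun c u => if u ≤ v then c u else l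

theorem mem_rowSeqs (s : ℕ → ℕ) (v k : ℕ) (c : ℕ → ℕ) :
    c ∈ rowSeqs s v k ↔ c 0 = 0 ∧ (∀ u < v, c u ≤ c (u + 1) ∧
      c (u + 1) + s u ≤ c u + s (u + 1) ∧ c u + c (u + 1) ≤ s u) ∧ ∀ u, v ≤ u → c u = k := by
  induction v generalizing k c with
  | zero =>
    rw [rowSeqs]
    split_ifs with h
    · subst h
      rw [Finset.mem_singleton]
      constructor
      · rintro rfl
        simp
      · rintro ⟨-, -, h⟩
        exact funext fun u => h u (by omega)
    · simp only [Finset.notMem_empty, false_iff]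
      rintro ⟨h1, -, h2⟩
      exact h (h2 0 le_rfl ▸ h1)
  | succ v ih =>
    simp only [rowSeqs, Finset.mem_biUnion, Finset.mem_filter, Finset.mem_range,
      Finset.mem_image, ih]
    constructor
    · rintro ⟨j, ⟨h1, h2, h3⟩, d, ⟨d1, d2, d3⟩, rfl⟩
      refine ⟨by simpa using d1, fun u hu => ?_, fun u hu => if_neg (by omega)⟩
      dsimp only
      rw [if_pos (by omega)]
      split_ifs with h
      · exact d2 u (by omega)
      · obtain rfl : u = v := by omega
        rw [d3 u le_rfl]
        exact ⟨by omega, h2, h3⟩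
    · rintro ⟨c1, c2, c3⟩
      have c4 := c2 v (by omega)
      rw [c3 (v + 1) le_rfl] at c4
      refine ⟨c v, ⟨by omega, c4.2⟩, fun u => if u ≤ v then c u else c v,
        ⟨by simpa using c1, fun u hu => ?_, fun u hu => ?_⟩, funext fun u => ?_⟩
      · dsimp only
        rw [if_pos (by omega), if_pos (by omega)]
        exact c2 u (by omega)
      · dsimp only
        split_ifs with h
        · rw [show u = v by omega]
        · rfl
      · by_cases h : u ≤ v
        · simp [h]
        · rw [if_neg h, c3 u (by omega)]

theorem card_rowSeqs_succ (s : ℕ → ℕ) (v l : ℕ) :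
    (rowSeqs s (v + 1) l).card = ∑ k ∈ (Finset.range (l + 1)).filter
      (fun k => l + s v ≤ k + s (v + 1) ∧ k + l ≤ s v), (rowSeqs s v k).card := by
  rw [rowSeqs, Finset.card_biUnion]
  · refine Finset.sum_congr rfl fun k _ => Finset.card_image_of_injOn ?_
    intro c hc d hd h
    rw [Finset.mem_coe, mem_rowSeqs] at hc hd
    funext u
    by_cases hu : u ≤ v
    · simpa [hu] using congrFun h u
    · rw [hc.2.2 u (by omega), hd.2.2 u (by omega)]
  · intro k _ j _ hkj
    rw [Function.onFun, Finset.disjoint_left]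
    intro c hc hd
    rw [Finset.mem_image] at hc hd
    obtain ⟨c, hc, rfl⟩ := hc
    obtain ⟨d, hd, h⟩ := hd
    rw [mem_rowSeqs] at hc hd
    have := congrFun h v
    simp only [le_refl, if_true] at this
    exact hkj (by rw [← hc.2.2 v le_rfl, ← hd.2.2 v le_rfl, this])

theorem descSum_eq_sum_rowSeqs {R : Type*} [CommRing R] [IsDomain R] [CharZero R] (s : ℕ → ℕ)
    (h0 : s 0 = 0) (hs : Monotone s) (v : ℕ) :
    descSum R (fun j => ∃ u, s u = j) (s v) =
      ∑ k ∈ Finset.range (s v / 2 + 1), (rowSeqs s v k).card • ballotPoly (s v) k := by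
  induction v with
  | zero =>
    rw [h0, descSum_zero]
    simp [rowSeqs, ballotPoly]
  | succ v ih =>
    have hv : s v ≤ s (v + 1) := hs (by omega)
    obtain ⟨p, hp⟩ := Nat.exists_eq_add_of_le hv
    have h1 := (descSum_add (R := R) (fun j => ∃ u, s u = j) (s v) p ⟨v, rfl⟩ (by
      rintro i hi hip ⟨u, hu⟩
      rcases Nat.lt_or_ge v u with h | h
      · have := hs (show v + 1 ≤ u by omega)
        omega
      · have := hs h
        omega) p le_rfl).1
    rw [hp, h1, ih, map_sum]
    have h2 : ∀ k ∈ Finset.range (s v / 2 + 1),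
        opH p ((rowSeqs s v k).card • (ballotPoly (s v) k : R[X])) =
        ∑ l ∈ Finset.range ((s v + p) / 2 + 1), if k ≤ l ∧ l ≤ k + p ∧ k + l ≤ s v then
          (rowSeqs s v k).card • ballotPoly (s v + p) l else 0 := by
      intro k hk
      rw [map_nsmul, opH_ballotPoly_strip _ _ _ (by rw [Finset.mem_range] at hk; omega),
        Finset.smul_sum, Finset.sum_filter]
    rw [Finset.sum_congr rfl h2, Finset.sum_comm]
    refine Finset.sum_congr rfl fun l _ => ?_
    rw [card_rowSeqs_succ, Finset.sum_smul, ← Finset.sum_filter]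
    refine Finset.sum_congr ?_ fun _ _ => rfl
    ext k
    simp only [Finset.mem_filter, Finset.mem_range, hp]
    omega

end TwoRowSequences

section Ranking

/-- The weakly increasing sequence with `c v` terms at most `v`. -/
def unrank (c : ℕ → ℕ) (j : ℕ) : ℕ := sInf {v | j < c v}

theorem unrank_le_iff {c : ℕ → ℕ} (hc : Monotone c) {j V : ℕ} (h : j < c V) (v : ℕ) :
    unrank c j ≤ v ↔ j < c v := by
  constructor
  · intro hv
    have : j < c (unrank c j) := Nat.sInf_mem (s := {v | j < c v}) ⟨V, h⟩
    exact this.trans_le (hc hv)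
  · exact fun hv => Nat.sInf_le hv

/-- The number of terms at most `v` among the first `N` terms of `g`. -/
def rankLE (g : ℕ → ℕ) (N v : ℕ) : ℕ := ((Finset.range N).filter fun j => g j ≤ v).card

theorem rankLE_le (g : ℕ → ℕ) (N v : ℕ) : rankLE g N v ≤ N :=
  (Finset.card_filter_le _ _).trans_eq (Finset.card_range N)

theorem rankLE_mono (g : ℕ → ℕ) (N : ℕ) : Monotone (rankLE g N) := fun _ _ h =>
  Finset.card_le_card fun _ hj => by
    rw [Finset.mem_filter] at hj ⊢
    exact ⟨hj.1, hj.2.trans h⟩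

theorem rankLE_eq (g c : ℕ → ℕ) (N v : ℕ) (hc : c v ≤ N)
    (h : ∀ j < N, (g j ≤ v ↔ j < c v)) : rankLE g N v = c v := by
  have : ((Finset.range N).filter fun j => g j ≤ v) = Finset.range (c v) := by
    ext j
    rw [Finset.mem_filter, Finset.mem_range, Finset.mem_range]
    constructor
    · exact fun hj => (h j hj.1).mp hj.2
    · exact fun hj => ⟨by omega, (h j (by omega)).mpr hj⟩
  rw [rankLE, this, Finset.card_range]

theorem le_iff_lt_rankLE {g : ℕ → ℕ} {N : ℕ} (hg : ∀ i j, i ≤ j → j < N → g i ≤ g j)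
    {j : ℕ} (hj : j < N) (v : ℕ) : g j ≤ v ↔ j < rankLE g N v := by
  constructor
  · intro h
    have : Finset.range (j + 1) ⊆ (Finset.range N).filter fun j => g j ≤ v := by
      intro i hi
      rw [Finset.mem_range] at hi
      rw [Finset.mem_filter, Finset.mem_range]
      exact ⟨by omega, (hg i j (by omega) hj).trans h⟩
    exact (Finset.card_range (j + 1)).symm.trans_le (Finset.card_le_card this)
  · intro h
    by_contra hv
    have : ((Finset.range N).filter fun j => g j ≤ v) ⊆ Finset.range j := by
      intro i hi
      rw [Finset.mem_filter, Finset.mem_range] at hi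
      rw [Finset.mem_range]
      by_contra hij
      have := hg j i (by omega) hi.1
      omega
    have := Finset.card_le_card this
    rw [Finset.card_range] at this
    exact absurd h (not_lt.mpr this)

theorem eq_unrank {g c : ℕ → ℕ} (hc : Monotone c) {j : ℕ} (h : ∀ v, g j ≤ v ↔ j < c v) :
    g j = unrank c j :=
  eq_of_forall_ge_iff fun v => by
    rw [h v, unrank_le_iff hc ((h (g j)).mp le_rfl)]

theorem monotone_of_step {g : ℕ → ℕ} {N : ℕ} (h : ∀ j, j + 1 < N → g j ≤ g (j + 1)) :
    ∀ i j, i ≤ j → j < N → g i ≤ g j := by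
  intro i j hij
  induction j, hij using Nat.le_induction with
  | base => exact fun _ => le_rfl
  | succ j _ ih => exact fun hj => (ih (by omega)).trans (h j hj)

theorem sum_card_filter_eq (g : ℕ → ℕ) (N v : ℕ) :
    ∑ u ∈ Finset.range (v + 1), ((Finset.range N).filter fun j => g j = u).card =
      rankLE g N v := by
  rw [rankLE, Finset.card_eq_sum_card_fiberwise (f := g) (t := Finset.range (v + 1))]
  · refine Finset.sum_congr rfl fun u hu => ?_
    rw [Finset.mem_range] at hu
    rw [Finset.filter_filter]
    congr 1
    refine Finset.filter_congr fun j _ => ?_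
    omega
  · intro j hj
    rw [Finset.mem_coe, Finset.mem_filter] at hj
    rw [Finset.mem_coe, Finset.mem_range]
    omega

/-- Partial sums of a content. -/
def partialSum (μ : ℕ → ℕ) (v : ℕ) : ℕ := ∑ u ∈ Finset.range (v + 1), μ u

theorem partialSum_zero (μ : ℕ → ℕ) : partialSum μ 0 = μ 0 := by simp [partialSum]

theorem partialSum_mono (μ : ℕ → ℕ) : Monotone (partialSum μ) :=
  monotone_nat_of_le_succ fun v => by
    rw [partialSum, partialSum, Finset.sum_range_succ _ (v + 1)]
    omega

theorem partialSum_injective {μ ν : ℕ → ℕ} (h : ∀ v, partialSum μ v = partialSum ν v) (v : ℕ) :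
    μ v = ν v := by
  cases v with
  | zero => rw [← partialSum_zero μ, h, partialSum_zero]
  | succ v =>
    have h1 := h (v + 1)
    have h2 := h v
    simp only [partialSum] at h1 h2
    rw [Finset.sum_range_succ, Finset.sum_range_succ _ (v + 1), h2] at h1
    omega

/-- The content has total size `n` and avoids the value `0`. -/
def ValidContent (n : ℕ) (s : ℕ → ℕ) : Prop := s 0 = 0 ∧ ∃ V, ∀ v, V ≤ v → s v = n

end Ranking

section Fundamental

theorem card_fundamental (n : ℕ) (J : Finset ℕ) (hJ : J ⊆ Finset.Ico 1 n) (μ : ℕ → ℕ) :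
    Nat.card {f : ℕ → ℕ //
      f 0 = 0 ∧ (∀ a, n < a → f a = 0) ∧
      (∀ a, 1 ≤ a → a ≤ n → 1 ≤ f a) ∧
      (∀ a b, 1 ≤ a → a ≤ b → b ≤ n → f a ≤ f b) ∧
      (∀ j ∈ J, f j < f (j + 1)) ∧
      ∀ v : ℕ, μ v = ((Finset.Icc 1 n).filter fun a => f a = v).card} =
    if ValidContent n (partialSum μ) ∧ ∀ j ∈ J, ∃ v, partialSum μ v = j then 1 else 0 := by
  have hshift : ∀ (f : ℕ → ℕ) (v : ℕ), ((Finset.Icc 1 n).filter fun a => f a = v).card =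
      ((Finset.range n).filter fun j => f (j + 1) = v).card := by
    intro f v
    refine Finset.card_bij' (fun a _ => a - 1) (fun a _ => a + 1) ?_ ?_ ?_ ?_
    · intro a ha
      rw [Finset.mem_filter, Finset.mem_Icc] at ha
      rw [Finset.mem_filter, Finset.mem_range, Nat.sub_add_cancel ha.1.1]
      exact ⟨by omega, ha.2⟩
    · intro a ha
      rw [Finset.mem_filter, Finset.mem_range] at ha
      rw [Finset.mem_filter, Finset.mem_Icc]
      exact ⟨by omega, ha.2⟩
    · intro a ha
      rw [Finset.mem_filter, Finset.mem_Icc] at ha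
      exact Nat.sub_add_cancel ha.1.1
    · intro a _
      exact Nat.add_sub_cancel a 1
  have key : ∀ f : ℕ → ℕ, (∀ a b, 1 ≤ a → a ≤ b → b ≤ n → f a ≤ f b) →
      (∀ v : ℕ, μ v = ((Finset.Icc 1 n).filter fun a => f a = v).card) →
      (∀ v, partialSum μ v = rankLE (fun j => f (j + 1)) n v) ∧
      ∀ j < n, ∀ v, f (j + 1) ≤ v ↔ j < partialSum μ v := by
    intro f hf hμ
    have h1 : ∀ v, partialSum μ v = rankLE (fun j => f (j + 1)) n v := by
      intro v
      rw [← sum_card_filter_eq]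
      exact Finset.sum_congr rfl fun u _ => by rw [hμ, hshift]
    refine ⟨h1, fun j hj v => ?_⟩
    rw [h1]
    exact le_iff_lt_rankLE (g := fun j => f (j + 1))
      (fun i j hij hj => hf _ _ (by omega) (by omega) (by omega)) hj v
  have hmono := partialSum_mono μ
  split_ifs with h
  · obtain ⟨⟨h0, V, hV⟩, hj⟩ := h
    have hle : ∀ v, partialSum μ v ≤ n := fun v => by
      rw [← hV (max v V) (le_max_right _ _)]
      exact hmono (le_max_left _ _)
    have hun : ∀ j < n, ∀ v, unrank (partialSum μ) j ≤ v ↔ j < partialSum μ v := fun j hj v =>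
      unrank_le_iff hmono (V := V) (by rwa [hV V le_rfl]) v
    rw [Nat.card_eq_one_iff_unique]
    constructor
    · constructor
      rintro ⟨f, f0, fn, -, fm, -, fc⟩ ⟨g, g0, gn, -, gm, -, gc⟩
      refine Subtype.ext (funext fun a => ?_)
      change f a = g a
      rcases a with _ | a
      · rw [f0, g0]
      · rcases Nat.lt_or_ge a n with ha | ha
        · rw [eq_unrank (g := fun a => f (a + 1)) hmono ((key f fm fc).2 a ha),
            eq_unrank (g := fun a => g (a + 1)) hmono ((key g gm gc).2 a ha)]
        · rw [fn _ (by omega), gn _ (by omega)]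
    · set f : ℕ → ℕ := fun a =>
        if 1 ≤ a ∧ a ≤ n then unrank (partialSum μ) (a - 1) else 0 with hf
      have hfa : ∀ j < n, ∀ v, f (j + 1) ≤ v ↔ j < partialSum μ v := fun j hj v => by
        rw [hf]
        dsimp only
        rw [if_pos ⟨by omega, by omega⟩]
        exact hun j hj v
      have hfa' : ∀ a, 1 ≤ a → a ≤ n → ∀ v, f a ≤ v ↔ a - 1 < partialSum μ v :=
        fun a h1 h2 v => by
          have := hfa (a - 1) (by omega) v
          rwa [Nat.sub_add_cancel h1] at this
      refine ⟨f, if_neg (by omega), fun a ha => if_neg (by omega), fun a h1 h2 => ?_,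
        fun a b h1 h2 h3 => ?_, fun j hjJ => ?_, ?_⟩
      · by_contra h
        have := (hfa' a h1 h2 0).mp (by omega)
        omega
      · rw [hfa' a h1 (by omega)]
        have := (hfa' b (by omega) h3 (f b)).mp le_rfl
        omega
      · obtain ⟨v, hv⟩ := hj j hjJ
        have hj' := Finset.mem_Ico.mp (hJ hjJ)
        have h1 := (hfa' j hj'.1 (by omega) v).mpr (by omega)
        have h2 := (hfa' (j + 1) (by omega) (by omega) v).not.mpr (by omega)
        omega
      · refine partialSum_injective fun v => ?_
        have : partialSum (fun v => ((Finset.Icc 1 n).filter fun a => f a = v).card) v =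
            rankLE (fun j => f (j + 1)) n v := by
          rw [← sum_card_filter_eq]
          exact Finset.sum_congr rfl fun u _ => hshift f u
        rw [this, rankLE_eq _ (partialSum μ) n v (hle v) fun j hj => hfa j hj v]
  · rw [Nat.card_eq_zero]
    left
    constructor
    rintro ⟨f, f0, fn, f1, fm, fJ, fc⟩
    obtain ⟨k1, k2⟩ := key f fm fc
    refine h ⟨⟨?_, f n, fun v hv => ?_⟩, fun j hj => ⟨f j, ?_⟩⟩
    · by_contra h0
      have h2 : 0 < n := by
        have := rankLE_le (fun j => f (j + 1)) n 0
        rw [← k1] at this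
        omega
      have := (k2 0 h2 0).mpr (by omega)
      have := f1 1 le_rfl h2
      rw [zero_add] at *
      omega
    · refine le_antisymm ?_ ?_
      · rw [k1]
        exact rankLE_le _ _ _
      · rcases Nat.eq_zero_or_pos n with rfl | hn
        · exact Nat.zero_le _
        · have := (k2 (n - 1) (by omega) v).mp (by rwa [Nat.sub_add_cancel hn])
          omega
    · have hj' := Finset.mem_Ico.mp (hJ hj)
      have h1 := (k2 (j - 1) (by omega) (f j)).mp (by rw [Nat.sub_add_cancel hj'.1])
      have h2 := (k2 j (by omega) (f j)).not.mp (by have := fJ j hj; omega)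
      omega

end Fundamental

section Tableaux

theorem card_twoRow_cells (a b : ℕ) (T : ℕ → ℕ → ℕ) (v : ℕ) :
    Nat.card {p : ℕ × ℕ // p.2 < twoRow a b p.1 ∧ T p.1 p.2 = v} =
      ((Finset.range a).filter fun j => T 0 j = v).card +
        ((Finset.range b).filter fun j => T 1 j = v).card := by
  have hinj : ∀ i : ℕ, Function.Injective fun j : ℕ => (i, j) := fun i j k h =>
    (Prod.mk.inj h).2
  rw [Nat.subtype_card (((Finset.range a).filter fun j => T 0 j = v).image (fun j => (0, j)) ∪
    ((Finset.range b).filter fun j => T 1 j = v).image (fun j => (1, j))),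
    Finset.card_union_of_disjoint, Finset.card_image_of_injective _ (hinj 0),
    Finset.card_image_of_injective _ (hinj 1)]
  · rw [Finset.disjoint_left]
    intro p hp hp'
    rw [Finset.mem_image] at hp hp'
    obtain ⟨_, _, rfl⟩ := hp
    obtain ⟨_, _, h⟩ := hp'
    simp at h
  · rintro ⟨i, j⟩
    simp only [Finset.mem_union, Finset.mem_image, Finset.mem_filter, Finset.mem_range,
      Prod.mk.injEq, twoRow]
    rcases i with _ | _ | i
    · simp
    · simp
    · simp

theorem partialSum_twoRow {a b : ℕ} {μ : ℕ → ℕ} {T : ℕ → ℕ → ℕ}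
    (h : ∀ v, μ v = Nat.card {p : ℕ × ℕ // p.2 < twoRow a b p.1 ∧ T p.1 p.2 = v}) (v : ℕ) :
    partialSum μ v = rankLE (T 0) a v + rankLE (T 1) b v := by
  rw [← sum_card_filter_eq, ← sum_card_filter_eq, ← Finset.sum_add_distrib]
  exact Finset.sum_congr rfl fun u _ => by rw [h, card_twoRow_cells]

/-- The two-row tableau with `c v` entries at most `v` in the second row and `s v` in total. -/
def tableauOf (a b : ℕ) (s c : ℕ → ℕ) : ℕ → ℕ → ℕ := fun i j =>
  if i = 0 ∧ j < a then unrank (fun v => s v - c v) j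
  else if i = 1 ∧ j < b then unrank c j else 0

theorem schurCoeff_of_not_valid {n k : ℕ} (hk : k ≤ n) (μ : ℕ → ℕ)
    (h : ¬ ValidContent n (partialSum μ)) : schurCoeff 1 (twoRow (n - k) k) μ = 0 := by
  rw [schurCoeff, Nat.card_eq_zero]
  left
  constructor
  rintro ⟨T, hr, -, h1, -, hμ⟩
  have hs := partialSum_twoRow hμ
  refine h ⟨?_, (Finset.range (n - k)).sup (T 0) + (Finset.range k).sup (T 1), fun v hv => ?_⟩
  · rw [hs, rankLE_eq (T 0) (fun _ => 0) _ _ (by omega) fun j hj => ?_,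
      rankLE_eq (T 1) (fun _ => 0) _ _ (by omega) fun j hj => ?_]
    · have := h1 1 j (by simpa [twoRow] using hj)
      omega
    · have := h1 0 j (by simpa [twoRow] using hj)
      omega
  · rw [hs, rankLE_eq (T 0) (fun _ => n - k) _ _ le_rfl fun j hj => ?_,
      rankLE_eq (T 1) (fun _ => k) _ _ le_rfl fun j hj => ?_]
    · omega
    · have := Finset.le_sup (f := T 1) (Finset.mem_range.mpr hj)
      omega
    · have := Finset.le_sup (f := T 0) (Finset.mem_range.mpr hj)
      omega

theorem schurCoeff_twoRow {n k V : ℕ} (hk : 2 * k ≤ n) (μ : ℕ → ℕ)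
    (h0 : partialSum μ 0 = 0) (hV : ∀ v, V ≤ v → partialSum μ v = n) :
    schurCoeff 1 (twoRow (n - k) k) μ = (rowSeqs (partialSum μ) V k).card := by
  set s := partialSum μ with hs
  have smono : Monotone s := partialSum_mono μ
  have facts : ∀ c ∈ rowSeqs s V k, Monotone c ∧ Monotone (fun v => s v - c v) ∧
      (∀ v, c v ≤ s v) ∧ c 0 = 0 ∧ (∀ v, c (v + 1) ≤ s v - c v) ∧ c V = k := by
    intro c hc
    rw [mem_rowSeqs] at hc
    obtain ⟨c0, c1, c2⟩ := hc
    have c3 : ∀ u, c u ≤ c (u + 1) ∧ c (u + 1) + s u ≤ c u + s (u + 1) ∧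
        c u + c (u + 1) ≤ s u := by
      intro u
      rcases Nat.lt_or_ge u V with h | h
      · exact c1 u h
      · rw [c2 u h, c2 (u + 1) (by omega), hV u h, hV (u + 1) (by omega)]
        omega
    refine ⟨monotone_nat_of_le_succ fun u => (c3 u).1, monotone_nat_of_le_succ fun u => ?_,
      fun u => ?_, c0, fun u => ?_, c2 V le_rfl⟩
    all_goals
      have := c3 u
      omega
  have un0 : ∀ c ∈ rowSeqs s V k, ∀ j < n - k, ∀ v,
      tableauOf (n - k) k s c 0 j ≤ v ↔ j < s v - c v := by
    intro c hc j hj v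
    obtain ⟨-, hd, -, -, -, h5⟩ := facts c hc
    rw [tableauOf, if_pos ⟨rfl, hj⟩]
    exact unrank_le_iff hd (V := V) (by simpa only [hV V le_rfl, h5] using hj) v
  have un1 : ∀ c ∈ rowSeqs s V k, ∀ j < k, ∀ v,
      tableauOf (n - k) k s c 1 j ≤ v ↔ j < c v := by
    intro c hc j hj v
    obtain ⟨hd, -, -, -, -, h5⟩ := facts c hc
    rw [tableauOf, if_neg (by omega), if_pos ⟨rfl, hj⟩]
    exact unrank_le_iff hd (V := V) (by rwa [h5]) v
  have bd : ∀ c ∈ rowSeqs s V k, ∀ v, c v ≤ k ∧ s v - c v ≤ n - k := by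
    intro c hc v
    obtain ⟨h1, h2, -, -, -, h5⟩ := facts c hc
    have e1 := h1 (le_max_left v V)
    have e2 := h2 (le_max_left v V)
    have e3 : c (max v V) = k := by
      rw [mem_rowSeqs] at hc
      exact hc.2.2 _ (le_max_right _ _)
    dsimp only at e2
    rw [hV _ (le_max_right v V), e3] at e2
    exact ⟨by omega, e2⟩
  rw [schurCoeff, Nat.subtype_card ((rowSeqs s V k).image (tableauOf (n - k) k s)),
    Finset.card_image_of_injOn]
  · intro c hc d hd hcd
    funext v
    rw [← rankLE_eq (tableauOf (n - k) k s c 1) c k v (bd c hc v).1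
      fun j hj => un1 c hc j hj v, hcd,
      rankLE_eq (tableauOf (n - k) k s d 1) d k v (bd d hd v).1 fun j hj => un1 d hd j hj v]
  · intro T
    rw [Finset.mem_image]
    constructor
    · rintro ⟨c, hc, rfl⟩
      obtain ⟨hm, hm', hle, hc0, hstrict, hcV⟩ := facts c hc
      refine ⟨?_, ?_, ?_, ?_, fun v => ?_⟩
      · intro i j hij
        rcases i with _ | _ | i
        · have hj : j + 1 < n - k := by simpa [twoRow] using hij
          rw [un0 c hc j (by omega)]
          have := (un0 c hc (j + 1) hj _).mp le_rfl
          omega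
        · have hj : j + 1 < k := by simpa [twoRow] using hij
          rw [zero_add, un1 c hc j (by omega)]
          have := (un1 c hc (j + 1) hj _).mp le_rfl
          omega
        · simp [twoRow] at hij
      · intro i j hij
        rcases i with _ | i
        · have hj : j < k := by simpa [twoRow] using hij
          rw [zero_add]
          have h1 := (un1 c hc j hj _).mp le_rfl
          rcases h : tableauOf (n - k) k s c 1 j with _ | u
          · rw [h] at h1
            omega
          · rw [h] at h1
            have := hstrict u
            exact Nat.lt_succ_of_le ((un0 c hc j (by omega) u).mpr (by omega))
        · simp [twoRow] at hij
      · intro i j hij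
        rcases i with _ | _ | i
        · have hj : j < n - k := by simpa [twoRow] using hij
          by_contra h
          have := (un0 c hc j hj 0).mp (by omega)
          omega
        · have hj : j < k := by simpa [twoRow] using hij
          by_contra h
          have := (un1 c hc j hj 0).mp (by rw [zero_add] at h; omega)
          omega
        · simp [twoRow] at hij
      · intro i j hij
        rw [tableauOf]
        rcases i with _ | _ | i
        · have hj : ¬ j < n - k := by simpa [twoRow] using hij
          simp [hj]
        · have hj : ¬ j < k := by simpa [twoRow] using hij
          simp [hj]
        · simp
      · refine partialSum_injective (ν := fun v => Nat.card {p : ℕ × ℕ //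
          p.2 < twoRow (n - k) k p.1 ∧ tableauOf (n - k) k s c p.1 p.2 = v}) (fun v => ?_) v
        rw [partialSum_twoRow (T := tableauOf (n - k) k s c) (fun _ => rfl),
          rankLE_eq _ (fun v => s v - c v) _ v (bd c hc v).2 fun j hj => un0 c hc j hj v,
          rankLE_eq _ c _ v (bd c hc v).1 fun j hj => un1 c hc j hj v]
        have := hle v
        rw [← hs]
        omega
    · rintro ⟨hr, hcol, h1, hz, hμ⟩
      have hsum := partialSum_twoRow hμ
      rw [← hs] at hsum
      have r0 : ∀ j < n - k, ∀ v, T 0 j ≤ v ↔ j < rankLE (T 0) (n - k) v := fun j hj v =>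
        le_iff_lt_rankLE (monotone_of_step fun j hj => hr 0 j (by simpa [twoRow] using hj)) hj v
      have r1 : ∀ j < k, ∀ v, T 1 j ≤ v ↔ j < rankLE (T 1) k v := fun j hj v =>
        le_iff_lt_rankLE (monotone_of_step fun j hj => hr 1 j (by simpa [twoRow] using hj)) hj v
      have hdiff : (fun v => s v - rankLE (T 1) k v) = rankLE (T 0) (n - k) := by
        funext v
        rw [hsum]
        omega
      refine ⟨rankLE (T 1) k, ?_, ?_⟩
      · rw [mem_rowSeqs]
        refine ⟨by have := hsum 0; omega, fun u _ => ⟨rankLE_mono _ _ (by omega), ?_, ?_⟩,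
          fun u hu => ?_⟩
        · rw [hsum, hsum]
          have := rankLE_mono (T 0) (n - k) (Nat.le_succ u)
          rw [Nat.succ_eq_add_one] at this
          omega
        · rw [hsum]
          by_contra hlt
          have e1 := rankLE_le (T 1) k (u + 1)
          set j := rankLE (T 0) (n - k) u with hj
          have e2 := (r1 j (by omega) (u + 1)).mpr (by omega)
          have e3 := hcol 0 j (by simp only [twoRow]; simp; omega)
          have e4 := (r0 j (by omega) u).mp (by rw [zero_add] at e3; omega)
          omega
        · have e1 := rankLE_le (T 1) k u
          have e2 := rankLE_le (T 0) (n - k) u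
          have e3 := hsum u
          rw [hV u hu] at e3
          omega
      · funext i j
        rw [tableauOf, hdiff]
        rcases i with _ | _ | i
        · by_cases hj : j < n - k
          · rw [if_pos ⟨rfl, hj⟩]
            exact (eq_unrank (rankLE_mono _ _) (r0 j hj)).symm
          · rw [if_neg (by omega), if_neg (by omega), hz 0 j (by simpa [twoRow] using hj)]
        · by_cases hj : j < k
          · rw [if_neg (by omega), if_pos ⟨rfl, hj⟩]
            exact (eq_unrank (rankLE_mono _ _) (r1 j hj)).symm
          · rw [if_neg (by omega), if_neg (by omega), hz (0 + 1) j (by simpa [twoRow] using hj)]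
        · rw [if_neg (by omega), if_neg (by omega), hz _ j (by simp [twoRow])]

end Tableaux

section LastDescent

open Polynomial

/-- The second-row entries `S` of a standard Young tableau with two rows. -/
def IsBallot (n : ℕ) (S : Finset ℕ) : Prop :=
  ∀ i ∈ Finset.Icc 1 n, 2 * (S.filter (· ≤ i)).card ≤ i

/-- The enumerator of the ballot `k`-subsets of `{1, …, n}` by last descent. -/
def ballotSum (R : Type*) [CommRing R] (n k : ℕ) : R[X] :=
  ∑ S ∈ (Finset.Icc 1 n).powerset,
    if S.card = k ∧ IsBallot n S then X ^ (n - ldesSet n S) else 0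

theorem ldesSet_le (n : ℕ) (S : Finset ℕ) : ldesSet n S ≤ n := by
  refine Finset.sup_le fun i hi => ?_
  rw [DesSet, Finset.mem_filter, Finset.mem_Ico] at hi
  exact hi.1.2.le

theorem IsBallot.two_mul_card_le {n : ℕ} {S : Finset ℕ} (h : IsBallot n S)
    (hS : S ⊆ Finset.Icc 1 n) : 2 * S.card ≤ n := by
  rcases Nat.eq_zero_or_pos n with rfl | hn
  · have : S = ∅ := by simpa using hS
    simp [this]
  · have h1 := h n (Finset.mem_Icc.mpr ⟨hn, le_rfl⟩)
    rwa [Finset.filter_true_of_mem fun x hx => (Finset.mem_Icc.mp (hS hx)).2] at h1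

theorem isBallot_succ {n : ℕ} {S : Finset ℕ} (hS : S ⊆ Finset.Icc 1 n) :
    IsBallot (n + 1) S ↔ IsBallot n S := by
  constructor
  · intro h i hi
    rw [Finset.mem_Icc] at hi
    exact h i (Finset.mem_Icc.mpr ⟨hi.1, by omega⟩)
  · intro h i hi
    rw [Finset.mem_Icc] at hi
    rcases Nat.lt_or_ge n i with h1 | h1
    · have := h.two_mul_card_le hS
      have := Finset.card_filter_le S (· ≤ i)
      omega
    · exact h i (Finset.mem_Icc.mpr ⟨hi.1, h1⟩)

theorem isBallot_insert {n : ℕ} {S : Finset ℕ} (hS : S ⊆ Finset.Icc 1 n) :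
    IsBallot (n + 1) (insert (n + 1) S) ↔ IsBallot n S ∧ 2 * S.card + 1 ≤ n := by
  have hn : n + 1 ∉ S := fun h => by simpa using hS h
  have h1 : (insert (n + 1) S).filter (· ≤ n + 1) = insert (n + 1) S := by
    refine Finset.filter_true_of_mem fun x hx => ?_
    rcases Finset.mem_insert.mp hx with rfl | hx
    · exact le_rfl
    · have := (Finset.mem_Icc.mp (hS hx)).2
      omega
  have h2 : ∀ i ≤ n, (insert (n + 1) S).filter (· ≤ i) = S.filter (· ≤ i) := fun i hi => by
    rw [Finset.filter_insert, if_neg (by omega)]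
  constructor
  · intro h
    refine ⟨fun i hi => ?_, ?_⟩
    · rw [Finset.mem_Icc] at hi
      rw [← h2 i hi.2]
      exact h i (Finset.mem_Icc.mpr ⟨hi.1, by omega⟩)
    · have := h (n + 1) (Finset.mem_Icc.mpr ⟨by omega, le_rfl⟩)
      rw [h1, Finset.card_insert_of_notMem hn] at this
      omega
  · rintro ⟨h, hc⟩ i hi
    rw [Finset.mem_Icc] at hi
    rcases Nat.lt_or_ge n i with h3 | h3
    · obtain rfl : i = n + 1 := by omega
      rw [h1, Finset.card_insert_of_notMem hn]
      omega
    · rw [h2 i h3]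
      exact h i (Finset.mem_Icc.mpr ⟨hi.1, h3⟩)

theorem ldesSet_succ {n : ℕ} {S : Finset ℕ} (h : n + 1 ∉ S) :
    ldesSet (n + 1) S = ldesSet n S := by
  have : DesSet (n + 1) S = DesSet n S := by
    ext i
    simp only [DesSet, Finset.mem_filter, Finset.mem_Ico]
    constructor
    · rintro ⟨h1, h2, h3⟩
      have : i ≠ n := by
        rintro rfl
        exact h h3
      exact ⟨by omega, h2, h3⟩
    · rintro ⟨h1, h2⟩
      exact ⟨by omega, h2⟩
  rw [ldesSet, this, ldesSet]

theorem ldesSet_insert {n : ℕ} (hn : 0 < n) (S : Finset ℕ) :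
    ldesSet (n + 1) (insert (n + 1) S) = if n ∈ S then ldesSet n S else n := by
  split_ifs with h
  · have : DesSet (n + 1) (insert (n + 1) S) = DesSet n S := by
      ext i
      simp only [DesSet, Finset.mem_filter, Finset.mem_Ico, Finset.mem_insert, not_or]
      constructor
      · rintro ⟨h1, h2, h3⟩
        have : i ≠ n := by
          rintro rfl
          exact h2.2 h
        exact ⟨by omega, h2.2, h3.resolve_left (by omega)⟩
      · rintro ⟨h1, h2, h3⟩
        exact ⟨by omega, ⟨by omega, h2⟩, Or.inr h3⟩
    rw [ldesSet, this, ldesSet]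
  · refine le_antisymm (Finset.sup_le fun i hi => ?_) ?_
    · rw [DesSet, Finset.mem_filter, Finset.mem_Ico] at hi
      exact Nat.le_of_lt_succ hi.1.2
    · refine Finset.le_sup (f := id) ?_
      simp only [DesSet, Finset.mem_filter, Finset.mem_Ico, Finset.mem_insert, not_or]
      exact ⟨by omega, ⟨by omega, h⟩, Or.inl trivial⟩

variable {R : Type*} [CommRing R]

theorem sum_powerset_Icc_succ {M : Type*} [AddCommMonoid M] (n : ℕ) (f : Finset ℕ → M) :
    ∑ S ∈ (Finset.Icc 1 (n + 1)).powerset, f S = ∑ S ∈ (Finset.Icc 1 n).powerset, f S +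
      ∑ S ∈ (Finset.Icc 1 n).powerset, f (insert (n + 1) S) := by
  rw [← Finset.insert_Icc_right_eq_Icc_add_one (by omega), Finset.sum_powerset_insert (by simp)]

theorem notMem_of_mem_powerset_Icc {n : ℕ} {S : Finset ℕ} (hS : S ∈ (Finset.Icc 1 n).powerset) :
    n + 1 ∉ S := fun h => by
  simpa using Finset.mem_powerset.mp hS h

theorem sum_ballot_notMem (n k : ℕ) :
    (∑ S ∈ (Finset.Icc 1 n).powerset,
      if S.card = k ∧ IsBallot (n + 1) S then X ^ (n + 1 - ldesSet (n + 1) S) else 0 : R[X]) =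
      X * ballotSum R n k := by
  rw [ballotSum, Finset.mul_sum]
  refine Finset.sum_congr rfl fun S hS => ?_
  rw [isBallot_succ (Finset.mem_powerset.mp hS), ldesSet_succ (notMem_of_mem_powerset_Icc hS),
    mul_ite, mul_zero, ← pow_succ', Nat.sub_add_comm (ldesSet_le n S)]

theorem ballotSum_zero_right (n : ℕ) : ballotSum R n 0 = X ^ n := by
  induction n with
  | zero => simp [ballotSum, IsBallot]
  | succ n ih =>
    rw [ballotSum, sum_powerset_Icc_succ, sum_ballot_notMem, ih, ← pow_succ', add_eq_left]
    refine Finset.sum_eq_zero fun S hS => ?_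
    rw [Finset.card_insert_of_notMem (notMem_of_mem_powerset_Icc hS), if_neg (by omega)]

theorem ballotSum_of_lt {n k : ℕ} (h : n < 2 * k) : ballotSum R n k = 0 := by
  refine Finset.sum_eq_zero fun S hS => if_neg ?_
  rintro ⟨rfl, hb⟩
  have := hb.two_mul_card_le (Finset.mem_powerset.mp hS)
  omega

theorem ballotSum_succ_succ {m k : ℕ} (hk : 2 * k ≤ m) :
    ballotSum R (m + 2) (k + 1) = X * ballotSum R (m + 1) (k + 1) +
      (X * (ballotSum R (m + 1) k - X * ballotSum R m k) + X * C ((ballotSum R m k).eval 1)) := by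
  have h1 : (∑ S ∈ (Finset.Icc 1 (m + 1)).powerset,
      if (insert (m + 2) S).card = k + 1 ∧ IsBallot (m + 2) (insert (m + 2) S) then
        X ^ (m + 2 - ldesSet (m + 2) (insert (m + 2) S)) else 0 : R[X]) =
      ∑ S ∈ (Finset.Icc 1 (m + 1)).powerset, if S.card = k ∧ IsBallot (m + 1) S then
        if m + 1 ∈ S then X * X ^ (m + 1 - ldesSet (m + 1) S) else X else 0 := by
    refine Finset.sum_congr rfl fun S hS => ?_
    rw [Finset.card_insert_of_notMem (notMem_of_mem_powerset_Icc hS),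
      isBallot_insert (Finset.mem_powerset.mp hS), ldesSet_insert (by omega)]
    have hiff : S.card + 1 = k + 1 ∧ IsBallot (m + 1) S ∧ 2 * S.card + 1 ≤ m + 1 ↔
        S.card = k ∧ IsBallot (m + 1) S := by
      constructor
      · rintro ⟨h1, h2, -⟩
        exact ⟨by omega, h2⟩
      · rintro ⟨h1, h2⟩
        exact ⟨by omega, h2, by omega⟩
    by_cases hS : S.card = k ∧ IsBallot (m + 1) S
    · rw [if_pos (hiff.mpr hS), if_pos hS]
      split_ifs
      · rw [← pow_succ', ← Nat.sub_add_comm (ldesSet_le _ S)]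
      · rw [show m + 2 - (m + 1) = 1 by omega, pow_one]
    · rw [if_neg (mt hiff.mp hS), if_neg hS]
  have h2 := sum_ballot_notMem (R := R) m k
  have h3 : ballotSum R (m + 1) k = X * ballotSum R m k +
      ∑ S ∈ (Finset.Icc 1 m).powerset,
        if (insert (m + 1) S).card = k ∧ IsBallot (m + 1) (insert (m + 1) S) then
          X ^ (m + 1 - ldesSet (m + 1) (insert (m + 1) S)) else 0 := by
    rw [ballotSum, sum_powerset_Icc_succ, h2]
  have h4 : (∑ S ∈ (Finset.Icc 1 m).powerset, if S.card = k ∧ IsBallot (m + 1) S then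
      if m + 1 ∈ S then X * X ^ (m + 1 - ldesSet (m + 1) S) else X else 0 : R[X]) =
      X * C ((ballotSum R m k).eval 1) := by
    rw [ballotSum, eval_finsetSum, map_sum, Finset.mul_sum]
    refine Finset.sum_congr rfl fun S hS => ?_
    rw [if_neg (notMem_of_mem_powerset_Icc hS), isBallot_succ (Finset.mem_powerset.mp hS)]
    split_ifs <;> simp
  have h5 : (∑ S ∈ (Finset.Icc 1 m).powerset,
      if (insert (m + 1) S).card = k ∧ IsBallot (m + 1) (insert (m + 1) S) then
        if m + 1 ∈ insert (m + 1) S then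
          X * X ^ (m + 1 - ldesSet (m + 1) (insert (m + 1) S)) else X else 0 : R[X]) =
      X * (ballotSum R (m + 1) k - X * ballotSum R m k) := by
    rw [h3, add_sub_cancel_left, Finset.mul_sum]
    refine Finset.sum_congr rfl fun S hS => ?_
    rw [if_pos (Finset.mem_insert_self _ _), mul_ite, mul_zero]
  rw [ballotSum, sum_powerset_Icc_succ, sum_ballot_notMem, h1, sum_powerset_Icc_succ, h4, h5]
  ring

theorem ballotSum_eq [IsDomain R] [CharZero R] (n k : ℕ) (hk : 2 * k ≤ n) :
    ballotSum R n k = ballotPoly n k := by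
  induction n using Nat.strong_induction_on generalizing k with
  | h n ih =>
    rcases k with _ | k
    · rw [ballotSum_zero_right, ballotPoly_zero_right]
    · obtain ⟨m, rfl⟩ := Nat.exists_eq_add_of_le (show 2 ≤ n by omega)
      rw [add_comm 2 m] at *
      have h1 : ballotSum R (m + 1) (k + 1) = ballotPoly (m + 1) (k + 1) := by
        rcases Nat.lt_or_ge (m + 1) (2 * (k + 1)) with h | h
        · rw [ballotSum_of_lt h, ballotPoly_middle _ _ (by omega)]
        · exact ih _ (by omega) _ h
      have h2 := opH_one_ballotPoly (R := R) m k
      have h3 := sub_one_mul_opE (ballotPoly m k : R[X])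
      rw [opH_one] at h2
      rw [ballotSum_succ_succ (by omega), h1, ih (m + 1) (by omega) k (by omega),
        ih m (by omega) k (by omega), ballotPoly_succ_succ (m + 1) k]
      linear_combination (X - 1) * (- h2) + h3

theorem sum_aCoeff (n k : ℕ) (hk : 2 * k ≤ n) :
    ∑ j ∈ Finset.range (n + 1), (aCoeff n k j : ℤ[X]) * X ^ j =
      (ballotPoly n k : ℤ[X][X]).eval X := by
  rw [← ballotSum_eq n k hk, ballotSum, eval_finsetSum]
  have h : ∀ j ∈ Finset.range (n + 1), (aCoeff n k j : ℤ[X]) * X ^ j =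
      ∑ S ∈ (Finset.Icc 1 n).powerset,
        if (S.card = k ∧ IsBallot n S) ∧ n - ldesSet n S = j then X ^ j else 0 := by
    intro j hj
    rw [Finset.mem_range] at hj
    rw [← Finset.sum_filter, Finset.sum_const, nsmul_eq_mul, aCoeff]
    congr 3
    refine Finset.filter_congr fun S _ => ?_
    have := ldesSet_le n S
    rw [and_assoc]
    refine and_congr_right fun _ => and_congr_right fun _ => ?_
    omega
  rw [Finset.sum_congr rfl h, Finset.sum_comm]
  refine Finset.sum_congr rfl fun S _ => ?_
  by_cases hS : S.card = k ∧ IsBallot n S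
  · simp only [hS, true_and, and_self, if_true]
    rw [Finset.sum_ite_eq, if_pos (by rw [Finset.mem_range]; omega)]
    simp
  · simp [hS]

end LastDescent

section Windows

/-- `p` is injective and fixes every number outside `{1, …, n}`. -/
structure IsWindow (n : ℕ) (p : ℕ → ℕ) : Prop where
  inj : Function.Injective p
  zero : p 0 = 0
  fix : ∀ i, n < i → p i = i

/-- Every inversion of `p` goes from a weak excedance to a deficiency. -/
def InversionsSplit (p : ℕ → ℕ) : Prop :=
  ∀ i j, i < j → p j < p i → i ≤ p i ∧ p j < j

/-- The positions of the deficiencies of `p`. -/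
def deficiencies (n : ℕ) (p : ℕ → ℕ) : Finset ℕ := (Finset.Icc 1 n).filter fun i => p i < i

variable {n : ℕ} {p : ℕ → ℕ}

namespace IsWindow

theorem le_of_le (h : IsWindow n p) {i : ℕ} (hi : i ≤ n) : p i ≤ n := by
  by_contra hlt
  have := h.inj (h.fix (p i) (by omega))
  omega

theorem surj (h : IsWindow n p) (v : ℕ) : ∃ i, p i = v := by
  rcases Nat.lt_or_ge n v with hv | hv
  · exact ⟨v, h.fix v hv⟩
  · have h1 : (Finset.range (n + 1)).image p = Finset.range (n + 1) := by
      refine Finset.eq_of_subset_of_card_le (fun x hx => ?_) ?_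
      · obtain ⟨i, hi, rfl⟩ := Finset.mem_image.mp hx
        rw [Finset.mem_range] at hi ⊢
        have := h.le_of_le (show i ≤ n by omega)
        omega
      · rw [Finset.card_image_of_injective _ h.inj]
    have h2 : v ∈ (Finset.range (n + 1)).image p := by
      rw [h1, Finset.mem_range]
      omega
    obtain ⟨i, -, hi⟩ := Finset.mem_image.mp h2
    exact ⟨i, hi⟩

theorem pos (h : IsWindow n p) {i : ℕ} (hi : 0 < i) : 0 < p i := by
  by_contra h0
  have := h.inj (show p i = p 0 by rw [h.zero]; omega)
  omega

theorem mem_deficiencies (h : IsWindow n p) {i : ℕ} : i ∈ deficiencies n p ↔ p i < i := by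
  rw [deficiencies, Finset.mem_filter, Finset.mem_Icc]
  refine ⟨fun hi => hi.2, fun hi => ⟨⟨by omega, ?_⟩, hi⟩⟩
  by_contra hlt
  have := h.fix i (by omega)
  omega

theorem exists_lt_of_deficiency (h : IsWindow n p) {i : ℕ} (hi : p i < i) :
    ∃ a < i, p i < p a := by
  by_contra! hno
  have h1 : (Finset.range i).card ≤ (Finset.range (p i)).card := by
    refine Finset.card_le_card_of_injOn p (fun a ha => ?_) h.inj.injOn
    rw [Finset.mem_coe, Finset.mem_range] at ha ⊢
    refine lt_of_le_of_ne (hno a ha) fun he => ?_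
    have := h.inj he
    omega
  rw [Finset.card_range, Finset.card_range] at h1
  omega

theorem exists_gt_of_excedance (h : IsWindow n p) {i j : ℕ} (hj : j ≤ p j) (hij : i < j)
    (hp : p j < p i) : ∃ b, j < b ∧ p b < p j := by
  by_contra! hno
  have h1 : Finset.range (p j) ⊆ ((Finset.range j).erase i).image p := by
    intro v hv
    rw [Finset.mem_range] at hv
    obtain ⟨b, rfl⟩ := h.surj v
    refine Finset.mem_image_of_mem p (Finset.mem_erase.mpr ⟨?_, Finset.mem_range.mpr ?_⟩)
    · rintro rfl
      omega
    · by_contra hb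
      rcases Nat.lt_or_ge j b with h2 | h2
      · have := hno b h2
        omega
      · have : b = j := by omega
        subst this
        omega
  have h2 := (Finset.card_le_card h1).trans Finset.card_image_le
  rw [Finset.card_erase_of_mem (Finset.mem_range.mpr hij), Finset.card_range,
    Finset.card_range] at h2
  omega

theorem inversionsSplit_iff (h : IsWindow n p) : InversionsSplit p ↔
    ¬ ∃ i j k : ℕ, 1 ≤ i ∧ i < j ∧ j < k ∧ k ≤ n ∧ p k < p j ∧ p j < p i := by
  have hn : ∀ i j, i < j → p j < p i → j ≤ n := by
    intro i j hij hp
    by_contra hlt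
    have h1 := h.fix j (by omega)
    rcases Nat.lt_or_ge n i with h2 | h2
    · have := h.fix i h2
      omega
    · have := h.le_of_le h2
      omega
  have h1 : ∀ i j, p j < p i → 1 ≤ i := by
    intro i j hp
    by_contra h0
    have : i = 0 := by omega
    rw [this, h.zero] at hp
    omega
  constructor
  · rintro hs ⟨i, j, k, -, hij, hjk, -, hkj, hji⟩
    have := hs i j hij hji
    have := hs j k hjk hkj
    omega
  · intro hno i j hij hp
    constructor
    · by_contra hi
      obtain ⟨a, ha, hpa⟩ := h.exists_lt_of_deficiency (not_le.mp hi)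
      exact hno ⟨a, i, j, h1 a i hpa, ha, hij, hn i j hij hp, hp, hpa⟩
    · by_contra hj
      obtain ⟨b, hb, hpb⟩ := h.exists_gt_of_excedance (not_lt.mp hj) hij hp
      exact hno ⟨i, j, b, h1 i j hp, hij, hb, hn j b hb hpb, hpb, hp⟩

theorem lt_iff_mem_DesSet (h : IsWindow n p) (hs : InversionsSplit p) (i : ℕ) :
    p (i + 1) < p i ↔ i ∉ deficiencies n p ∧ i + 1 ∈ deficiencies n p := by
  rw [h.mem_deficiencies, h.mem_deficiencies, not_lt]
  refine ⟨fun hp => hs i (i + 1) (by omega) hp, fun hp => ?_⟩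
  refine lt_of_le_of_ne (by omega) fun he => ?_
  have := h.inj he
  omega

theorem count_image (h : IsWindow n p) (P : Finset ℕ) (k : ℕ) :
    Nat.count (· ∈ P.image p) k = (P.filter fun a => p a < k).card := by
  rw [Nat.count_eq_card_filter_range,
    ← Finset.card_image_of_injective (P.filter fun a => p a < k) h.inj]
  congr 1
  ext v
  simp only [Finset.mem_filter, Finset.mem_range, Finset.mem_image]
  constructor
  · rintro ⟨hv, a, ha, rfl⟩
    exact ⟨a, ⟨ha, hv⟩, rfl⟩
  · rintro ⟨a, ⟨ha, hv⟩, rfl⟩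
    exact ⟨hv, a, ha, rfl⟩

end IsWindow

theorem count_eq_card_filter_lt (P : Finset ℕ) (k : ℕ) :
    Nat.count (· ∈ P) k = (P.filter fun a => a < k).card := by
  rw [Nat.count_eq_card_filter_range]
  congr 1
  ext v
  rw [Finset.mem_filter, Finset.mem_filter, Finset.mem_range, and_comm]

namespace IsWindow

theorem compat (h : IsWindow n p) :
    Compat n (deficiencies n p) ((deficiencies n p).image p) := by
  intro i _
  rw [h.count_image, count_eq_card_filter_lt]
  refine Finset.card_le_card fun a ha => ?_
  rw [Finset.mem_filter] at ha ⊢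
  have := h.mem_deficiencies.mp ha.1
  exact ⟨ha.1, by omega⟩

theorem count_image_succ (h : IsWindow n p) :
    Nat.count (· ∈ (deficiencies n p).image p) (n + 1) =
      Nat.count (· ∈ deficiencies n p) (n + 1) := by
  rw [h.count_image, count_eq_card_filter_lt]
  congr 1
  refine Finset.filter_congr fun a ha => ?_
  rw [deficiencies, Finset.mem_filter, Finset.mem_Icc] at ha
  omega

theorem contact_iff (h : IsWindow n p) (hs : InversionsSplit p) (i : ℕ) :
    Nat.count (· ∈ (deficiencies n p).image p) (i + 1) =
        Nat.count (· ∈ deficiencies n p) (i + 1) ↔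
      ∀ j ∈ Finset.Icc 1 i, ∀ k ∈ Finset.Icc (i + 1) n, p j < p k := by
  set P := deficiencies n p with hP
  have hsub : (P.filter fun a => a < i + 1) ⊆ P.filter fun a => p a < i + 1 := by
    intro a ha
    rw [Finset.mem_filter] at ha ⊢
    have := h.mem_deficiencies.mp ha.1
    exact ⟨ha.1, by omega⟩
  have h1 : Nat.count (· ∈ P.image p) (i + 1) = Nat.count (· ∈ P) (i + 1) ↔
      ∀ a, p a ≤ i → p a < a → a ≤ i := by
    rw [h.count_image, count_eq_card_filter_lt]
    constructor
    · intro he a ha hlt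
      have := Finset.eq_of_subset_of_card_le hsub he.le
      have h2 : a ∈ P.filter fun a => a < i + 1 := by
        rw [this, Finset.mem_filter]
        exact ⟨h.mem_deficiencies.mpr hlt, by omega⟩
      rw [Finset.mem_filter] at h2
      omega
    · intro ha
      refine le_antisymm (Finset.card_le_card fun a ha' => ?_) (Finset.card_le_card hsub)
      rw [Finset.mem_filter] at ha' ⊢
      have := ha a (by omega) (h.mem_deficiencies.mp ha'.1)
      exact ⟨ha'.1, by omega⟩
  rw [h1]
  constructor
  · intro ha j hj k hk
    rw [Finset.mem_Icc] at hj hk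
    by_contra hlt
    have hne : p j ≠ p k := fun he => by
      have := h.inj he
      omega
    have hinv := hs j k (by omega) (by omega)
    have hki : i < p k := by
      by_contra hki
      have := ha k (by omega) hinv.2
      omega
    have h2 : Finset.range (i + 1) ⊆ ((Finset.range (i + 1)).erase j).image p := by
      intro v hv
      rw [Finset.mem_range] at hv
      obtain ⟨b, rfl⟩ := h.surj v
      refine Finset.mem_image_of_mem p (Finset.mem_erase.mpr ⟨?_, Finset.mem_range.mpr ?_⟩)
      · rintro rfl
        omega
      · by_contra hb
        have := ha b (by omega) (by omega)
        omega
    have h3 := (Finset.card_le_card h2).trans Finset.card_image_le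
    rw [Finset.card_erase_of_mem (Finset.mem_range.mpr (by omega)), Finset.card_range] at h3
    omega
  · intro hcut a ha hlt
    by_contra hai
    have han : a ≤ n := by
      by_contra han
      have := h.fix a (by omega)
      omega
    have h2 : (Finset.range (i + 1)).card ≤ (Finset.range (p a)).card := by
      refine Finset.card_le_card_of_injOn p (fun j hj => ?_) h.inj.injOn
      rw [Finset.mem_coe, Finset.mem_range] at hj ⊢
      rcases Nat.eq_zero_or_pos j with rfl | h0
      · rw [h.zero]
        exact h.pos (by omega)
      · exact hcut j (Finset.mem_Icc.mpr ⟨h0, by omega⟩) a (Finset.mem_Icc.mpr ⟨by omega, han⟩)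
    rw [Finset.card_range, Finset.card_range] at h2
    omega

end IsWindow

/-- The map sending `P` to `S` and the complement of `P` to the complement of `S`, increasing on
both. -/
def shuffle (P S : Finset ℕ) (a : ℕ) : ℕ :=
  if a ∈ P then Nat.nth (· ∈ S) (Nat.count (· ∈ P) a)
  else Nat.nth (· ∉ S) (Nat.count (· ∉ P) a)

theorem IsWindow.eq_shuffle (h : IsWindow n p) (hs : InversionsSplit p) (a : ℕ) :
    p a = shuffle (deficiencies n p) ((deficiencies n p).image p) a := by
  set P := deficiencies n p with hP
  have hmem : ∀ b, p b ∈ P.image p ↔ b ∈ P := fun b => by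
    rw [Finset.mem_image]
    exact ⟨fun ⟨c, hc, he⟩ => h.inj he ▸ hc, fun hb => ⟨b, hb, rfl⟩⟩
  have hlt : ∀ b, (b ∈ P ↔ a ∈ P) → (p b < p a ↔ b < a) := by
    intro b hb
    rw [h.mem_deficiencies, h.mem_deficiencies] at hb
    constructor
    · intro hp
      by_contra hba
      rcases Nat.lt_or_ge a b with h1 | h1
      · have := hs a b h1 hp
        omega
      · rw [show b = a by omega] at hp
        omega
    · intro hba
      by_contra hp
      have hne : p b ≠ p a := fun he => by
        have := h.inj he
        omega
      have := hs b a hba (by omega)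
      omega
  rw [shuffle]
  split_ifs with ha
  · have hc : Nat.count (· ∈ P.image p) (p a) = Nat.count (· ∈ P) a := by
      rw [h.count_image, count_eq_card_filter_lt]
      congr 1
      refine Finset.filter_congr fun b hb => hlt b (by tauto)
    rw [← hc]
    exact (Nat.nth_count (p := (· ∈ P.image p)) ((hmem a).mpr ha)).symm
  · have hc : Nat.count (· ∉ P.image p) (p a) = Nat.count (· ∉ P) a := by
      rw [Nat.count_eq_card_filter_range, Nat.count_eq_card_filter_range,
        ← Finset.card_image_of_injective ((Finset.range a).filter (· ∉ P)) h.inj]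
      congr 1
      ext v
      obtain ⟨b, rfl⟩ := h.surj v
      have e : p b ∈ ((Finset.range a).filter (· ∉ P)).image p ↔
          b ∈ (Finset.range a).filter (· ∉ P) := by
        rw [Finset.mem_image]
        exact ⟨fun ⟨c, hc, he⟩ => h.inj he ▸ hc, fun hb => ⟨b, hb, rfl⟩⟩
      rw [e, Finset.mem_filter, Finset.mem_filter, Finset.mem_range, Finset.mem_range, hmem]
      refine and_congr_left fun hb => hlt b (by tauto)
    rw [← hc]
    exact (Nat.nth_count (p := (· ∉ P.image p)) ((hmem a).not.mpr ha)).symm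

end Windows

section Shuffles

theorem count_not_add_count (P : Finset ℕ) (a : ℕ) :
    Nat.count (· ∉ P) a + Nat.count (· ∈ P) a = a := by
  induction a with
  | zero => simp
  | succ a ih =>
    rw [Nat.count_succ, Nat.count_succ]
    split_ifs <;> omega

theorem count_eq_card {P : Finset ℕ} {n k : ℕ} (hP : P ⊆ Finset.Icc 1 n) (hk : n < k) :
    Nat.count (· ∈ P) k = P.card := by
  rw [count_eq_card_filter_lt, Finset.filter_true_of_mem]
  intro a ha
  have := (Finset.mem_Icc.mp (hP ha)).2
  omega

theorem count_lt_card {P : Finset ℕ} {a : ℕ} (ha : a ∈ P) : Nat.count (· ∈ P) a < P.card := by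
  rw [count_eq_card_filter_lt]
  refine Finset.card_lt_card (Finset.filter_ssubset.mpr ⟨a, ha, lt_irrefl a⟩)

theorem infinite_notMem (S : Finset ℕ) : (Set.ofPred (· ∉ S)).Infinite :=
  S.finite_toSet.infinite_compl

theorem nth_mem_and_count_nth {S : Finset ℕ} {c : ℕ} (hc : c < S.card) :
    Nat.nth (· ∈ S) c ∈ S ∧ Nat.count (· ∈ S) (Nat.nth (· ∈ S) c) = c := by
  have h : ∀ hf : (Set.ofPred (· ∈ S)).Finite, c < hf.toFinset.card := by
    intro hf
    have : hf.toFinset = S := by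
      ext x
      rw [Set.Finite.mem_toFinset]
      rfl
    rwa [this]
  exact ⟨Nat.nth_mem (p := (· ∈ S)) c h, Nat.count_nth h⟩

variable {P S : Finset ℕ}

theorem shuffle_mem_iff (hc : P.card = S.card) (a : ℕ) : shuffle P S a ∈ S ↔ a ∈ P := by
  rw [shuffle]
  split_ifs with ha
  · exact iff_of_true (nth_mem_and_count_nth (hc ▸ count_lt_card ha)).1 ha
  · exact iff_of_false (Nat.nth_mem_of_infinite (infinite_notMem S) _) ha

theorem count_shuffle (hc : P.card = S.card) {a : ℕ} (ha : a ∈ P) :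
    Nat.count (· ∈ S) (shuffle P S a) = Nat.count (· ∈ P) a := by
  rw [shuffle, if_pos ha]
  exact (nth_mem_and_count_nth (hc ▸ count_lt_card ha)).2

theorem count_not_shuffle {a : ℕ} (ha : a ∉ P) :
    Nat.count (· ∉ S) (shuffle P S a) = Nat.count (· ∉ P) a := by
  rw [shuffle, if_neg ha]
  exact Nat.count_nth_of_infinite (infinite_notMem S) _

theorem shuffle_shuffle (hc : P.card = S.card) (a : ℕ) :
    shuffle S P (shuffle P S a) = a := by
  by_cases ha : a ∈ P
  · rw [shuffle, if_pos ((shuffle_mem_iff hc a).mpr ha), count_shuffle hc ha]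
    exact Nat.nth_count (p := (· ∈ P)) ha
  · rw [shuffle, if_neg ((shuffle_mem_iff hc a).not.mpr ha), count_not_shuffle ha]
    exact Nat.nth_count (p := (· ∉ P)) ha

/-- The pairs `(P, S)` of deficiency positions and values of `321`-avoiding permutations. -/
def deficiencyPairs (n : ℕ) : Finset (Finset ℕ × Finset ℕ) :=
  ((Finset.Icc 1 n).powerset ×ˢ (Finset.Icc 1 n).powerset).filter fun q =>
    Compat n q.1 q.2 ∧ Nat.count (· ∈ q.2) (n + 1) = Nat.count (· ∈ q.1) (n + 1)

variable {n : ℕ}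

theorem mem_deficiencyPairs : (P, S) ∈ deficiencyPairs n ↔
    (P ⊆ Finset.Icc 1 n ∧ S ⊆ Finset.Icc 1 n) ∧ Compat n P S ∧
      Nat.count (· ∈ S) (n + 1) = Nat.count (· ∈ P) (n + 1) := by
  rw [deficiencyPairs, Finset.mem_filter, Finset.mem_product, Finset.mem_powerset,
    Finset.mem_powerset]

theorem card_eq_of_mem_deficiencyPairs (h : (P, S) ∈ deficiencyPairs n) : P.card = S.card := by
  obtain ⟨⟨hP, hS⟩, -, he⟩ := mem_deficiencyPairs.mp h
  rw [← count_eq_card hP (Nat.lt_succ_self n), ← count_eq_card hS (Nat.lt_succ_self n), he]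

theorem count_succ_le_count (h : (P, S) ∈ deficiencyPairs n) (a : ℕ) :
    Nat.count (· ∈ P) (a + 1) ≤ Nat.count (· ∈ S) a := by
  obtain ⟨⟨hP, hS⟩, hc, -⟩ := mem_deficiencyPairs.mp h
  rcases Nat.lt_or_ge n a with ha | ha
  · rw [count_eq_card hP (by omega), count_eq_card hS ha, card_eq_of_mem_deficiencyPairs h]
  · exact hc a ha

theorem shuffle_lt_iff (h : (P, S) ∈ deficiencyPairs n) (a : ℕ) :
    shuffle P S a < a ↔ a ∈ P := by
  have hc := card_eq_of_mem_deficiencyPairs h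
  have h1 := count_succ_le_count h a
  have h2 := Nat.count_succ (· ∈ P) a
  constructor
  · intro hlt
    by_contra ha
    have h3 : Nat.count (· ∉ S) (shuffle P S a) < Nat.count (· ∉ S) a :=
      Nat.count_strict_mono ((shuffle_mem_iff hc a).not.mpr ha) hlt
    rw [count_not_shuffle ha] at h3
    have := count_not_add_count P a
    have := count_not_add_count S a
    omega
  · intro ha
    by_contra hle
    have h3 := Nat.count_monotone (· ∈ S) (not_lt.mp hle)
    rw [count_shuffle hc ha] at h3
    rw [if_pos ha] at h2
    omega

theorem isWindow_shuffle (h : (P, S) ∈ deficiencyPairs n) : IsWindow n (shuffle P S) := by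
  have hc := card_eq_of_mem_deficiencyPairs h
  obtain ⟨⟨hP, hS⟩, -, -⟩ := mem_deficiencyPairs.mp h
  have hout : ∀ a, a ∉ Finset.Icc 1 n → Nat.count (· ∈ P) a = Nat.count (· ∈ S) a →
      shuffle P S a = a := by
    intro a ha he
    have h1 := count_not_add_count P a
    have h2 := count_not_add_count S a
    rw [shuffle, if_neg fun haP => ha (hP haP),
      show Nat.count (· ∉ P) a = Nat.count (· ∉ S) a by omega]
    exact Nat.nth_count (p := (· ∉ S)) fun haS => ha (hS haS)
  refine ⟨(Function.LeftInverse.injective (shuffle_shuffle hc)), hout 0 (by simp) (by simp),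
    fun i hi => hout i (by rw [Finset.mem_Icc]; omega) ?_⟩
  rw [count_eq_card hP hi, count_eq_card hS hi, hc]

theorem deficiencies_shuffle (h : (P, S) ∈ deficiencyPairs n) :
    deficiencies n (shuffle P S) = P := by
  ext a
  rw [(isWindow_shuffle h).mem_deficiencies, shuffle_lt_iff h]

theorem image_shuffle (h : (P, S) ∈ deficiencyPairs n) : P.image (shuffle P S) = S := by
  have hc := card_eq_of_mem_deficiencyPairs h
  refine Finset.eq_of_subset_of_card_le (fun v hv => ?_) ?_
  · obtain ⟨a, ha, rfl⟩ := Finset.mem_image.mp hv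
    exact (shuffle_mem_iff hc a).mpr ha
  · rw [Finset.card_image_of_injective _ (isWindow_shuffle h).inj, hc]

theorem inversionsSplit_shuffle (h : (P, S) ∈ deficiencyPairs n) :
    InversionsSplit (shuffle P S) := by
  have hc := card_eq_of_mem_deficiencyPairs h
  intro i j hij hlt
  rw [shuffle_lt_iff h, ← not_lt, shuffle_lt_iff h]
  by_cases hi : i ∈ P
  · have h1 : Nat.count (· ∈ P) i < Nat.count (· ∈ P) j := Nat.count_strict_mono hi hij
    by_cases hj : j ∈ P
    · have h2 := Nat.count_monotone (· ∈ S) hlt.le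
      rw [count_shuffle hc hi, count_shuffle hc hj] at h2
      omega
    · rw [← shuffle_lt_iff h] at hi hj
      omega
  · refine ⟨hi, ?_⟩
    by_contra hj
    have h1 : Nat.count (· ∉ P) i < Nat.count (· ∉ P) j := Nat.count_strict_mono hi hij
    have h2 := Nat.count_monotone (· ∉ S) hlt.le
    rw [count_not_shuffle hi, count_not_shuffle hj] at h2
    omega

end Shuffles

section SignedPermutations

/-- The odd extension of `σ : ℕ → ℕ` to the integers. -/
def oddExtend (σ : ℕ → ℕ) (z : ℤ) : ℤ := z.sign * σ z.natAbs

theorem oddExtend_natCast {σ : ℕ → ℕ} (h0 : σ 0 = 0) (a : ℕ) : oddExtend σ a = σ a := by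
  rcases Nat.eq_zero_or_pos a with rfl | ha
  · simp [oddExtend, h0]
  · simp [oddExtend, Int.sign_natCast_of_ne_zero ha.ne']

theorem oddExtend_neg (σ : ℕ → ℕ) (z : ℤ) : oddExtend σ (-z) = -oddExtend σ z := by
  simp [oddExtend]

theorem oddExtend_oddExtend {σ τ : ℕ → ℕ} (h0 : σ 0 = 0) (h0' : τ 0 = 0)
    (h : ∀ a, τ (σ a) = a) (z : ℤ) : oddExtend τ (oddExtend σ z) = z := by
  obtain ⟨a, rfl | rfl⟩ := z.eq_nat_or_neg
  · rw [oddExtend_natCast h0, oddExtend_natCast h0', h]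
  · rw [oddExtend_neg, oddExtend_natCast h0, oddExtend_neg, oddExtend_natCast h0', h]

/-- The window of a permutation of the integers, as a function on the naturals. -/
def window (π : Equiv.Perm ℤ) (i : ℕ) : ℕ := (π i).toNat

variable {n : ℕ} {π : Equiv.Perm ℤ}

theorem InB.map_zero_s2 (h : InB n π) : π 0 = 0 := by
  have := h.1 0
  rw [neg_zero] at this
  omega

theorem InS.window_cast (h : InS n π) (i : ℕ) : (window π i : ℤ) = π i := by
  rw [window, Int.toNat_of_nonneg]
  rcases Nat.eq_zero_or_pos i with rfl | h0
  · rw [Nat.cast_zero, h.1.map_zero_s2]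
  · rcases Nat.lt_or_ge n i with h1 | h1
    · rw [h.1.2 i (by rw [Nat.abs_cast]; omega)]
      omega
    · exact (h.2 i h0 h1).le

theorem InS.isWindow (h : InS n π) : IsWindow n (window π) := by
  refine ⟨fun i j hij => ?_, ?_, fun i hi => ?_⟩
  · have : π i = π j := by rw [← h.window_cast, ← h.window_cast, hij]
    exact_mod_cast π.injective this
  · have := h.window_cast 0
    rw [Nat.cast_zero, h.1.map_zero_s2] at this
    exact_mod_cast this
  · have := h.window_cast i
    rw [h.1.2 i (by rw [Nat.abs_cast]; omega)] at this
    exact_mod_cast this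

theorem InS.eq_of_window_eq {ρ : Equiv.Perm ℤ} (h : InS n π) (h' : InS n ρ)
    (he : window π = window ρ) : π = ρ := by
  have hnat : ∀ a : ℕ, π a = ρ a := fun a => by rw [← h.window_cast, ← h'.window_cast, he]
  ext z
  obtain ⟨a, rfl | rfl⟩ := z.eq_nat_or_neg
  · exact hnat a
  · rw [h.1.1, h'.1.1, hnat]

theorem InS.avoids321_iff (h : InS n π) : Avoids321 n π ↔ InversionsSplit (window π) := by
  rw [h.isWindow.inversionsSplit_iff, Avoids321]
  simp only [← h.window_cast, Nat.cast_lt]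

theorem InS.DesA_eq (h : InS n π) (ha : Avoids321 n π) :
    DesA n π = DesSet n (deficiencies n (window π)) := by
  have hw : ∀ i, went π i = window π i := by
    intro i
    rw [went, h.window_cast]
    split_ifs with hi
    · rw [hi, Nat.cast_zero, h.1.map_zero_s2]
    · rfl
  refine Finset.filter_congr fun i _ => ?_
  rw [hw, hw, Nat.cast_lt]
  exact h.isWindow.lt_iff_mem_DesSet (h.avoids321_iff.mp ha) i

theorem InS.bl_eq (hn : 0 < n) (h : InS n π) (ha : Avoids321 n π) :
    bl n π = contacts n (deficiencies n (window π))
      ((deficiencies n (window π)).image (window π)) := by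
  have hIcc : Finset.Icc 1 n = insert n (Finset.Ioo 0 n) := by
    ext i
    rw [Finset.mem_Icc, Finset.mem_insert, Finset.mem_Ioo]
    omega
  rw [contacts, hIcc, Finset.filter_insert, if_pos h.isWindow.count_image_succ,
    Finset.card_insert_of_notMem (by simp), bl, add_comm]
  congr 2
  ext i
  simp only [Finset.mem_filter, h.isWindow.contact_iff (h.avoids321_iff.mp ha),
    ← h.window_cast, Nat.cast_lt]

/-- Sending a `321`-avoiding permutation to its deficiency positions and values. -/
theorem bijOn_deficiencyPairs (n : ℕ) :
    Set.BijOn (fun π => (deficiencies n (window π), (deficiencies n (window π)).image (window π)))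
      {π | InS n π ∧ Avoids321 n π} (deficiencyPairs n) := by
  refine ⟨?_, ?_, ?_⟩
  · rintro π ⟨h, -⟩
    rw [Finset.mem_coe, mem_deficiencyPairs]
    refine ⟨⟨Finset.filter_subset _ _, fun v hv => ?_⟩, h.isWindow.compat,
      h.isWindow.count_image_succ⟩
    obtain ⟨a, ha, rfl⟩ := Finset.mem_image.mp hv
    have ha := Finset.mem_Icc.mp (Finset.filter_subset _ _ ha)
    exact Finset.mem_Icc.mpr ⟨h.isWindow.pos ha.1, h.isWindow.le_of_le ha.2⟩
  · rintro π ⟨h, ha⟩ ρ ⟨h', ha'⟩ he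
    rw [Prod.mk.injEq] at he
    refine h.eq_of_window_eq h' (funext fun a => ?_)
    rw [h.isWindow.eq_shuffle (h.avoids321_iff.mp ha) a, he.2, he.1,
      ← h'.isWindow.eq_shuffle (h'.avoids321_iff.mp ha') a]
  · rintro ⟨P, S⟩ hPS
    rw [Finset.mem_coe] at hPS
    have hc := card_eq_of_mem_deficiencyPairs hPS
    have hw := isWindow_shuffle hPS
    have h0' : shuffle S P 0 = 0 := by
      have := shuffle_shuffle hc 0
      rwa [hw.zero] at this
    let π : Equiv.Perm ℤ :=
      { toFun := oddExtend (shuffle P S)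
        invFun := oddExtend (shuffle S P)
        left_inv := oddExtend_oddExtend hw.zero h0' (shuffle_shuffle hc)
        right_inv := oddExtend_oddExtend h0' hw.zero (shuffle_shuffle hc.symm) }
    have hπ : ∀ a : ℕ, π a = shuffle P S a := oddExtend_natCast hw.zero
    have hodd : ∀ z : ℤ, π (-z) = -π z := oddExtend_neg _
    have hwin : window π = shuffle P S := funext fun a => by
      rw [window, hπ, Int.toNat_natCast]
    have hS : InS n π := by
      refine ⟨⟨hodd, fun z hz => ?_⟩, fun i hi _ => ?_⟩
      · obtain ⟨a, rfl | rfl⟩ := z.eq_nat_or_neg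
        · rw [Nat.abs_cast] at hz
          rw [hπ, hw.fix a (by omega)]
        · rw [abs_neg, Nat.abs_cast] at hz
          rw [hodd, hπ, hw.fix a (by omega)]
      · rw [hπ]
        exact_mod_cast hw.pos hi
    refine ⟨π, ⟨hS, hS.avoids321_iff.mpr (hwin ▸ inversionsSplit_shuffle hPS)⟩, ?_⟩
    simp only [hwin, deficiencies_shuffle hPS, image_shuffle hPS]

end SignedPermutations

section Coefficients

open Polynomial

theorem DesSet_subset (n : ℕ) (P : Finset ℕ) : DesSet n P ⊆ Finset.Ico 1 n :=
  Finset.filter_subset _ _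

theorem coeff_FA {n : ℕ} {J : Finset ℕ} (hJ : J ⊆ Finset.Ico 1 n) (m : ℕ →₀ ℕ) :
    MvPowerSeries.coeff m (FA ℤ[X] n J) =
      if ValidContent n (partialSum m) ∧ ∀ j ∈ J, ∃ v, partialSum m v = j then 1 else 0 := by
  refine (congrArg (Nat.cast : ℕ → ℤ[X]) (card_fundamental n J hJ m)).trans ?_
  rw [Nat.cast_ite, Nat.cast_one, Nat.cast_zero]

theorem coeff_schurS (lam : ℕ → ℕ) (m : ℕ →₀ ℕ) :
    MvPowerSeries.coeff m (schurS ℤ[X] 1 lam) = (schurCoeff 1 lam m : ℤ[X]) := rfl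

theorem sum_deficiencyPairs (n : ℕ) (D : ℕ → Prop) :
    ∑ q ∈ deficiencyPairs n, X ^ contacts n q.1 q.2 *
        (if ∀ j ∈ DesSet n q.1, D j then 1 else 0 : ℤ[X]) =
      (descSum ℤ[X] D n).eval X := by
  rw [descSum, eval_finsetSum, deficiencyPairs, Finset.sum_filter, Finset.sum_product]
  refine Finset.sum_congr rfl fun P hP => ?_
  have h0 : 0 ∉ P := fun h => by
    have := (Finset.mem_Icc.mp (Finset.mem_powerset.mp hP h)).1
    omega
  rw [← Finset.sum_filter]
  dsimp only
  by_cases hD : ∀ j ∈ DesSet n P, D j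
  · simp only [if_pos hD, mul_one, sum_contacts X n P h0]
  · simp only [if_neg hD, mul_zero, Finset.sum_const_zero, eval_zero]

theorem finsum_eq_sum_deficiencyPairs {n : ℕ} (hn : 0 < n) :
    (∑ᶠ π ∈ {π : Equiv.Perm ℤ | InS n π ∧ Avoids321 n π},
        (X ^ bl n π : ℤ[X]) • FA ℤ[X] n (DesA n π)) =
      ∑ q ∈ deficiencyPairs n, (X ^ contacts n q.1 q.2 : ℤ[X]) • FA ℤ[X] n (DesSet n q.1) := by
  rw [← finsum_mem_coe_finset]
  refine finsum_mem_eq_of_bijOn _ (bijOn_deficiencyPairs n) ?_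
  rintro π ⟨h, ha⟩
  rw [h.bl_eq hn ha, h.DesA_eq ha]

end Coefficients

theorem schur_positivity_FC_Sn (n : ℕ) (hn : 0 < n) :
    (∑ᶠ π ∈ {π : Equiv.Perm ℤ | InS n π ∧ Avoids321 n π},
        (Polynomial.X ^ bl n π : Polynomial ℤ) • FA (Polynomial ℤ) n (DesA n π)) =
      ∑ k ∈ Finset.range (n / 2 + 1),
        (∑ j ∈ Finset.range (n + 1), (aCoeff n k j : Polynomial ℤ) * Polynomial.X ^ j) •
          schurS (Polynomial ℤ) 1 (twoRow (n - k) k) := by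
  rw [finsum_eq_sum_deficiencyPairs hn]
  ext1 m
  rw [map_sum, map_sum]
  simp only [MvPowerSeries.coeff_smul, coeff_FA (DesSet_subset n _), coeff_schurS]
  by_cases hv : ValidContent n (partialSum m)
  · obtain ⟨h0, V, hV⟩ := id hv
    simp only [hv, true_and]
    have hdesc := descSum_eq_sum_rowSeqs (R := Polynomial ℤ) (partialSum m) h0
      (partialSum_mono m) V
    rw [hV V le_rfl] at hdesc
    rw [sum_deficiencyPairs, hdesc, Polynomial.eval_finsetSum]
    refine Finset.sum_congr rfl fun k hk => ?_
    have hk' : 2 * k ≤ n := by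
      rw [Finset.mem_range] at hk
      omega
    rw [Polynomial.eval_smul, sum_aCoeff n k hk', schurCoeff_twoRow hk' m h0 hV, nsmul_eq_mul,
      mul_comm]
  · simp only [hv, false_and, if_false, mul_zero, Finset.sum_const_zero]
    refine (Finset.sum_eq_zero fun k hk => ?_).symm
    rw [Finset.mem_range] at hk
    rw [schurCoeff_of_not_valid (by omega) m hv, Nat.cast_zero, mul_zero]

end Paper
end
end
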